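/- arXiv:hep-th/0602093 — 13 statements merged into one kernel-verified Lean document; each statement's English description precedes it below -/
import Mathlib

section
/- Let A be an associative unital algebra over ℂ, let X and Y be 2×2 matrices with entries in A, and let R be an invertible 4×4 complex matrix such that R·(X⊗I₂)·(I₂⊗Y) = (I₂⊗Y)·(X⊗I₂)·R holds as an identity of 4×4 matrices over A. Then the traces commute in A: (X₁₁+X₂₂)·(Y₁₁+Y₂₂) = (Y₁₁+Y₂₂)·(X₁₁+X₂₂). (This is the algebraic core of Lemma 1 of the paper: the coefficients T_m of the transfer matrix T(u) = tr M(u) mutually commute whenever the monodromy matrix satisfies the RLL exchange relation with an invertible R-matrix.) -/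
open Matrix
open scoped Kronecker

theorem trace_mul_map_comm_aux {A : Type*} [Ring A] [Algebra ℂ A] {n : Type*} [Fintype n]
    (M : Matrix n n A) (S : Matrix n n ℂ) :
    (M * S.map (algebraMap ℂ A)).trace = (S.map (algebraMap ℂ A) * M).trace := by
  simp only [Matrix.trace, Matrix.diag, Matrix.mul_apply, Matrix.map_apply]
  rw [Finset.sum_comm]
  refine Finset.sum_congr rfl fun i _ => Finset.sum_congr rfl fun j _ => ?_
  exact (Algebra.commutes _ _).symm

/-- If a 2×2 monodromy-type exchange relation
`R·(X⊗I₂)·(I₂⊗Y) = (I₂⊗Y)·(X⊗I₂)·R` holds with an invertible complex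
4×4 matrix `R`, then the traces of `X` and `Y` commute. -/
theorem trace_commute_of_RLL
    (A : Type*) [Ring A] [Algebra ℂ A]
    (X Y : Matrix (Fin 2) (Fin 2) A)
    (R : Matrix (Fin 2 × Fin 2) (Fin 2 × Fin 2) ℂ) (hR : IsUnit R)
    (hRLL : R.map (algebraMap ℂ A) *
          (X ⊗ₖ (1 : Matrix (Fin 2) (Fin 2) A)) *
          ((1 : Matrix (Fin 2) (Fin 2) A) ⊗ₖ Y) =
        ((1 : Matrix (Fin 2) (Fin 2) A) ⊗ₖ Y) *
          (X ⊗ₖ (1 : Matrix (Fin 2) (Fin 2) A)) *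
          R.map (algebraMap ℂ A)) :
    (X 0 0 + X 1 1) * (Y 0 0 + Y 1 1) = (Y 0 0 + Y 1 1) * (X 0 0 + X 1 1) := by
  obtain ⟨u, rfl⟩ := hR
  obtain ⟨R, S, hRS, hSR⟩ := u
  simp only at hRLL
  have h1 : S.map (algebraMap ℂ A) * R.map (algebraMap ℂ A) = 1 := by
    rw [← Matrix.map_mul, hSR]
    simp
  have h2 : R.map (algebraMap ℂ A) * S.map (algebraMap ℂ A) = 1 := by
    rw [← Matrix.map_mul, hRS]
    simp
  have key : ((X ⊗ₖ (1 : Matrix (Fin 2) (Fin 2) A)) *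
      ((1 : Matrix (Fin 2) (Fin 2) A) ⊗ₖ Y)).trace =
      (((1 : Matrix (Fin 2) (Fin 2) A) ⊗ₖ Y) * (X ⊗ₖ (1 : Matrix (Fin 2) (Fin 2) A))).trace := by
    generalize X ⊗ₖ (1 : Matrix (Fin 2) (Fin 2) A) = P at hRLL ⊢
    generalize (1 : Matrix (Fin 2) (Fin 2) A) ⊗ₖ Y = Q at hRLL ⊢
    calc (P * Q).trace = (S.map (algebraMap ℂ A) * (R.map (algebraMap ℂ A) * P * Q)).trace := by
          rw [Matrix.mul_assoc (R.map _), ← Matrix.mul_assoc, h1, Matrix.one_mul]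
      _ = (Q * P * R.map (algebraMap ℂ A) * S.map (algebraMap ℂ A)).trace := by
          rw [hRLL, trace_mul_map_comm_aux]
      _ = (Q * P).trace := by
          rw [Matrix.mul_assoc (Q * P), h2, Matrix.mul_one]
  simp [Matrix.trace, Matrix.mul_apply, Fintype.sum_prod_type, Matrix.one_apply] at key
  simp only [add_mul, mul_add]
  rw [← sub_eq_zero] at key ⊢
  rw [← key]
  abel
end

section
/- For all u, v ∈ ℂ, the exchange relation R(u−v)·(L(u)⊗I₂)·(I₂⊗L(v)) = (I₂⊗L(v))·(L(u)⊗I₂)·R(u−v) holds as an identity of 4×4 matrices over A, where L(u) is the XXZ L-matrix and R(u) is the XXZ auxiliary R-matrix. -/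
open Matrix
open scoped Kronecker

/-- `q = exp(iπb²)`. -/
noncomputable def qc (b : ℝ) : ℂ := Complex.exp (Complex.I * ((Real.pi * b ^ 2 : ℝ) : ℂ))

/-- The XXZ L-matrix. -/
noncomputable def xxzL {A : Type*} [Ring A] [Algebra ℂ A]
    (b : ℝ) (e f k kinv : A) (u : ℂ) : Matrix (Fin 2) (Fin 2) A :=
  !![Complex.exp (((Real.pi * b : ℝ) : ℂ) * u) • k -
       Complex.exp (-(((Real.pi * b : ℝ) : ℂ) * u)) • kinv,
     (Complex.I * Complex.exp (((Real.pi * b : ℝ) : ℂ) * u)) • f;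
     (Complex.I * Complex.exp (-(((Real.pi * b : ℝ) : ℂ) * u))) • e,
     Complex.exp (((Real.pi * b : ℝ) : ℂ) * u) • kinv -
       Complex.exp (-(((Real.pi * b : ℝ) : ℂ) * u)) • k]

/-- The XXZ auxiliary R-matrix. -/
noncomputable def xxzR (b : ℝ) (u : ℂ) : Matrix (Fin 2 × Fin 2) (Fin 2 × Fin 2) ℂ :=
  Matrix.of fun p q =>
    if (p = ((0 : Fin 2), (0 : Fin 2)) ∧ q = ((0 : Fin 2), (0 : Fin 2))) ∨
        (p = ((1 : Fin 2), (1 : Fin 2)) ∧ q = ((1 : Fin 2), (1 : Fin 2))) then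
      Complex.sinh (((Real.pi * b : ℝ) : ℂ) * (u + Complex.I * (b : ℂ)))
    else if (p = ((0 : Fin 2), (1 : Fin 2)) ∧ q = ((0 : Fin 2), (1 : Fin 2))) ∨
        (p = ((1 : Fin 2), (0 : Fin 2)) ∧ q = ((1 : Fin 2), (0 : Fin 2))) then
      Complex.sinh (((Real.pi * b : ℝ) : ℂ) * u)
    else if p = ((0 : Fin 2), (1 : Fin 2)) ∧ q = ((1 : Fin 2), (0 : Fin 2)) then
      Complex.I * ((Real.sin (Real.pi * b ^ 2) : ℝ) : ℂ) *
        Complex.exp (((Real.pi * b : ℝ) : ℂ) * u)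
    else if p = ((1 : Fin 2), (0 : Fin 2)) ∧ q = ((0 : Fin 2), (1 : Fin 2)) then
      Complex.I * ((Real.sin (Real.pi * b ^ 2) : ℝ) : ℂ) *
        Complex.exp (-(((Real.pi * b : ℝ) : ℂ) * u))
    else 0

theorem xxz_mul_algebraMap {A : Type*} [Ring A] [Algebra ℂ A] (x : A) (r : ℂ) :
    x * algebraMap ℂ A r = r • x := by
  rw [Algebra.smul_def, Algebra.commutes]

theorem xxz_algebraMap_mul {A : Type*} [Ring A] [Algebra ℂ A] (x : A) (r : ℂ) :
    algebraMap ℂ A r * x = r • x := by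
  rw [Algebra.smul_def]

/-- The XXZ L-matrix satisfies the RLL exchange relation with the
XXZ auxiliary R-matrix. -/
theorem xxz_exchange_relation (b : ℝ) (hb0 : 0 < b) (hb1 : b < 1)
    (A : Type*) [Ring A] [Algebra ℂ A]
    (e f k kinv : A) (hk : k * kinv = 1) (hk' : kinv * k = 1)
    (hke : k * e = qc b • (e * k))
    (hkf : k * f = (qc b)⁻¹ • (f * k))
    (hef : e * f - f * e = (qc b - (qc b)⁻¹) • (kinv * kinv - k * k)) :
    ∀ u v : ℂ,
      (xxzR b (u - v)).map (algebraMap ℂ A) *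
          (xxzL b e f k kinv u ⊗ₖ (1 : Matrix (Fin 2) (Fin 2) A)) *
          ((1 : Matrix (Fin 2) (Fin 2) A) ⊗ₖ xxzL b e f k kinv v) =
        ((1 : Matrix (Fin 2) (Fin 2) A) ⊗ₖ xxzL b e f k kinv v) *
          (xxzL b e f k kinv u ⊗ₖ (1 : Matrix (Fin 2) (Fin 2) A)) *
          (xxzR b (u - v)).map (algebraMap ℂ A) := by
  intro u v
  have hq0 : qc b ≠ 0 := Complex.exp_ne_zero _
  have hU0 : Complex.exp (((Real.pi * b : ℝ) : ℂ) * u) ≠ 0 := Complex.exp_ne_zero _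
  have hV0 : Complex.exp (((Real.pi * b : ℝ) : ℂ) * v) ≠ 0 := Complex.exp_ne_zero _
  have hx : Complex.exp (((Real.pi * b : ℝ) : ℂ) * (u - v)) =
      Complex.exp (((Real.pi * b : ℝ) : ℂ) * u) / Complex.exp (((Real.pi * b : ℝ) : ℂ) * v) := by
    rw [mul_sub, Complex.exp_sub]
  have hs : Complex.I * ((Real.sin (Real.pi * b ^ 2) : ℝ) : ℂ) = (qc b - (qc b)⁻¹) / 2 := by
    rw [qc, ← Complex.exp_neg, Complex.ofReal_sin, Complex.sin]
    have h1 : -((Real.pi * b ^ 2 : ℝ) : ℂ) * Complex.I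
        = -(Complex.I * ((Real.pi * b ^ 2 : ℝ) : ℂ)) := by ring
    rw [h1, mul_comm ((Real.pi * b ^ 2 : ℝ) : ℂ) Complex.I]
    linear_combination (Complex.exp (-(Complex.I * ((Real.pi * b ^ 2 : ℝ) : ℂ))) -
      Complex.exp (Complex.I * ((Real.pi * b ^ 2 : ℝ) : ℂ))) / 2 * Complex.I_mul_I
  have hxq : Complex.exp (((Real.pi * b : ℝ) : ℂ) * ((u - v) + Complex.I * (b : ℂ))) =
      Complex.exp (((Real.pi * b : ℝ) : ℂ) * u) / Complex.exp (((Real.pi * b : ℝ) : ℂ) * v)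
        * qc b := by
    rw [← hx, qc, ← Complex.exp_add]
    congr 1
    push_cast
    ring
  have hkie : kinv * e = (qc b)⁻¹ • (e * kinv) := by
    have : e * kinv = qc b • (kinv * e) := by
      calc e * kinv = kinv * (k * e) * kinv := by rw [← mul_assoc kinv, hk', one_mul]
        _ = qc b • (kinv * e) := by
          rw [hke, mul_smul_comm, smul_mul_assoc, mul_assoc, mul_assoc e, hk, mul_one]
    rw [this, smul_smul, inv_mul_cancel₀ hq0, one_smul]
  have hkif : kinv * f = qc b • (f * kinv) := by
    have : f * kinv = (qc b)⁻¹ • (kinv * f) := by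
      calc f * kinv = kinv * (k * f) * kinv := by rw [← mul_assoc kinv, hk', one_mul]
        _ = (qc b)⁻¹ • (kinv * f) := by
          rw [hkf, mul_smul_comm, smul_mul_assoc, mul_assoc, mul_assoc f, hk, mul_one]
    rw [this, smul_smul, mul_inv_cancel₀ hq0, one_smul]
  have hef' : e * f = f * e + (qc b - (qc b)⁻¹) • (kinv * kinv - k * k) := by
    rw [← hef]; abel
  have hI : Complex.I ^ 2 = -1 := Complex.I_sq
  ext ⟨i, j⟩ ⟨m, n⟩
  fin_cases i <;> fin_cases j <;> fin_cases m <;> fin_cases n <;>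
  · simp [Matrix.mul_apply, Fintype.sum_prod_type, Fin.sum_univ_two, xxzR, xxzL,
      Matrix.one_apply, Complex.sinh, -Complex.ofReal_sin, hs, hxq, hx, Complex.exp_neg,
      -Complex.ofReal_mul, -map_mul, -map_sub, -map_div₀, -map_inv₀]
    try simp only [xxz_mul_algebraMap, xxz_algebraMap_mul, mul_sub, sub_mul, mul_add, add_mul,
      smul_mul_assoc, mul_smul_comm, hk, hk', hke, hkf, hkie, hkif, hef', smul_sub, smul_add]
    try generalize Complex.exp (((Real.pi * b : ℝ) : ℂ) * u) = U at *
    try generalize Complex.exp (((Real.pi * b : ℝ) : ℂ) * v) = V at *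
    try generalize qc b = q at *
    try match_scalars <;> field_simp <;> (try simp only [hI]) <;> ring
end

section
/- For all u, v ∈ ℂ, the exchange relation R(u−v)·(L(u)⊗I₂)·(I₂⊗L(v)) = (I₂⊗L(v))·(L(u)⊗I₂)·R(u−v) holds as an identity of 4×4 matrices over A, where L(u) is the sinh–Gordon L-matrix and R(u) is the symmetric auxiliary R-matrix. -/
open Matrix
open scoped Kronecker

/-- The sinh–Gordon L-matrix. -/
noncomputable def sgL {A : Type*} [Ring A] [Algebra ℂ A]
    (b s : ℝ) (e f k kinv : A) (u : ℂ) : Matrix (Fin 2) (Fin 2) A :=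
  !![((Real.exp (-(Real.pi * b * s)) : ℝ) : ℂ) • e,
     (-Complex.I * ((Real.exp (-(Real.pi * b * s)) : ℝ) : ℂ)) •
       (Complex.exp (((Real.pi * b : ℝ) : ℂ) * u) • kinv -
        Complex.exp (-(((Real.pi * b : ℝ) : ℂ) * u)) • k);
     (-Complex.I * ((Real.exp (-(Real.pi * b * s)) : ℝ) : ℂ)) •
       (Complex.exp (((Real.pi * b : ℝ) : ℂ) * u) • k -
        Complex.exp (-(((Real.pi * b : ℝ) : ℂ) * u)) • kinv),
     ((Real.exp (-(Real.pi * b * s)) : ℝ) : ℂ) • f]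

/-- The symmetric auxiliary R-matrix. -/
noncomputable def symR (b : ℝ) (u : ℂ) : Matrix (Fin 2 × Fin 2) (Fin 2 × Fin 2) ℂ :=
  Matrix.of fun p q =>
    if (p = ((0 : Fin 2), (0 : Fin 2)) ∧ q = ((0 : Fin 2), (0 : Fin 2))) ∨
        (p = ((1 : Fin 2), (1 : Fin 2)) ∧ q = ((1 : Fin 2), (1 : Fin 2))) then
      Complex.sinh (((Real.pi * b : ℝ) : ℂ) * (u + Complex.I * (b : ℂ)))
    else if (p = ((0 : Fin 2), (1 : Fin 2)) ∧ q = ((0 : Fin 2), (1 : Fin 2))) ∨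
        (p = ((1 : Fin 2), (0 : Fin 2)) ∧ q = ((1 : Fin 2), (0 : Fin 2))) then
      Complex.sinh (((Real.pi * b : ℝ) : ℂ) * u)
    else if (p = ((0 : Fin 2), (1 : Fin 2)) ∧ q = ((1 : Fin 2), (0 : Fin 2))) ∨
        (p = ((1 : Fin 2), (0 : Fin 2)) ∧ q = ((0 : Fin 2), (1 : Fin 2))) then
      Complex.I * ((Real.sin (Real.pi * b ^ 2) : ℝ) : ℂ)
    else 0

set_option maxHeartbeats 4000000 in
/-- The sinh–Gordon L-matrix satisfies the RLL exchange relation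
with the symmetric auxiliary R-matrix. -/
theorem sg_exchange_relation (b : ℝ) (hb0 : 0 < b) (hb1 : b < 1) (s : ℝ)
    (A : Type*) [Ring A] [Algebra ℂ A]
    (e f k kinv : A) (hk : k * kinv = 1) (hk' : kinv * k = 1)
    (hke : k * e = qc b • (e * k))
    (hkf : k * f = (qc b)⁻¹ • (f * k))
    (hef : e * f - f * e = (qc b - (qc b)⁻¹) • (kinv * kinv - k * k)) :
    ∀ u v : ℂ,
      (symR b (u - v)).map (algebraMap ℂ A) *
          (sgL b s e f k kinv u ⊗ₖ (1 : Matrix (Fin 2) (Fin 2) A)) *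
          ((1 : Matrix (Fin 2) (Fin 2) A) ⊗ₖ sgL b s e f k kinv v) =
        ((1 : Matrix (Fin 2) (Fin 2) A) ⊗ₖ sgL b s e f k kinv v) *
          (sgL b s e f k kinv u ⊗ₖ (1 : Matrix (Fin 2) (Fin 2) A)) *
          (symR b (u - v)).map (algebraMap ℂ A) := by
  intro u v
  have hq : qc b ≠ 0 := Complex.exp_ne_zero _
  have hKe : kinv * e = (qc b)⁻¹ • (e * kinv) := by
    have h1 : kinv * (k * e) * kinv = qc b • (kinv * e) := by
      rw [hke, mul_smul_comm, smul_mul_assoc, mul_assoc, mul_assoc, hk, mul_one]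
    rw [← mul_assoc, hk', one_mul] at h1
    rw [h1, smul_smul, inv_mul_cancel₀ hq, one_smul]
  have hKf : kinv * f = qc b • (f * kinv) := by
    have h1 : kinv * (k * f) * kinv = (qc b)⁻¹ • (kinv * f) := by
      rw [hkf, mul_smul_comm, smul_mul_assoc, mul_assoc, mul_assoc, hk, mul_one]
    rw [← mul_assoc, hk', one_mul] at h1
    rw [h1, smul_smul, mul_inv_cancel₀ hq, one_smul]
  have hef' : e * f = f * e + (qc b - (qc b)⁻¹) • (kinv * kinv - k * k) := by
    rw [← hef]; abel
  have hx : Complex.exp (((Real.pi * b : ℝ) : ℂ) * u) ≠ 0 := Complex.exp_ne_zero _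
  have hy : Complex.exp (((Real.pi * b : ℝ) : ℂ) * v) ≠ 0 := Complex.exp_ne_zero _
  have hqe : Complex.exp (((Real.pi * b : ℝ) : ℂ) * (Complex.I * (b : ℂ))) = qc b := by
    unfold qc; congr 1; push_cast; ring
  have hb : Complex.sinh (((Real.pi * b : ℝ) : ℂ) * (u - v)) =
      (Complex.exp (((Real.pi * b : ℝ) : ℂ) * u) * (Complex.exp (((Real.pi * b : ℝ) : ℂ) * v))⁻¹
       - (Complex.exp (((Real.pi * b : ℝ) : ℂ) * u))⁻¹ * Complex.exp (((Real.pi * b : ℝ) : ℂ) * v)) / 2 := by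
    rw [Complex.sinh, ← Complex.exp_neg, ← Complex.exp_neg, ← Complex.exp_add, ← Complex.exp_add]
    ring_nf
  have ha : Complex.sinh (((Real.pi * b : ℝ) : ℂ) * (u - v + Complex.I * (b : ℂ))) =
      (Complex.exp (((Real.pi * b : ℝ) : ℂ) * u) * (Complex.exp (((Real.pi * b : ℝ) : ℂ) * v))⁻¹ * qc b
       - (Complex.exp (((Real.pi * b : ℝ) : ℂ) * u))⁻¹ * Complex.exp (((Real.pi * b : ℝ) : ℂ) * v) * (qc b)⁻¹) / 2 := by
    rw [← hqe, Complex.sinh, ← Complex.exp_neg, ← Complex.exp_neg, ← Complex.exp_neg,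
      ← Complex.exp_add, ← Complex.exp_add, ← Complex.exp_add, ← Complex.exp_add]
    ring_nf
  have hc : Complex.I * ((Real.sin (Real.pi * b ^ 2) : ℝ) : ℂ) = (qc b - (qc b)⁻¹) / 2 := by
    unfold qc
    rw [← Complex.exp_neg, Complex.ofReal_sin, Complex.sin, mul_comm Complex.I (((Real.pi * b ^ 2 : ℝ) : ℂ)),
      ← neg_mul]
    linear_combination (Complex.exp (-((Real.pi * b ^ 2 : ℝ) : ℂ) * Complex.I) -
      Complex.exp (((Real.pi * b ^ 2 : ℝ) : ℂ) * Complex.I)) / 2 * Complex.I_mul_I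
  unfold symR sgL
  rw [ha, hb, hc]
  simp only [Complex.exp_neg]
  generalize Complex.exp (((Real.pi * b : ℝ) : ℂ) * u) = x at *
  generalize Complex.exp (((Real.pi * b : ℝ) : ℂ) * v) = y at *
  generalize ((Real.exp (-(Real.pi * b * s)) : ℝ) : ℂ) = g at *
  clear ha hb hc hqe
  generalize qc b = q at *
  have hI : Complex.I ^ 2 = -1 := Complex.I_sq
  ext ⟨i, j⟩ ⟨i', j'⟩
  fin_cases i <;> fin_cases j <;> fin_cases i' <;> fin_cases j' <;>
    simp [Matrix.mul_apply, Fintype.sum_prod_type, Fin.sum_univ_two, Matrix.one_apply,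
      Algebra.algebraMap_eq_smul_one, -neg_smul, -smul_neg] <;>
    simp only [mul_sub, sub_mul, smul_sub, smul_add, mul_add, add_mul, smul_mul_assoc, mul_smul_comm,
      one_mul, mul_one, neg_mul, mul_neg, hke, hkf, hKe, hKf, hef', hk, hk'] <;>
    match_scalars <;> field_simp <;> (try simp only [hI]) <;> ring
end

section
/- Let ξ ∈ ℂ and suppose M : ℂ → (2×2 matrices over A) satisfies, for all u, v ∈ ℂ, the exchange relation R(u−v;ξ)·(M(u)⊗I₂)·(I₂⊗M(v)) = (I₂⊗M(v))·(M(u)⊗I₂)·R(u−v;ξ). Then the quantum determinant det_q M(u) := M(u)₁₁·M(u−ib)₂₂ − exp(−iπb²ξ)·M(u)₁₂·M(u−ib)₂₁ is central: for all u, v ∈ ℂ and all i, j ∈ {1,2}, det_q M(u) commutes with M(v)_{ij} in A. -/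
open Matrix
open scoped Kronecker

/-- The twisted auxiliary R-matrix `R(u;ξ)`. -/
noncomputable def Rxi (b : ℝ) (ξ u : ℂ) : Matrix (Fin 2 × Fin 2) (Fin 2 × Fin 2) ℂ :=
  Matrix.of fun p q =>
    if (p = ((0 : Fin 2), (0 : Fin 2)) ∧ q = ((0 : Fin 2), (0 : Fin 2))) ∨
        (p = ((1 : Fin 2), (1 : Fin 2)) ∧ q = ((1 : Fin 2), (1 : Fin 2))) then
      Complex.sinh (((Real.pi * b : ℝ) : ℂ) * (u + Complex.I * (b : ℂ)))
    else if (p = ((0 : Fin 2), (1 : Fin 2)) ∧ q = ((0 : Fin 2), (1 : Fin 2))) ∨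
        (p = ((1 : Fin 2), (0 : Fin 2)) ∧ q = ((1 : Fin 2), (0 : Fin 2))) then
      Complex.sinh (((Real.pi * b : ℝ) : ℂ) * u)
    else if p = ((0 : Fin 2), (1 : Fin 2)) ∧ q = ((1 : Fin 2), (0 : Fin 2)) then
      Complex.I * ((Real.sin (Real.pi * b ^ 2) : ℝ) : ℂ) *
        Complex.exp (((Real.pi * b : ℝ) : ℂ) * ξ * u)
    else if p = ((1 : Fin 2), (0 : Fin 2)) ∧ q = ((0 : Fin 2), (1 : Fin 2)) then
      Complex.I * ((Real.sin (Real.pi * b ^ 2) : ℝ) : ℂ) *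
        Complex.exp (-(((Real.pi * b : ℝ) : ℂ) * ξ * u))
    else 0

/-- The RLL exchange relation with the R-matrix `R(u−v;ξ)`. -/
def ExchRel {A : Type*} [Ring A] [Algebra ℂ A] (b : ℝ) (ξ : ℂ)
    (M : ℂ → Matrix (Fin 2) (Fin 2) A) : Prop :=
  ∀ u v : ℂ,
    (Rxi b ξ (u - v)).map (algebraMap ℂ A) *
        (M u ⊗ₖ (1 : Matrix (Fin 2) (Fin 2) A)) *
        ((1 : Matrix (Fin 2) (Fin 2) A) ⊗ₖ M v) =
      ((1 : Matrix (Fin 2) (Fin 2) A) ⊗ₖ M v) *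
        (M u ⊗ₖ (1 : Matrix (Fin 2) (Fin 2) A)) *
        (Rxi b ξ (u - v)).map (algebraMap ℂ A)

/-- The quantum determinant `det_q M(u) = M(u)₁₁·M(u−ib)₂₂ − exp(−iπb²ξ)·M(u)₁₂·M(u−ib)₂₁`. -/
noncomputable def detq {A : Type*} [Ring A] [Algebra ℂ A] (b : ℝ) (ξ : ℂ)
    (M : ℂ → Matrix (Fin 2) (Fin 2) A) (u : ℂ) : A :=
  M u 0 0 * M (u - Complex.I * (b : ℂ)) 1 1 -
    Complex.exp (-(Complex.I * ((Real.pi * b ^ 2 : ℝ) : ℂ) * ξ)) •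
      (M u 0 1 * M (u - Complex.I * (b : ℂ)) 1 0)

/-- Entrywise six-vertex exchange relation. -/
def Rel6 {A : Type*} [Ring A] [Algebra ℂ A] (a s c : ℂ) (X Y : Fin 2 → Fin 2 → A) : Prop :=
  ∀ i j k l : Fin 2,
    (if i = j then a else s) • (X i k * Y j l) + (if i = j then 0 else c) • (X j k * Y i l) =
    (if k = l then a else s) • (Y j l * X i k) + (if k = l then 0 else c) • (Y j k * X i l)

/-- index swap -/
def sw (i : Fin 2) : Fin 2 := 1 - i

lemma sw_inj (i j : Fin 2) : (sw i = sw j) = (i = j) := by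
  revert i j; unfold sw; decide

lemma Rel6.swap {A : Type*} [Ring A] [Algebra ℂ A] {a s c : ℂ} {X Y : Fin 2 → Fin 2 → A}
    (h : Rel6 a s c X Y) :
    Rel6 a s c (fun i j => X (sw i) (sw j)) (fun i j => Y (sw i) (sw j)) := by
  intro i j k l
  have := h (sw i) (sw j) (sw k) (sw l)
  simpa only [sw_inj] using this

lemma row0 {A : Type*} [Ring A] [Algebra ℂ A] {s m c : ℂ} {L M N : Fin 2 → Fin 2 → A}
    (hNM : Rel6 0 (-c) c N M) (hLM : Rel6 (-m) (-s) c L M) (hNL : Rel6 s m c N L)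
    (hc : c ≠ 0) (hs : s ≠ 0) (r : Fin 2) :
    (M 0 0 * N 1 1 - M 0 1 * N 1 0) * L 0 r = L 0 r * (M 0 0 * N 1 1 - M 0 1 * N 1 0) := by
  have key : (s * c) • ((M 0 0 * N 1 1 - M 0 1 * N 1 0) * L 0 r) =
      (s * c) • (L 0 r * (M 0 0 * N 1 1 - M 0 1 * N 1 0)) := by
    have e1 := congrArg (fun x => x * N 0 0) (hLM 0 1 r 1)
    have e2 := congrArg (fun x => x * N 0 1) (hLM 0 1 r 0)
    have e3 := congrArg (fun x => L 0 r * x) (hNM 1 0 0 1)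
    have e4 := congrArg (fun x => L 0 r * x) (hNM 0 1 0 1)
    have e5 := congrArg (fun x => L 1 r * x) (hNM 0 0 0 1)
    have e6 := congrArg (fun x => x * L 0 r) (hNM 1 0 0 1)
    have e7 := congrArg (fun x => x * L 0 r) (hNM 0 1 0 1)
    have e8 := congrArg (fun x => M 1 0 * x) (hNL 0 0 1 r)
    have e9 := congrArg (fun x => M 1 1 * x) (hNL 0 0 0 r)
    fin_cases r <;>
    simp [-neg_inj, mul_add, add_mul, mul_sub, sub_mul, mul_assoc] at e1 e2 e3 e4 e5 e6 e7 e8 e9 ⊢ <;>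
    linear_combination (norm := module) c • e1 - c • e2 + s • e3 + s • e4 - c • e5 - s • e6
      - s • e7 - c • e8 + c • e9
  exact (smul_right_injective A (mul_ne_zero hs hc)) key

lemma row1 {A : Type*} [Ring A] [Algebra ℂ A] {s m c : ℂ} {L M N : Fin 2 → Fin 2 → A}
    (hNM : Rel6 0 (-c) c N M) (hLM : Rel6 (-m) (-s) c L M) (hNL : Rel6 s m c N L)
    (hc : c ≠ 0) (hm : m ≠ 0) (r : Fin 2) :
    (M 0 0 * N 1 1 - M 0 1 * N 1 0) * L 1 r = L 1 r * (M 0 0 * N 1 1 - M 0 1 * N 1 0) := by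
  have key : (m * c) • ((M 0 0 * N 1 1 - M 0 1 * N 1 0) * L 1 r) =
      (m * c) • (L 1 r * (M 0 0 * N 1 1 - M 0 1 * N 1 0)) := by
    have e1 := congrArg (fun x => x * N 0 0) (hLM 1 1 r 1)
    have e2 := congrArg (fun x => x * N 0 1) (hLM 1 1 r 0)
    have e3 := congrArg (fun x => L 1 r * x) (hNM 1 0 0 1)
    have e4 := congrArg (fun x => L 1 r * x) (hNM 0 1 0 1)
    have e5 := congrArg (fun x => x * L 0 r) (hNM 1 1 0 1)
    have e6 := congrArg (fun x => x * L 1 r) (hNM 1 0 0 1)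
    have e7 := congrArg (fun x => x * L 1 r) (hNM 0 1 0 1)
    have e8 := congrArg (fun x => M 1 0 * x) (hNL 0 1 1 r)
    have e9 := congrArg (fun x => M 1 1 * x) (hNL 0 1 0 r)
    fin_cases r <;>
    simp [-neg_inj, mul_add, add_mul, mul_sub, sub_mul, mul_assoc] at e1 e2 e3 e4 e5 e6 e7 e8 e9 ⊢ <;>
    linear_combination (norm := module) c • e1 - c • e2 + m • e3 + m • e4 - c • e5 - m • e6
      - m • e7 - c • e8 + c • e9
  exact (smul_right_injective A (mul_ne_zero hm hc)) key

lemma det_swap {A : Type*} [Ring A] [Algebra ℂ A] {c : ℂ} {M N : Fin 2 → Fin 2 → A}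
    (hNM : Rel6 0 (-c) c N M) (hc : c ≠ 0) :
    M 1 1 * N 0 0 - M 1 0 * N 0 1 = M 0 0 * N 1 1 - M 0 1 * N 1 0 := by
  have e1 := hNM 0 1 0 1
  have e2 := hNM 1 0 0 1
  simp at e1 e2
  refine smul_right_injective A hc ?_
  simp only
  linear_combination (norm := module) e1 + e2

lemma all_rows {A : Type*} [Ring A] [Algebra ℂ A] {s m c : ℂ} {L M N : Fin 2 → Fin 2 → A}
    (hNM : Rel6 0 (-c) c N M) (hLM : Rel6 (-m) (-s) c L M) (hNL : Rel6 s m c N L)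
    (hc : c ≠ 0) (hsm : s ≠ 0 ∨ m ≠ 0) (i r : Fin 2) :
    (M 0 0 * N 1 1 - M 0 1 * N 1 0) * L i r = L i r * (M 0 0 * N 1 1 - M 0 1 * N 1 0) := by
  have hd := det_swap hNM hc
  have hsw : sw (sw r) = r := by revert r; unfold sw; decide
  rcases hsm with hs | hm
  · fin_cases i
    · exact row0 hNM hLM hNL hc hs r
    · have := row0 hNM.swap hLM.swap hNL.swap hc hs (sw r)
      simp only [hsw] at this
      simp only [sw, sub_zero, sub_self] at this
      rw [hd] at this
      exact this
  · fin_cases i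
    · have := row1 hNM.swap hLM.swap hNL.swap hc hm (sw r)
      simp only [hsw] at this
      simp only [sw, sub_zero, sub_self] at this
      rw [hd] at this
      exact this
    · exact row1 hNM hLM hNL hc hm r

/-- gauge exponent -/
noncomputable def gz (b : ℝ) (ξ u : ℂ) (i : Fin 2) : ℂ :=
  if i = 0 then Complex.exp (((Real.pi * b : ℝ) : ℂ) * ξ * u) else 1

lemma gz_ne (b : ℝ) (ξ u : ℂ) (i : Fin 2) : gz b ξ u i ≠ 0 := by
  unfold gz; split_ifs
  · exact Complex.exp_ne_zero _
  · exact one_ne_zero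

/-- gauge-transformed matrix -/
noncomputable def gM {A : Type*} [Ring A] [Algebra ℂ A] (b : ℝ) (ξ : ℂ)
    (M : ℂ → Matrix (Fin 2) (Fin 2) A) (u : ℂ) (i j : Fin 2) : A :=
  ((gz b ξ u i)⁻¹ * gz b ξ u j) • M u i j

lemma gM_rel {A : Type*} [Ring A] [Algebra ℂ A] (b : ℝ) (ξ : ℂ)
    (M : ℂ → Matrix (Fin 2) (Fin 2) A) (hM : ExchRel b ξ M) (u v : ℂ) :
    Rel6 (Complex.sinh (((Real.pi * b : ℝ) : ℂ) * (u - v + Complex.I * (b : ℂ))))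
      (Complex.sinh (((Real.pi * b : ℝ) : ℂ) * (u - v)))
      (Complex.I * ((Real.sin (Real.pi * b ^ 2) : ℝ) : ℂ)) (gM b ξ M u) (gM b ξ M v) := by
  have h := hM u v
  have hx : Complex.exp (((Real.pi * b : ℝ) : ℂ) * ξ * (u - v)) =
      Complex.exp (((Real.pi * b : ℝ) : ℂ) * ξ * u) *
        (Complex.exp (((Real.pi * b : ℝ) : ℂ) * ξ * v))⁻¹ := by
    rw [← Complex.exp_neg, ← Complex.exp_add]; congr 1; ring
  have hy : Complex.exp (-(((Real.pi * b : ℝ) : ℂ) * ξ * (u - v))) =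
      (Complex.exp (((Real.pi * b : ℝ) : ℂ) * ξ * u))⁻¹ *
        (Complex.exp (((Real.pi * b : ℝ) : ℂ) * ξ * v)) := by
    rw [← Complex.exp_neg, ← Complex.exp_add]; congr 1; ring
  unfold Rxi at h
  rw [hx, hy] at h
  have hu := Complex.exp_ne_zero (((Real.pi * b : ℝ) : ℂ) * ξ * u)
  have hv := Complex.exp_ne_zero (((Real.pi * b : ℝ) : ℂ) * ξ * v)
  unfold Rel6 gM gz
  generalize Complex.exp (((Real.pi * b : ℝ) : ℂ) * ξ * u) = x at *
  generalize Complex.exp (((Real.pi * b : ℝ) : ℂ) * ξ * v) = y at *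
  generalize Complex.sinh (((Real.pi * b : ℝ) : ℂ) * (u - v + Complex.I * (b : ℂ))) = a at *
  generalize Complex.sinh (((Real.pi * b : ℝ) : ℂ) * (u - v)) = s at *
  generalize Complex.I * ((Real.sin (Real.pi * b ^ 2) : ℝ) : ℂ) = c at *
  have h' : ∀ i j k l : Fin 2, _ := fun i j k l => congrFun (congrFun h (i, j)) (k, l)
  clear h
  have comm : ∀ (z : ℂ) (w : A), w * algebraMap ℂ A z = z • w := fun z w => by
    rw [Algebra.smul_def, Algebra.commutes]
  intro i j k l
  have e := congrArg (fun w => ((if i = 0 then x else 1)⁻¹ * (if j = 0 then y else 1)⁻¹ *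
    (if k = 0 then x else 1) * (if l = 0 then y else 1)) • w) (h' i j k l)
  clear h'
  fin_cases i <;> fin_cases j <;> fin_cases k <;> fin_cases l <;>
  simp [Matrix.mul_apply, Fintype.sum_prod_type, Fin.sum_univ_two, Matrix.one_apply,
    ← Algebra.smul_def, comm, -map_mul, smul_smul] at e ⊢
  all_goals linear_combination (norm := skip) e
  all_goals match_scalars
  all_goals (try field_simp)
  all_goals (try ring)

/-- The quantum determinant of a monodromy matrix satisfying the
exchange relation is central. -/
theorem detq_central (b : ℝ) (hb0 : 0 < b) (hb1 : b < 1)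
    (A : Type*) [Ring A] [Algebra ℂ A] (ξ : ℂ)
    (M : ℂ → Matrix (Fin 2) (Fin 2) A) (hM : ExchRel b ξ M) :
    ∀ (u v : ℂ) (i j : Fin 2), Commute (detq b ξ M u) (M v i j) := by
  intro u v i j
  set p : ℂ := ((Real.pi * b : ℝ) : ℂ) with hp
  set c : ℂ := Complex.I * ((Real.sin (Real.pi * b ^ 2) : ℝ) : ℂ) with hcdef
  have hsin : Real.sin (Real.pi * b ^ 2) ≠ 0 := by
    apply ne_of_gt
    apply Real.sin_pos_of_pos_of_lt_pi
    · positivity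
    · have : b ^ 2 < 1 := by nlinarith
      nlinarith [Real.pi_pos]
  have hc : c ≠ 0 := mul_ne_zero Complex.I_ne_zero (by exact_mod_cast hsin)
  have hcs : Complex.sinh (p * (Complex.I * b)) = c := by
    have : p * (Complex.I * b) = ((Real.pi * b ^ 2 : ℝ) : ℂ) * Complex.I := by
      rw [hp]; push_cast; ring
    rw [this, Complex.sinh_mul_I, ← Complex.ofReal_sin, hcdef, mul_comm]
  have r1 := gM_rel b ξ M hM (u - Complex.I * b) u
  have r2 := gM_rel b ξ M hM v u
  have r3 := gM_rel b ξ M hM (u - Complex.I * b) v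
  rw [← hp, ← hcdef] at r1 r2 r3
  have a1 : Complex.sinh (p * (u - Complex.I * b - u + Complex.I * b)) = 0 := by
    ring_nf; simp
  have a2 : Complex.sinh (p * (u - Complex.I * b - u)) = -c := by
    rw [← hcs, ← Complex.sinh_neg]; congr 1; ring
  have a3 : Complex.sinh (p * (v - u + Complex.I * b)) =
      -Complex.sinh (p * (u - Complex.I * b - v)) := by
    rw [← Complex.sinh_neg]; congr 1; ring
  have a4 : Complex.sinh (p * (v - u)) = -Complex.sinh (p * (u - v)) := by
    rw [← Complex.sinh_neg]; congr 1; ring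
  have a5 : u - Complex.I * b - v + Complex.I * b = u - v := by ring
  rw [a1, a2] at r1
  rw [a3, a4] at r2
  rw [a5] at r3
  have hsm : Complex.sinh (p * (u - v)) ≠ 0 ∨ Complex.sinh (p * (u - Complex.I * b - v)) ≠ 0 := by
    by_contra hcon
    push Not at hcon
    obtain ⟨h1, h2⟩ := hcon
    have : p * (u - Complex.I * b - v) = p * (u - v) - p * (Complex.I * b) := by ring
    rw [this, Complex.sinh_sub, h1, hcs] at h2
    have h3 := Complex.cosh_sq (p * (u - v))
    rw [h1] at h3
    have h4 : Complex.cosh (p * (u - v)) = 0 := by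
      have : Complex.cosh (p * (u - v)) * c = 0 := by linear_combination -h2
      exact (mul_eq_zero.mp this).resolve_right hc
    rw [h4] at h3
    norm_num at h3
  have main := all_rows r1 r2 r3 hc hsm i j
  have hd : gM b ξ M u 0 0 * gM b ξ M (u - Complex.I * b) 1 1 -
      gM b ξ M u 0 1 * gM b ξ M (u - Complex.I * b) 1 0 = detq b ξ M u := by
    have hq : (Complex.exp (p * ξ * u))⁻¹ * Complex.exp (p * ξ * (u - Complex.I * b)) =
        Complex.exp (-(Complex.I * ((Real.pi * b ^ 2 : ℝ) : ℂ) * ξ)) := by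
      rw [← Complex.exp_neg, ← Complex.exp_add]; congr 1; rw [hp]; push_cast; ring
    have hu := Complex.exp_ne_zero (p * ξ * u)
    unfold detq gM gz
    rw [← hq, ← hp]
    simp [smul_smul, hu, mul_comm]
  rw [hd] at main
  have hne : (gz b ξ v i)⁻¹ * gz b ξ v j ≠ 0 :=
    mul_ne_zero (inv_ne_zero (gz_ne _ _ _ _)) (gz_ne _ _ _ _)
  refine smul_right_injective A hne ?_
  simpa [gM] using main
end

section
/- Let ξ ∈ ℂ and suppose M′ and M″ are functions from ℂ to 2×2 matrices over A, each satisfying the exchange relation R(u−v;ξ)·(M(u)⊗I₂)·(I₂⊗M(v)) = (I₂⊗M(v))·(M(u)⊗I₂)·R(u−v;ξ) for all u, v ∈ ℂ, and such that every entry M′(u)_{ij} commutes with every entry M″(v)_{kl}. Then M(u) := M′(u)·M″(u) also satisfies the same exchange relation, and its quantum determinant factorizes: det_q M(u) = det_q M′(u) · det_q M″(u) for all u ∈ ℂ. Consequently, for an N-site monodromy matrix M(u) = L_N(u)·…·L₂(u)·L₁(u) built from solutions L_r of the exchange relation whose entries at different sites pairwise commute, det_q M(u) equals the product of the quantum determinants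 det_q L_r(u). -/
open Matrix
open scoped Kronecker

/-- The `N`-site monodromy matrix `M(u) = L_N(u)·…·L₂(u)·L₁(u)`. -/
noncomputable def mono {A : Type*} [Ring A]
    (L : ℕ → ℂ → Matrix (Fin 2) (Fin 2) A) : ℕ → ℂ → Matrix (Fin 2) (Fin 2) A
  | 0 => fun _ => 1
  | n + 1 => fun u => L (n + 1) u * mono L n u

section Aux
set_option linter.unusedSectionVars false
variable {A : Type*} [Ring A] [Algebra ℂ A]

lemma aux_left (X Y : Matrix (Fin 2) (Fin 2) A) :
    (X * Y) ⊗ₖ (1 : Matrix (Fin 2) (Fin 2) A) = (X ⊗ₖ 1) * (Y ⊗ₖ 1) := by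
  ext ⟨i, j⟩ ⟨k, l⟩
  fin_cases j <;> fin_cases l <;>
  simp [Matrix.mul_apply, kroneckerMap_apply, Fintype.sum_prod_type, Fin.sum_univ_two]

lemma aux_right (X Y : Matrix (Fin 2) (Fin 2) A) :
    (1 : Matrix (Fin 2) (Fin 2) A) ⊗ₖ (X * Y) = (1 ⊗ₖ X) * (1 ⊗ₖ Y) := by
  ext ⟨i, j⟩ ⟨k, l⟩
  fin_cases i <;> fin_cases k <;>
  simp [Matrix.mul_apply, kroneckerMap_apply, Fintype.sum_prod_type, Fin.sum_univ_two]

lemma aux_12 (X Y : Matrix (Fin 2) (Fin 2) A) (p q : Fin 2 × Fin 2) :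
    ((X ⊗ₖ (1 : Matrix (Fin 2) (Fin 2) A)) * ((1 : Matrix (Fin 2) (Fin 2) A) ⊗ₖ Y)) p q
      = X p.1 q.1 * Y p.2 q.2 := by
  obtain ⟨i, j⟩ := p
  obtain ⟨k, l⟩ := q
  fin_cases j <;> fin_cases k <;>
  simp [Matrix.mul_apply, kroneckerMap_apply, Fintype.sum_prod_type, Fin.sum_univ_two]

lemma aux_21 (X Y : Matrix (Fin 2) (Fin 2) A) (p q : Fin 2 × Fin 2) :
    (((1 : Matrix (Fin 2) (Fin 2) A) ⊗ₖ Y) * (X ⊗ₖ (1 : Matrix (Fin 2) (Fin 2) A))) p q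
      = Y p.2 q.2 * X p.1 q.1 := by
  obtain ⟨i, j⟩ := p
  obtain ⟨k, l⟩ := q
  fin_cases i <;> fin_cases l <;>
  simp [Matrix.mul_apply, kroneckerMap_apply, Fintype.sum_prod_type, Fin.sum_univ_two]

lemma aux_comm (X Y : Matrix (Fin 2) (Fin 2) A)
    (h : ∀ i j k l, Commute (X i j) (Y k l)) :
    (X ⊗ₖ (1 : Matrix (Fin 2) (Fin 2) A)) * ((1 : Matrix (Fin 2) (Fin 2) A) ⊗ₖ Y) =
    ((1 : Matrix (Fin 2) (Fin 2) A) ⊗ₖ Y) * (X ⊗ₖ (1 : Matrix (Fin 2) (Fin 2) A)) := by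
  ext p q
  rw [aux_12, aux_21]
  exact h _ _ _ _

lemma aux_exch (b : ℝ) (ξ : ℂ) (M' M'' : ℂ → Matrix (Fin 2) (Fin 2) A)
    (hM' : ExchRel b ξ M') (hM'' : ExchRel b ξ M'')
    (hcomm : ∀ (u v : ℂ) (i j k l : Fin 2), Commute (M' u i j) (M'' v k l)) :
    ExchRel b ξ fun u => M' u * M'' u := by
  intro u v
  have h1 := hM' u v
  have h2 := hM'' u v
  have c1 := aux_comm (M'' u) (M' v) (fun i j k l => (hcomm v u k l i j).symm)
  have c2 := aux_comm (M' u) (M'' v) (fun i j k l => hcomm u v i j k l)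
  simp only [aux_left, aux_right]
  generalize (Rxi b ξ (u - v)).map (algebraMap ℂ A) = R at *
  generalize M' u ⊗ₖ (1 : Matrix (Fin 2) (Fin 2) A) = a at *
  generalize M'' u ⊗ₖ (1 : Matrix (Fin 2) (Fin 2) A) = c at *
  generalize (1 : Matrix (Fin 2) (Fin 2) A) ⊗ₖ M' v = d at *
  generalize (1 : Matrix (Fin 2) (Fin 2) A) ⊗ₖ M'' v = e at *
  calc R * (a * c) * (d * e) = R * a * (c * d) * e := by noncomm_ring
    _ = R * a * d * (c * e) := by rw [c1]; noncomm_ring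
    _ = d * a * (R * c * e) := by rw [h1]; noncomm_ring
    _ = d * (a * e) * c * R := by rw [h2]; noncomm_ring
    _ = _ := by rw [c2]; noncomm_ring

/-- The rank one degenerate R-matrix. -/
noncomputable def auxQ (q : ℂ) : Matrix (Fin 2 × Fin 2) (Fin 2 × Fin 2) ℂ :=
  Matrix.of fun p r =>
    if p = ((0 : Fin 2), (1 : Fin 2)) ∧ r = ((0 : Fin 2), (1 : Fin 2)) then -1
    else if p = ((1 : Fin 2), (0 : Fin 2)) ∧ r = ((1 : Fin 2), (0 : Fin 2)) then -1
    else if p = ((0 : Fin 2), (1 : Fin 2)) ∧ r = ((1 : Fin 2), (0 : Fin 2)) then q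
    else if p = ((1 : Fin 2), (0 : Fin 2)) ∧ r = ((0 : Fin 2), (1 : Fin 2)) then q⁻¹
    else 0

lemma aux_R (b : ℝ) (ξ : ℂ) :
    Rxi b ξ (-(Complex.I * (b : ℂ))) =
      (Complex.I * ((Real.sin (Real.pi * b ^ 2) : ℝ) : ℂ)) •
        auxQ (Complex.exp (-(Complex.I * ((Real.pi * b ^ 2 : ℝ) : ℂ) * ξ))) := by
  have hs : Complex.sinh (((Real.pi * b : ℝ) : ℂ) * (-(Complex.I * (b : ℂ)))) =
      -(Complex.I * ((Real.sin (Real.pi * b ^ 2) : ℝ) : ℂ)) := by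
    have : ((Real.pi * b : ℝ) : ℂ) * (-(Complex.I * (b : ℂ))) =
        -(((Real.pi * b ^ 2 : ℝ) : ℂ) * Complex.I) := by push_cast; ring
    rw [this, Complex.sinh_neg, Complex.sinh_mul_I, Complex.ofReal_sin]; ring
  have e1 : ((Real.pi * b : ℝ) : ℂ) * ξ * (-(Complex.I * (b : ℂ))) =
      -(Complex.I * ((Real.pi * b ^ 2 : ℝ) : ℂ) * ξ) := by push_cast; ring
  ext ⟨i, j⟩ ⟨k, l⟩
  simp only [Rxi, auxQ, Matrix.of_apply, Matrix.smul_apply, hs, e1, neg_add_cancel, mul_zero,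
    Complex.sinh_zero, smul_eq_mul, Complex.exp_neg, inv_inv]
  fin_cases i <;> fin_cases j <;> fin_cases k <;> fin_cases l <;> simp

lemma aux_rels (b : ℝ) (hb0 : 0 < b) (hb1 : b < 1) (ξ : ℂ)
    (M : ℂ → Matrix (Fin 2) (Fin 2) A) (h : ExchRel b ξ M) (u q : ℂ)
    (hq : q = Complex.exp (-(Complex.I * ((Real.pi * b ^ 2 : ℝ) : ℂ) * ξ)))
    (C D : Matrix (Fin 2) (Fin 2) A) (hC : C = M u) (hD : D = M (u - Complex.I * (b : ℂ))) :
    C 0 0 * D 0 1 = q • (C 0 1 * D 0 0) ∧ C 1 0 * D 1 1 = q • (C 1 1 * D 1 0) ∧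
    C 1 0 * D 0 1 - q • (C 1 1 * D 0 0) = -(q • (C 0 0 * D 1 1 - q • (C 0 1 * D 1 0))) := by
  have hq0 : q ≠ 0 := hq ▸ Complex.exp_ne_zero _
  have hs : (Complex.I * ((Real.sin (Real.pi * b ^ 2) : ℝ) : ℂ)) ≠ 0 := by
    have : 0 < Real.sin (Real.pi * b ^ 2) := by
      apply Real.sin_pos_of_pos_of_lt_pi
      · positivity
      · have : b ^ 2 < 1 := by nlinarith
        nlinarith [Real.pi_pos]
    exact mul_ne_zero Complex.I_ne_zero (by exact_mod_cast this.ne')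
  have h0 := h (u - Complex.I * (b : ℂ)) u
  have e : u - Complex.I * (b : ℂ) - u = -(Complex.I * (b : ℂ)) := by ring
  rw [e, aux_R, ← hq, ← hC, ← hD, Matrix.mul_assoc] at h0
  have key : ∀ p r, ∑ x, auxQ q p x • (D x.1 r.1 * C x.2 r.2) =
      ∑ x, auxQ q x r • (C p.2 x.2 * D p.1 x.1) := by
    intro p r
    have := congr_fun (congr_fun h0 p) r
    rw [Matrix.mul_apply, Matrix.mul_apply] at this
    have c1 : ∀ (c : ℂ) (x : A), x * algebraMap ℂ A c = c • x := fun c x => by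
      rw [← Algebra.commutes, Algebra.smul_def]
    have c2 : ∀ (c : ℂ) (x : A), algebraMap ℂ A c * x = c • x := fun c x => by
      rw [Algebra.smul_def]
    simp only [aux_12, aux_21, Matrix.map_apply, Matrix.smul_apply, c1, c2, smul_assoc,
      ← Finset.smul_sum] at this
    exact smul_right_injective A hs this
  have k1 := key (0, 0) (0, 1)
  have k2 := key (1, 1) (0, 1)
  have k3 := key (0, 1) (0, 1)
  have k4 := key (1, 0) (0, 1)
  simp [auxQ, Fintype.sum_prod_type, Fin.sum_univ_two] at k1 k2 k3 k4
  refine ⟨?_, ?_, ?_⟩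
  · linear_combination (norm := skip) (-q) • k1
    match_scalars <;> field_simp <;> ring
  · linear_combination (norm := skip) (-q) • k2
    match_scalars <;> field_simp <;> ring
  · linear_combination (norm := skip) (-q) • k3 + (-q ^ 2) • k4
    match_scalars <;> field_simp <;> ring

lemma aux_detq (b : ℝ) (hb0 : 0 < b) (hb1 : b < 1) (ξ : ℂ)
    (M' M'' : ℂ → Matrix (Fin 2) (Fin 2) A)
    (hM'' : ExchRel b ξ M'')
    (hcomm : ∀ (u v : ℂ) (i j k l : Fin 2), Commute (M' u i j) (M'' v k l)) (u : ℂ) :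
    detq b ξ (fun w => M' w * M'' w) u = detq b ξ M' u * detq b ξ M'' u := by
  obtain ⟨r1, r2, r3⟩ := aux_rels b hb0 hb1 ξ M'' hM'' u _ rfl _ _ rfl rfl
  have sw : ∀ (i j k l m n : Fin 2) (x : Fin 2) (y : Fin 2),
      M' u i j * M'' u k l * (M' (u - Complex.I * (b : ℂ)) m n * M'' (u - Complex.I * (b : ℂ)) x y)
      = (M' u i j * M' (u - Complex.I * (b : ℂ)) m n) *
        (M'' u k l * M'' (u - Complex.I * (b : ℂ)) x y) := by
    intro i j k l m n x y
    exact (hcomm (u - Complex.I * (b : ℂ)) u m n k l).symm.mul_mul_mul_comm _ _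
  unfold detq
  simp only [Matrix.mul_apply, Fin.sum_univ_two, add_mul, mul_add, sw]
  generalize Complex.exp (-(Complex.I * ((Real.pi * b ^ 2 : ℝ) : ℂ) * ξ)) = q at *
  have r3' := eq_add_of_sub_eq r3
  rw [r1, r2, r3']
  simp only [mul_add, add_mul, mul_sub, sub_mul, smul_sub, smul_add, mul_neg, mul_smul_comm,
    smul_mul_assoc]
  module

lemma aux_exch_one (b : ℝ) (ξ : ℂ) :
    ExchRel b ξ (fun _ => (1 : Matrix (Fin 2) (Fin 2) A)) := by
  intro u v
  simp

lemma aux_mono (b : ℝ) (hb0 : 0 < b) (hb1 : b < 1) (ξ : ℂ)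
    (L : ℕ → ℂ → Matrix (Fin 2) (Fin 2) A) (N : ℕ)
    (hE : ∀ r, 1 ≤ r → r ≤ N → ExchRel b ξ (L r))
    (hc : ∀ r r', 1 ≤ r → r ≤ N → 1 ≤ r' → r' ≤ N → r ≠ r' →
          ∀ (u v : ℂ) (i j k l : Fin 2), Commute (L r u i j) (L r' v k l)) :
    ∀ n ≤ N, ExchRel b ξ (mono L n) ∧
      (∀ r, n < r → r ≤ N → ∀ (u v : ℂ) (i j k l : Fin 2),
        Commute (L r u i j) (mono L n v k l)) ∧
      (∀ u, detq b ξ (mono L n) u =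
          ((List.range n).map fun r => detq b ξ (L (r + 1)) u).prod) := by
  intro n
  induction n with
  | zero =>
    intro _
    refine ⟨aux_exch_one b ξ, ?_, ?_⟩
    · intro r _ _ u v i j k l
      show Commute _ ((1 : Matrix (Fin 2) (Fin 2) A) k l)
      rw [Matrix.one_apply]
      split_ifs
      · exact Commute.one_right _
      · exact Commute.zero_right _
    · intro u
      simp [detq, mono]
  | succ n ih =>
    intro hn
    obtain ⟨h1, h2, h3⟩ := ih (by omega)
    have hcm := h2 (n + 1) (by omega) hn
    refine ⟨aux_exch b ξ _ _ (hE (n + 1) (by omega) hn) h1 hcm, ?_, ?_⟩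
    · intro r hr hrN u v i j k l
      show Commute _ ((L (n + 1) v * mono L n v) k l)
      rw [Matrix.mul_apply]
      refine Commute.sum_right _ _ _ fun x _ => Commute.mul_right ?_ ?_
      · exact hc r (n + 1) (by omega) hrN (by omega) hn (by omega) _ _ _ _ _ _
      · exact h2 r (by omega) hrN _ _ _ _ _ _
    · intro u
      have hd := aux_detq b hb0 hb1 ξ (L (n + 1)) (mono L n) h1 hcm u
      have hcd : Commute (detq b ξ (L (n + 1)) u) (detq b ξ (mono L n) u) := by
        unfold detq
        refine Commute.sub_left ?_ (Commute.smul_left ?_ _) <;>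
        refine Commute.sub_right ?_ (Commute.smul_right ?_ _) <;>
        exact Commute.mul_left (Commute.mul_right (hcm _ _ _ _ _ _) (hcm _ _ _ _ _ _))
          (Commute.mul_right (hcm _ _ _ _ _ _) (hcm _ _ _ _ _ _))
      rw [List.range_succ, List.map_append, List.prod_append, ← h3]
      simp only [List.map_cons, List.map_nil, List.prod_singleton]
      rw [← hcd.eq, ← hd]
      rfl

end Aux

/-- If `M′`, `M″` satisfy the exchange relation and their entries
mutually commute, then `M = M′·M″` satisfies the exchange relation and
`det_q M = det_q M′ · det_q M″`; consequently the quantum determinant of an `N`-site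
monodromy matrix built from site-wise commuting solutions of the exchange relation
is the product of the quantum determinants of its L-matrices. -/
theorem detq_multiplicative (b : ℝ) (hb0 : 0 < b) (hb1 : b < 1)
    (A : Type*) [Ring A] [Algebra ℂ A] (ξ : ℂ)
    (M' M'' : ℂ → Matrix (Fin 2) (Fin 2) A)
    (hM' : ExchRel b ξ M') (hM'' : ExchRel b ξ M'')
    (hcomm : ∀ (u v : ℂ) (i j k l : Fin 2), Commute (M' u i j) (M'' v k l)) :
    (ExchRel b ξ fun u => M' u * M'' u) ∧
      (∀ u : ℂ, detq b ξ (fun w => M' w * M'' w) u = detq b ξ M' u * detq b ξ M'' u) ∧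
      (∀ (N : ℕ) (L : ℕ → ℂ → Matrix (Fin 2) (Fin 2) A),
        (∀ r, 1 ≤ r → r ≤ N → ExchRel b ξ (L r)) →
        (∀ r r', 1 ≤ r → r ≤ N → 1 ≤ r' → r' ≤ N → r ≠ r' →
          ∀ (u v : ℂ) (i j k l : Fin 2), Commute (L r u i j) (L r' v k l)) →
        ∀ u : ℂ, detq b ξ (mono L N) u =
          ((List.range N).map fun r => detq b ξ (L (r + 1)) u).prod) := by
  exact ⟨aux_exch b ξ M' M'' hM' hM'' hcomm, aux_detq b hb0 hb1 ξ M' M'' hM'' hcomm,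
    fun N L hE hc u => (aux_mono b hb0 hb1 ξ L N hE hc N le_rfl).2.2 u⟩
end

section
/- Let ξ, ρ₀ ∈ ℂ, and for u ∈ ℂ let G(u) be the 2×2 matrix with scalar entries [[1, 0], [exp(−πbξu)·ρ₀, 1]]. Suppose M : ℂ → (2×2 matrices over A) satisfies the exchange relation R(u−v;ξ)·(M(u)⊗I₂)·(I₂⊗M(v)) = (I₂⊗M(v))·(M(u)⊗I₂)·R(u−v;ξ) for all u, v ∈ ℂ. Then the gauge-transformed matrix M̃(u) := G(u)·M(u)·G(u)⁻¹ has the same quantum determinant: det_q M̃(u) = det_q M(u) for all u ∈ ℂ. -/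
open Matrix
open scoped Kronecker

theorem exch_key (b : ℝ) (hb0 : 0 < b) (hb1 : b < 1)
    {A : Type*} [Ring A] [Algebra ℂ A] (ξ : ℂ)
    (M : ℂ → Matrix (Fin 2) (Fin 2) A) (hM : ExchRel b ξ M) (u : ℂ) :
    M u 0 1 * M (u - Complex.I * (b : ℂ)) 0 0 =
      Complex.exp (Complex.I * ((Real.pi * b ^ 2 : ℝ) : ℂ) * ξ) •
        (M u 0 0 * M (u - Complex.I * (b : ℂ)) 0 1) := by
  have h := congrFun (congrFun (hM (u - Complex.I * (b : ℂ)) u) (0, 0)) (0, 1)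
  have e0 : u - Complex.I * (b : ℂ) - u = -(Complex.I * (b : ℂ)) := by ring
  rw [e0] at h
  have hs : Real.sin (Real.pi * b ^ 2) ≠ 0 := by
    have h1 : 0 < Real.pi := Real.pi_pos
    apply ne_of_gt
    apply Real.sin_pos_of_pos_of_lt_pi
    · positivity
    · have : b ^ 2 < 1 := by nlinarith
      nlinarith
  have hs' : Complex.I * ((Real.sin (Real.pi * b ^ 2) : ℝ) : ℂ) ≠ 0 :=
    mul_ne_zero Complex.I_ne_zero (by exact_mod_cast hs)
  have e1 : Complex.sinh (((Real.pi * b : ℝ) : ℂ) * -(Complex.I * (b : ℂ))) =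
      -(Complex.I * ((Real.sin (Real.pi * b ^ 2) : ℝ) : ℂ)) := by
    rw [show ((Real.pi * b : ℝ) : ℂ) * -(Complex.I * (b : ℂ)) =
      -(((Real.pi * b ^ 2 : ℝ) : ℂ) * Complex.I) by push_cast; ring]
    rw [Complex.sinh_neg, Complex.sinh_mul_I, Complex.ofReal_sin]
    ring
  have e2 : -(((Real.pi * b : ℝ) : ℂ) * ξ * -(Complex.I * (b : ℂ))) =
      Complex.I * ((Real.pi * b ^ 2 : ℝ) : ℂ) * ξ := by push_cast; ring
  have r1 : Rxi b ξ (-(Complex.I * (b : ℂ))) (0, 0) (0, 0) = 0 := by simp [Rxi]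
  have r2 : Rxi b ξ (-(Complex.I * (b : ℂ))) (0, 0) (0, 1) = 0 := by simp [Rxi]
  have r3 : Rxi b ξ (-(Complex.I * (b : ℂ))) (0, 0) (1, 0) = 0 := by simp [Rxi]
  have r4 : Rxi b ξ (-(Complex.I * (b : ℂ))) (0, 0) (1, 1) = 0 := by simp [Rxi]
  have r5 : Rxi b ξ (-(Complex.I * (b : ℂ))) (1, 1) (0, 1) = 0 := by simp [Rxi]
  have r6 : Rxi b ξ (-(Complex.I * (b : ℂ))) (0, 1) (0, 1) =
      -(Complex.I * ((Real.sin (Real.pi * b ^ 2) : ℝ) : ℂ)) := by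
    rw [← e1]; simp [Rxi]
  have r7 : Rxi b ξ (-(Complex.I * (b : ℂ))) (1, 0) (0, 1) =
      Complex.I * ((Real.sin (Real.pi * b ^ 2) : ℝ) : ℂ) *
      Complex.exp (Complex.I * ((Real.pi * b ^ 2 : ℝ) : ℂ) * ξ) := by
    rw [← e2]; simp [Rxi]
  generalize Complex.I * ((Real.sin (Real.pi * b ^ 2) : ℝ) : ℂ) = s at *
  generalize Complex.exp (Complex.I * ((Real.pi * b ^ 2 : ℝ) : ℂ) * ξ) = q at *
  simp only [Matrix.mul_apply, Fintype.sum_prod_type, Fin.sum_univ_two, Matrix.map_apply,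
    Matrix.kroneckerMap_apply, r1, r2, r3, r4, r5, r6, r7] at h
  simp [Algebra.algebraMap_eq_smul_one, -mul_eq_zero] at h
  have h2 : s • (M u 0 1 * M (u - Complex.I * (b : ℂ)) 0 0) =
      s • (q • (M u 0 0 * M (u - Complex.I * (b : ℂ)) 0 1)) := by
    rw [smul_smul]
    first | exact (neg_add_eq_zero.mp h.symm) | (trace_state; exact h)
  have h3 := congrArg (fun x => s⁻¹ • x) h2
  simpa [smul_smul, hs'] using h3

/-- The quantum determinant is invariant under the gauge
transformation `M̃(u) = G(u)·M(u)·G(u)⁻¹` with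
`G(u) = [[1,0],[exp(−πbξu)·ρ₀,1]]`. -/
theorem detq_gauge_invariant (b : ℝ) (hb0 : 0 < b) (hb1 : b < 1)
    (A : Type*) [Ring A] [Algebra ℂ A] (ξ ρ₀ : ℂ)
    (M : ℂ → Matrix (Fin 2) (Fin 2) A) (hM : ExchRel b ξ M)
    (G Ginv : ℂ → Matrix (Fin 2) (Fin 2) A)
    (hG : ∀ u : ℂ, G u =
      !![(1 : A), 0;
         algebraMap ℂ A (Complex.exp (-(((Real.pi * b : ℝ) : ℂ) * ξ * u)) * ρ₀), 1])
    (hGinv : ∀ u : ℂ, G u * Ginv u = 1 ∧ Ginv u * G u = 1) :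
    ∀ u : ℂ, detq b ξ (fun w => G w * M w * Ginv w) u = detq b ξ M u := by
  intro u
  have hI : ∀ w, Ginv w = !![(1 : A), 0;
      -algebraMap ℂ A (Complex.exp (-(((Real.pi * b : ℝ) : ℂ) * ξ * w)) * ρ₀), 1] := by
    intro w
    refine left_inv_eq_right_inv (hGinv w).2 ?_
    rw [hG w]
    ext i j
    fin_cases i <;> fin_cases j <;> simp [Matrix.mul_apply, Fin.sum_univ_two]
  have key := exch_key b hb0 hb1 ξ M hM u
  have hq : Complex.exp (-(((Real.pi * b : ℝ) : ℂ) * ξ * (u - Complex.I * (b : ℂ)))) =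
      Complex.exp (Complex.I * ((Real.pi * b ^ 2 : ℝ) : ℂ) * ξ) *
      Complex.exp (-(((Real.pi * b : ℝ) : ℂ) * ξ * u)) := by
    rw [← Complex.exp_add]; congr 1; push_cast; ring
  have hqq : Complex.exp (Complex.I * ((Real.pi * b ^ 2 : ℝ) : ℂ) * ξ) ≠ 0 := Complex.exp_ne_zero _
  simp only [detq, hI, hG, hq, Matrix.mul_apply, Fin.sum_univ_two, Complex.exp_neg (Complex.I * _ * ξ)]
  generalize Complex.exp (Complex.I * ((Real.pi * b ^ 2 : ℝ) : ℂ) * ξ) = q at *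
  generalize Complex.exp (-(((Real.pi * b : ℝ) : ℂ) * ξ * u)) = g at *
  generalize M u = X at *
  generalize M (u - Complex.I * (b : ℂ)) = Y at *
  simp [Algebra.algebraMap_eq_smul_one]
  simp only [mul_add, add_mul, mul_sub, sub_mul, mul_neg, neg_mul, smul_add, smul_neg, smul_mul_assoc, mul_smul_comm, key, smul_smul, mul_one, one_mul]
  match_scalars <;> field_simp <;> ring
end

section
/- Suppose in addition that the Casimir relation f·e = (4·cosh(πbs)² − 2)·1 + q·k² + q⁻¹·k⁻² holds in A for some s ∈ ℂ. Then the quantum determinant of the XXZ L-matrix is the scalar L(u)₁₁·L(u−ib)₂₂ − q⁻¹·L(u)₁₂·L(u−ib)₂₁ = 4·cosh(πb(s+u−ib/2))·cosh(πb(s−u+ib/2))·1 for every u ∈ ℂ. -/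
open Matrix

/-- Under the Casimir relation the quantum determinant of the
XXZ L-matrix is the scalar `4·cosh(πb(s+u−ib/2))·cosh(πb(s−u+ib/2))`. -/
theorem xxz_quantum_determinant (b : ℝ) (hb0 : 0 < b) (hb1 : b < 1)
    (A : Type*) [Ring A] [Algebra ℂ A]
    (e f k kinv : A) (hk : k * kinv = 1) (hk' : kinv * k = 1)
    (hke : k * e = qc b • (e * k))
    (hkf : k * f = (qc b)⁻¹ • (f * k))
    (hef : e * f - f * e = (qc b - (qc b)⁻¹) • (kinv * kinv - k * k))
    (s : ℂ)
    (hcas : f * e =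
      (4 * Complex.cosh (((Real.pi * b : ℝ) : ℂ) * s) ^ 2 - 2) • (1 : A) +
        qc b • (k * k) + (qc b)⁻¹ • (kinv * kinv)) :
    ∀ u : ℂ,
      xxzL b e f k kinv u 0 0 * xxzL b e f k kinv (u - Complex.I * (b : ℂ)) 1 1 -
          (qc b)⁻¹ •
            (xxzL b e f k kinv u 0 1 * xxzL b e f k kinv (u - Complex.I * (b : ℂ)) 1 0) =
        (4 * Complex.cosh (((Real.pi * b : ℝ) : ℂ) * (s + u - Complex.I * (b : ℂ) / 2)) *
          Complex.cosh (((Real.pi * b : ℝ) : ℂ) * (s - u + Complex.I * (b : ℂ) / 2))) •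
          (1 : A) := by
  intro u
  set c : ℂ := ((Real.pi * b : ℝ) : ℂ) with hc
  have hq0 : qc b ≠ 0 := Complex.exp_ne_zero _
  have hq : qc b = Complex.exp (c * (Complex.I * (b : ℂ))) := by
    unfold qc
    congr 1
    rw [hc]
    push_cast
    ring
  have h1 : Complex.exp (c * (u - Complex.I * (b : ℂ))) = Complex.exp (c * u) * (qc b)⁻¹ := by
    rw [hq, ← Complex.exp_neg, ← Complex.exp_add]
    congr 1
    ring
  have h2 : Complex.exp (-(c * (u - Complex.I * (b : ℂ)))) = (Complex.exp (c * u))⁻¹ * qc b := by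
    rw [hq, ← Complex.exp_neg, ← Complex.exp_add]
    congr 1
    ring
  have hE0 : Complex.exp (c * u) ≠ 0 := Complex.exp_ne_zero _
  have hS0 : Complex.exp (c * s) ≠ 0 := Complex.exp_ne_zero _
  have hr0 : Complex.exp (c * (Complex.I * (b : ℂ) / 2)) ≠ 0 := Complex.exp_ne_zero _
  have hr : qc b = Complex.exp (c * (Complex.I * (b : ℂ) / 2)) ^ 2 := by
    rw [hq, ← Complex.exp_nat_mul]
    congr 1
    push_cast
    ring
  have hR : 4 * Complex.cosh (c * (s + u - Complex.I * (b : ℂ) / 2)) *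
          Complex.cosh (c * (s - u + Complex.I * (b : ℂ) / 2)) =
      (4 * Complex.cosh (c * s) ^ 2 - 2) + Complex.exp (c * u) ^ 2 * (qc b)⁻¹ +
        (Complex.exp (c * u))⁻¹ ^ 2 * qc b := by
    rw [hr]
    simp only [Complex.cosh, mul_add, mul_sub, Complex.exp_add, Complex.exp_sub, Complex.exp_neg]
    field_simp
    ring
  rw [hR]
  simp only [xxzL, Matrix.of_apply, Matrix.cons_val_zero, Matrix.cons_val_one, Matrix.cons_val',
    Matrix.cons_val_fin_one]
  rw [← hc, h1, h2, Complex.exp_neg]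
  generalize Complex.exp (c * u) = E at *
  generalize qc b = q at *
  simp only [mul_sub, sub_mul, smul_mul_smul_comm, hk, hk', hcas]
  match_scalars <;> field_simp <;> simp [Complex.I_sq] <;> ring
end

section
/- Suppose in addition that the Casimir relation f·e = (4·cosh(πbs)² − 2)·1 + q·k² + q⁻¹·k⁻² holds in A, where s ∈ ℝ is the parameter entering the sinh–Gordon L-matrix. Then the quantum determinant of the sinh–Gordon L-matrix is the scalar L(u)₁₁·L(u−ib)₂₂ − L(u)₁₂·L(u−ib)₂₁ = 4·exp(−2πbs)·cosh(πb(s+u−ib/2))·cosh(πb(s−u+ib/2))·1 for every u ∈ ℂ. -/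
open Matrix

/-- Under the Casimir relation the quantum determinant of the
sinh–Gordon L-matrix is the scalar
`4·exp(−2πbs)·cosh(πb(s+u−ib/2))·cosh(πb(s−u+ib/2))`. -/
theorem sg_quantum_determinant (b : ℝ) (hb0 : 0 < b) (hb1 : b < 1) (s : ℝ)
    (A : Type*) [Ring A] [Algebra ℂ A]
    (e f k kinv : A) (hk : k * kinv = 1) (hk' : kinv * k = 1)
    (hke : k * e = qc b • (e * k))
    (hkf : k * f = (qc b)⁻¹ • (f * k))
    (hef : e * f - f * e = (qc b - (qc b)⁻¹) • (kinv * kinv - k * k))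
    (hcas : f * e =
      (4 * Complex.cosh (((Real.pi * b * s : ℝ) : ℂ)) ^ 2 - 2) • (1 : A) +
        qc b • (k * k) + (qc b)⁻¹ • (kinv * kinv)) :
    ∀ u : ℂ,
      sgL b s e f k kinv u 0 0 * sgL b s e f k kinv (u - Complex.I * (b : ℂ)) 1 1 -
          sgL b s e f k kinv u 0 1 * sgL b s e f k kinv (u - Complex.I * (b : ℂ)) 1 0 =
        (4 * Complex.exp (-(2 * ((Real.pi * b * s : ℝ) : ℂ))) *
          Complex.cosh (((Real.pi * b : ℝ) : ℂ) * ((s : ℂ) + u - Complex.I * (b : ℂ) / 2)) *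
          Complex.cosh (((Real.pi * b : ℝ) : ℂ) * ((s : ℂ) - u + Complex.I * (b : ℂ) / 2))) •
          (1 : A) := by
  intro u
  have hef' : e * f = (4 * Complex.cosh (((Real.pi * b * s : ℝ) : ℂ)) ^ 2 - 2) • (1 : A) +
        qc b • (kinv * kinv) + (qc b)⁻¹ • (k * k) := by
    have h := sub_eq_iff_eq_add.mp hef
    rw [h, hcas]
    module
  obtain ⟨S, hS⟩ : ∃ S, S = Complex.exp ((Real.pi * b * s : ℝ) : ℂ) := ⟨_, rfl⟩
  obtain ⟨U, hU⟩ : ∃ U, U = Complex.exp (((Real.pi * b : ℝ) : ℂ) * u) := ⟨_, rfl⟩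
  obtain ⟨h, hh⟩ : ∃ h, h = Complex.exp (Complex.I * ((Real.pi * b ^ 2 : ℝ) : ℂ) / 2) := ⟨_, rfl⟩
  have S0 : S ≠ 0 := hS ▸ Complex.exp_ne_zero _
  have U0 : U ≠ 0 := hU ▸ Complex.exp_ne_zero _
  have h0 : h ≠ 0 := hh ▸ Complex.exp_ne_zero _
  have hq : qc b = h * h := by
    rw [hh, qc, ← Complex.exp_add]; congr 1; ring
  have hE : ((Real.exp (-(Real.pi * b * s)) : ℝ) : ℂ) = S⁻¹ := by
    rw [hS, ← Complex.exp_neg]; push_cast; rfl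
  have hE2 : Complex.exp (-(2 * ((Real.pi * b * s : ℝ) : ℂ))) = S⁻¹ * S⁻¹ := by
    rw [hS, ← Complex.exp_neg, ← Complex.exp_add]; congr 1; ring
  have hU' : Complex.exp (((Real.pi * b : ℝ) : ℂ) * (u - Complex.I * (b : ℂ))) = U * h⁻¹ * h⁻¹ := by
    rw [hU, hh, ← Complex.exp_neg, ← Complex.exp_add, ← Complex.exp_add]; congr 1
    push_cast; ring
  have hc : Complex.cosh ((Real.pi * b * s : ℝ) : ℂ) = (S + S⁻¹) / 2 := by
    rw [Complex.cosh, Complex.exp_neg, ← hS]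
  have h1 : Complex.exp (((Real.pi * b : ℝ) : ℂ) * ((s : ℂ) + u - Complex.I * (b : ℂ) / 2))
      = S * U * h⁻¹ := by
    rw [hS, hU, hh, ← Complex.exp_neg, ← Complex.exp_add, ← Complex.exp_add]; congr 1
    push_cast; ring
  have h2 : Complex.exp (((Real.pi * b : ℝ) : ℂ) * ((s : ℂ) - u + Complex.I * (b : ℂ) / 2))
      = S * U⁻¹ * h := by
    rw [hS, hU, hh, ← Complex.exp_neg, ← Complex.exp_add, ← Complex.exp_add]; congr 1
    push_cast; ring
  rw [hE2, Complex.cosh, Complex.cosh, Complex.exp_neg, Complex.exp_neg, h1, h2]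
  simp only [sgL, Matrix.of_apply, Matrix.cons_val', Matrix.cons_val_zero, Matrix.cons_val_one,
    Matrix.cons_val_fin_one]
  rw [hE, Complex.exp_neg, Complex.exp_neg, hU', ← hU]
  simp only [smul_mul_smul_comm, sub_mul, mul_sub, hk, hk', hef', hc, hq]
  have hI : (-Complex.I * S⁻¹ * (-Complex.I * S⁻¹)) = -(S⁻¹ * S⁻¹) := by
    linear_combination (S⁻¹ * S⁻¹) * Complex.I_mul_I
  rw [hI]
  match_scalars <;> field_simp <;> ring
end

section
/- There exist elements A_{N,m} ∈ A (0 ≤ m ≤ N), B_{N,m} ∈ A (0 ≤ m ≤ N−1) and D_{N,m} ∈ A (0 ≤ m ≤ N), independent of u, such that the entries of the monodromy matrix M(u) = L_N(u)·…·L₂(u)·L₁(u) satisfy, for all u ∈ ℂ: M(u)₁₁ = Σ_{m=0}^{N} (−1)^m·exp((N−2m)πbu)·A_{N,m}, M(u)₁₂ = i·Σ_{m=0}^{N−1} (−1)^m·exp((N−2m)πbu)·B_{N,m}, M(u)₂₂ = Σ_{m=0}^{N} (−1)^m·exp((N−2m)πbu)·D_{N,m}. Moreover the extreme coefficients are given by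 (N−1)-fold coproducts of the generators: A_{N,0} = k_N·k_{N−1}·…·k₁, A_{N,N} = k_N⁻¹·…·k₁⁻¹, D_{N,0} = k_N⁻¹·…·k₁⁻¹, D_{N,N} = k_N·…·k₁, B_{N,0} = Σ_{j=1}^{N} (k_N·…·k_{j+1})·f_j·(k_{j−1}⁻¹·…·k₁⁻¹), and B_{N,N−1} = Σ_{j=1}^{N} (k_N⁻¹·…·k_{j+1}⁻¹)·f_j·(k_{j−1}·…·k₁). -/
open Matrix

/-- `prodDesc g lo hi = g hi · g (hi−1) · … · g (lo+1)` (equal to `1` if `hi ≤ lo`). -/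
def prodDesc {A : Type*} [Ring A] (g : ℕ → A) (lo : ℕ) : ℕ → A
  | 0 => 1
  | n + 1 => if n + 1 ≤ lo then 1 else g (n + 1) * prodDesc g lo n

open Polynomial in
theorem xxz_eval_aux {A : Type*} [Ring A] [Algebra ℂ A] (p : A[X]) (n : ℕ) (t : ℂ)
    (h : ∀ m, n ≤ m → p.coeff m = 0) :
    p.eval (algebraMap ℂ A t) = ∑ m ∈ Finset.range n, t ^ m • p.coeff m := by
  have h2 : p.degree < n := (Polynomial.degree_lt_iff_coeff_zero p n).2 h
  rcases Nat.eq_zero_or_pos n with rfl | hn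
  · have : p = 0 := by ext m; simpa using h m (Nat.zero_le _)
    simp [this]
  · have h3 : p.natDegree < n := by
      have : p.natDegree ≤ n - 1 :=
        Polynomial.natDegree_le_iff_coeff_eq_zero.2 (fun m hm => h m (by omega))
      omega
    rw [Polynomial.eval_eq_sum_range' h3]
    refine Finset.sum_congr rfl fun m _ => ?_
    rw [← map_pow, Algebra.smul_def, Algebra.commutes]

theorem xxz_prodDesc_succ {A : Type*} [Ring A] (g : ℕ → A) (lo n : ℕ) (h : lo ≤ n) :
    prodDesc g lo (n + 1) = g (n + 1) * prodDesc g lo n := by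
  rw [prodDesc, if_neg (by omega)]

theorem xxz_prodDesc_self {A : Type*} [Ring A] (g : ℕ → A) (n : ℕ) :
    prodDesc g n n = 1 := by
  cases n <;> simp [prodDesc]

theorem xxz_sum_succ {A : Type*} [Ring A] (g h f : ℕ → A) (n : ℕ) :
    ∑ j ∈ Finset.Icc 1 (n + 1), prodDesc g j (n + 1) * f j * prodDesc h 0 (j - 1) =
      g (n + 1) * (∑ j ∈ Finset.Icc 1 n, prodDesc g j n * f j * prodDesc h 0 (j - 1)) +
        f (n + 1) * prodDesc h 0 n := by
  rw [Finset.sum_Icc_succ_top (by omega), xxz_prodDesc_self, Finset.mul_sum]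
  congr 1
  · refine Finset.sum_congr rfl fun j hj => ?_
    rw [xxz_prodDesc_succ _ _ _ (Finset.mem_Icc.1 hj).2]
    simp only [mul_assoc]
  · simp

open Polynomial in
theorem xxz_aux {A : Type*} [Ring A] [Algebra ℂ A] (b : ℝ) (e f k kinv : ℕ → A) (n : ℕ) :
    ∃ p r s d : A[X],
      (∀ u x y t : ℂ, x = Complex.exp (((Real.pi * b : ℝ) : ℂ) * u) →
        y = Complex.exp (-(((Real.pi * b : ℝ) : ℂ) * u)) → t = - y ^ 2 →
        mono (fun r => xxzL b (e r) (f r) (k r) (kinv r)) n u 0 0 =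
          x ^ n • p.eval (algebraMap ℂ A t) ∧
        mono (fun r => xxzL b (e r) (f r) (k r) (kinv r)) n u 0 1 =
          (Complex.I * x ^ n) • r.eval (algebraMap ℂ A t) ∧
        mono (fun r => xxzL b (e r) (f r) (k r) (kinv r)) n u 1 0 =
          (Complex.I * x ^ n * y ^ 2) • s.eval (algebraMap ℂ A t) ∧
        mono (fun r => xxzL b (e r) (f r) (k r) (kinv r)) n u 1 1 =
          x ^ n • d.eval (algebraMap ℂ A t)) ∧
      (∀ m, n < m → p.coeff m = 0) ∧ (∀ m, n ≤ m → r.coeff m = 0) ∧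
      (∀ m, n ≤ m → s.coeff m = 0) ∧ (∀ m, n < m → d.coeff m = 0) ∧
      p.coeff 0 = prodDesc k 0 n ∧
      p.coeff n = prodDesc kinv 0 n ∧
      d.coeff 0 = prodDesc kinv 0 n ∧
      d.coeff n = prodDesc k 0 n ∧
      r.coeff 0 = ∑ j ∈ Finset.Icc 1 n, prodDesc k j n * f j * prodDesc kinv 0 (j - 1) ∧
      (r * X).coeff n = ∑ j ∈ Finset.Icc 1 n, prodDesc kinv j n * f j * prodDesc k 0 (j - 1) := by
  induction n with
  | zero =>
    refine ⟨1, 0, 0, 1, ?_, ?_, ?_, ?_, ?_, ?_⟩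
    · intros; simp [mono]
    · intro m hm; simp [coeff_one]; omega
    · simp
    · simp
    · intro m hm; simp [coeff_one]; omega
    · simp [prodDesc]
  | succ n ih =>
    obtain ⟨p, r, s, d, hM, hp, hr, hs, hd, hp0, hpn, hd0, hdn, hr0, hrn⟩ := ih
    refine ⟨C (k (n+1)) * p + C (kinv (n+1)) * p * X + C (f (n+1)) * s * X,
      C (k (n+1)) * r + C (kinv (n+1)) * (r * X) + C (f (n+1)) * d,
      C (e (n+1)) * p + C (kinv (n+1)) * s + C (k (n+1)) * s * X,
      C (kinv (n+1)) * d + C (k (n+1)) * d * X + C (e (n+1)) * r * X, ?_, ?_, ?_, ?_, ?_, ?_,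
      ?_, ?_, ?_, ?_, ?_⟩
    · intro u x y t hx hy ht
      obtain ⟨h00, h01, h10, h11⟩ := hM u x y t hx hy ht
      have hxy : x * y = 1 := by rw [hx, hy, ← Complex.exp_add]; simp
      have hI : Complex.I * Complex.I = -1 := Complex.I_mul_I
      have hc : ∀ a : A, a * algebraMap ℂ A t = t • a := fun a => by
        rw [Algebra.smul_def, Algebra.commutes]
      simp only [mono, Matrix.mul_apply, Fin.sum_univ_two, h00, h01, h10, h11]
      simp only [xxzL, ← hx, ← hy, Matrix.of_apply, Matrix.cons_val_zero, Matrix.cons_val_one,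
        Matrix.cons_val', Matrix.cons_val_fin_one, eval_add, eval_C_mul, eval_mul_X, hc,
        smul_add, smul_smul, sub_mul, smul_mul_assoc, mul_smul_comm, ← mul_assoc]
      have hIx : Complex.I ^ 2 = -1 := Complex.I_sq
      refine ⟨?_, ?_, ?_, ?_⟩
      · match_scalars <;> grind
      · match_scalars <;> grind
      · match_scalars <;> grind
      · match_scalars <;> grind
    · intro m hm
      obtain ⟨m, rfl⟩ : ∃ l, m = l + 1 := ⟨m - 1, by omega⟩
      simp [coeff_mul_X, hp m (by omega), hp (m+1) (by omega), hs m (by omega)]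
    · intro m hm
      obtain ⟨m, rfl⟩ : ∃ l, m = l + 1 := ⟨m - 1, by omega⟩
      simp [coeff_mul_X, hr m (by omega), hr (m+1) (by omega), hd (m+1) (by omega)]
    · intro m hm
      obtain ⟨m, rfl⟩ : ∃ l, m = l + 1 := ⟨m - 1, by omega⟩
      simp [coeff_mul_X, hs m (by omega), hs (m+1) (by omega), hp (m+1) (by omega)]
    · intro m hm
      obtain ⟨m, rfl⟩ : ∃ l, m = l + 1 := ⟨m - 1, by omega⟩
      simp [coeff_mul_X, hd m (by omega), hd (m+1) (by omega), hr m (by omega)]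
    · simp [xxz_prodDesc_succ, hp0]
    · simp [coeff_mul_X, xxz_prodDesc_succ, hpn, hp (n+1) (by omega), hs n le_rfl]
    · simp [xxz_prodDesc_succ, hd0]
    · simp [coeff_mul_X, xxz_prodDesc_succ, hdn, hd (n+1) (by omega), hr n le_rfl]
    · rw [xxz_sum_succ, ← hr0, ← hd0]; simp
    · rw [xxz_sum_succ, ← hrn, ← hdn, coeff_mul_X, coeff_add, coeff_add, coeff_C_mul,
        coeff_C_mul, coeff_C_mul, hr n le_rfl]; simp

/-- Structure of the entries of the XXZ monodromy matrix:
they are Laurent polynomials in `exp(πbu)` with `u`-independent coefficients, and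
the extreme coefficients are explicit coproducts of the generators. -/
theorem xxz_monodromy_structure (b : ℝ) (hb0 : 0 < b) (hb1 : b < 1)
    (A : Type*) [Ring A] [Algebra ℂ A] (N : ℕ) (hN : 1 ≤ N)
    (e f k kinv : ℕ → A)
    (hk : ∀ r, 1 ≤ r → r ≤ N → k r * kinv r = 1 ∧ kinv r * k r = 1)
    (hke : ∀ r, 1 ≤ r → r ≤ N → k r * e r = qc b • (e r * k r))
    (hkf : ∀ r, 1 ≤ r → r ≤ N → k r * f r = (qc b)⁻¹ • (f r * k r))
    (hef : ∀ r, 1 ≤ r → r ≤ N →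
      e r * f r - f r * e r = (qc b - (qc b)⁻¹) • (kinv r * kinv r - k r * k r))
    (hsites : ∀ r r', 1 ≤ r → r ≤ N → 1 ≤ r' → r' ≤ N → r ≠ r' →
      ∀ i j : Fin 4, Commute (![e r, f r, k r, kinv r] i) (![e r', f r', k r', kinv r'] j)) :
    ∃ Ac Bc Dc : ℕ → A,
      (∀ u : ℂ,
        mono (fun r => xxzL b (e r) (f r) (k r) (kinv r)) N u 0 0 =
          ∑ m ∈ Finset.range (N + 1),
            ((-1 : ℂ) ^ m *
              Complex.exp ((((N : ℂ) - 2 * (m : ℂ)) * ((Real.pi * b : ℝ) : ℂ)) * u)) • Ac m) ∧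
      (∀ u : ℂ,
        mono (fun r => xxzL b (e r) (f r) (k r) (kinv r)) N u 0 1 =
          ∑ m ∈ Finset.range N,
            (Complex.I * (-1 : ℂ) ^ m *
              Complex.exp ((((N : ℂ) - 2 * (m : ℂ)) * ((Real.pi * b : ℝ) : ℂ)) * u)) • Bc m) ∧
      (∀ u : ℂ,
        mono (fun r => xxzL b (e r) (f r) (k r) (kinv r)) N u 1 1 =
          ∑ m ∈ Finset.range (N + 1),
            ((-1 : ℂ) ^ m *
              Complex.exp ((((N : ℂ) - 2 * (m : ℂ)) * ((Real.pi * b : ℝ) : ℂ)) * u)) • Dc m) ∧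
      Ac 0 = prodDesc k 0 N ∧
      Ac N = prodDesc kinv 0 N ∧
      Dc 0 = prodDesc kinv 0 N ∧
      Dc N = prodDesc k 0 N ∧
      Bc 0 = ∑ j ∈ Finset.Icc 1 N, prodDesc k j N * f j * prodDesc kinv 0 (j - 1) ∧
      Bc (N - 1) = ∑ j ∈ Finset.Icc 1 N, prodDesc kinv j N * f j * prodDesc k 0 (j - 1) := by
  obtain ⟨p, r, s, d, hM, hp, hr, hs, hd, hp0, hpn, hd0, hdn, hr0, hrn⟩ :=
    xxz_aux b e f k kinv N
  have key : ∀ (u : ℂ) (m : ℕ),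
      Complex.exp ((((N : ℂ) - 2 * (m : ℂ)) * ((Real.pi * b : ℝ) : ℂ)) * u) =
        Complex.exp (((Real.pi * b : ℝ) : ℂ) * u) ^ N *
          (Complex.exp (-(((Real.pi * b : ℝ) : ℂ) * u)) ^ 2) ^ m := by
    intro u m
    rw [← pow_mul, ← Complex.exp_nat_mul, ← Complex.exp_nat_mul, ← Complex.exp_add]
    congr 1
    push_cast
    ring
  refine ⟨p.coeff, r.coeff, d.coeff, ?_, ?_, ?_, hp0, hpn, hd0, hdn, hr0, ?_⟩
  · intro u
    rw [(hM u _ _ _ rfl rfl rfl).1, xxz_eval_aux p (N + 1) _ (fun m hm => hp m hm),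
      Finset.smul_sum]
    refine Finset.sum_congr rfl fun m _ => ?_
    rw [smul_smul, key, neg_pow]
    congr 1
    ring
  · intro u
    rw [(hM u _ _ _ rfl rfl rfl).2.1, xxz_eval_aux r N _ hr, Finset.smul_sum]
    refine Finset.sum_congr rfl fun m _ => ?_
    rw [smul_smul, key, neg_pow]
    congr 1
    ring
  · intro u
    rw [(hM u _ _ _ rfl rfl rfl).2.2.2, xxz_eval_aux d (N + 1) _ (fun m hm => hd m hm),
      Finset.smul_sum]
    refine Finset.sum_congr rfl fun m _ => ?_
    rw [smul_smul, key, neg_pow]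
    congr 1
    ring
  · rw [← hrn]
    obtain ⟨n, rfl⟩ : ∃ l, N = l + 1 := ⟨N - 1, by omega⟩
    rw [Polynomial.coeff_mul_X]
    rfl
end

section
/- Let b > 0, let N ≥ 1 be an integer, let p₀ ∈ ℂ, and let a₀, …, a_N ∈ ℂ with a_N = 2^{−N}·exp(πb·p₀) and a₀ = (−1)^N·2^{−N}·exp(−πb·p₀). Define P(u) = exp(−Nπbu)·Σ_{m=0}^{N} a_m·exp(2mπbu). Let y₁, …, y_{N−1} ∈ ℂ satisfy sinh(πb(y_k − y_l)) ≠ 0 for all k ≠ l, and set ρ = y₁ + … + y_{N−1}. Then for every u ∈ ℂ: P(u) = sinh(πb(u + p₀ + ρ))·∏_{k=1}^{N−1} sinh(πb(u − y_k)) + Σ_{k=1}^{N−1} [∏_{l≠k} sinh(πb(u − y_l)) / sinh(πb(y_k − y_l))]·P(y_k). -/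
open Finset

open Polynomial in
theorem interp_aux (n : ℕ) (s : Finset ℕ) (hs : s.card = n) (A : ℂ[X]) (hA : A.natDegree ≤ n + 1)
    (z : ℕ → ℂ) (hz : Set.InjOn z s) (K r : ℂ) (hK : A.coeff (n+1) = K)
    (h0 : A.coeff 0 = K * ((-r) * ∏ k ∈ s, (- z k))) :
    ∃ Q : ℂ[X], (∀ x, A.eval x = K * ((x - r) * ∏ k ∈ s, (x - z k)) + x * Q.eval x) ∧
      ∀ x, Q.eval x = ∑ k ∈ s, Q.eval (z k) * ∏ l ∈ s.erase k, (x - z l) / (z k - z l) := by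
  classical
  set M : ℂ[X] := (X - C r) * ∏ k ∈ s, (X - C (z k)) with hM
  have hmon : (∏ k ∈ s, (X - C (z k))).Monic := monic_prod_of_monic _ _ fun k _ => monic_X_sub_C _
  have hMm : M.Monic := (monic_X_sub_C r).mul hmon
  have hMd : M.natDegree = n + 1 := by
    rw [hM, (monic_X_sub_C r).natDegree_mul hmon, natDegree_X_sub_C,
      natDegree_prod_of_monic _ _ fun k _ => monic_X_sub_C _]
    simp [hs, add_comm]
  have hMc : M.coeff (n+1) = 1 := by rw [← hMd]; exact hMm
  have hMe : ∀ x, M.eval x = (x - r) * ∏ k ∈ s, (x - z k) := by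
    intro x; simp [hM, eval_prod]
  set D := A - C K * M with hD
  have hD0 : D.coeff 0 = 0 := by
    rw [hD, coeff_sub, h0, coeff_C_mul, coeff_zero_eq_eval_zero, hMe]; simp
  have hDn : D.coeff (n+1) = 0 := by
    rw [hD, coeff_sub, hK, coeff_C_mul, hMc]; simp
  have hDX : D = X * D.divX := by
    conv_lhs => rw [← D.divX_mul_X_add]
    rw [hD0]; simp [mul_comm]
  refine ⟨D.divX, ?_, ?_⟩
  · intro x
    have : A = C K * M + D := by rw [hD]; ring
    have h2 := congrArg (eval x) this
    rw [eval_add, eval_mul, eval_C, hMe, hDX, eval_mul, eval_X] at h2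
    exact h2
  · have hdeg : D.divX.degree < s.card := by
      rw [degree_lt_iff_coeff_zero]
      intro m hm
      rw [coeff_divX]
      rw [hs] at hm
      rcases hm.eq_or_lt with h | h
      · rw [← h]; exact hDn
      · rw [hD, coeff_sub, coeff_C_mul, coeff_eq_zero_of_natDegree_lt (by omega),
          coeff_eq_zero_of_natDegree_lt (p := M) (by omega)]
        simp
    intro x
    have h := Lagrange.eq_interpolate hz hdeg
    conv_lhs => rw [h]
    rw [Lagrange.interpolate_apply, eval_finset_sum]
    refine Finset.sum_congr rfl fun k _ => ?_
    rw [eval_mul, eval_C, Lagrange.basis, eval_prod]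
    congr 1
    refine Finset.prod_congr rfl fun l _ => ?_
    simp [Lagrange.basisDivisor, div_eq_mul_inv, mul_comm]

theorem sinh_aux (c u v : ℂ) : Complex.sinh (c * (u - v)) =
    Complex.exp (-(c*u)) * (Complex.exp (-(c*v)) / 2) * (Complex.exp (2*c*u) - Complex.exp (2*c*v)) := by
  have h1 : Complex.exp (c*(u-v)) = Complex.exp (-(c*u)) * Complex.exp (-(c*v)) * Complex.exp (2*c*u) := by
    rw [← Complex.exp_add, ← Complex.exp_add]; ring_nf
  have h2 : Complex.exp (-(c*(u-v))) = Complex.exp (-(c*u)) * Complex.exp (-(c*v)) * Complex.exp (2*c*v) := by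
    rw [← Complex.exp_add, ← Complex.exp_add]; ring_nf
  rw [Complex.sinh, h1, h2]; ring

/-- Trigonometric Lagrange-type interpolation formula for a
Laurent polynomial `P(u) = exp(−Nπbu)·Σ_{m=0}^{N} a_m·exp(2mπbu)` with prescribed
extreme coefficients. -/
theorem trig_interpolation (b : ℝ) (hb : 0 < b) (N : ℕ) (hN : 1 ≤ N) (p₀ : ℂ)
    (a : ℕ → ℂ)
    (haN : a N = ((2 : ℂ) ^ N)⁻¹ * Complex.exp (((Real.pi * b : ℝ) : ℂ) * p₀))
    (ha0 : a 0 = (-1 : ℂ) ^ N * ((2 : ℂ) ^ N)⁻¹ *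
      Complex.exp (-(((Real.pi * b : ℝ) : ℂ) * p₀)))
    (P : ℂ → ℂ)
    (hP : ∀ u : ℂ, P u = Complex.exp (-((N : ℂ) * ((Real.pi * b : ℝ) : ℂ) * u)) *
      ∑ m ∈ Finset.range (N + 1),
        a m * Complex.exp (2 * (m : ℂ) * ((Real.pi * b : ℝ) : ℂ) * u))
    (y : ℕ → ℂ)
    (hy : ∀ k ∈ Finset.Icc 1 (N - 1), ∀ l ∈ Finset.Icc 1 (N - 1), k ≠ l →
      Complex.sinh (((Real.pi * b : ℝ) : ℂ) * (y k - y l)) ≠ 0)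
    (ρ : ℂ) (hρ : ρ = ∑ k ∈ Finset.Icc 1 (N - 1), y k) :
    ∀ u : ℂ,
      P u = Complex.sinh (((Real.pi * b : ℝ) : ℂ) * (u + p₀ + ρ)) *
          ∏ k ∈ Finset.Icc 1 (N - 1), Complex.sinh (((Real.pi * b : ℝ) : ℂ) * (u - y k)) +
        ∑ k ∈ Finset.Icc 1 (N - 1),
          (∏ l ∈ (Finset.Icc 1 (N - 1)).erase k,
            Complex.sinh (((Real.pi * b : ℝ) : ℂ) * (u - y l)) /
              Complex.sinh (((Real.pi * b : ℝ) : ℂ) * (y k - y l))) * P (y k) := by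
  obtain ⟨n, rfl⟩ : ∃ n, N = n + 1 := ⟨N - 1, by omega⟩
  simp only [Nat.add_sub_cancel] at *
  generalize ((Real.pi * b : ℝ) : ℂ) = c at *
  have hs : (Finset.Icc 1 n).card = n := by simp
  generalize Finset.Icc 1 n = s at *
  set z : ℕ → ℂ := fun k => Complex.exp (2 * c * y k) with hzdef
  have hz : Set.InjOn z s := by
    intro k hk l hl h
    by_contra hne
    apply hy k hk l hl hne
    rw [sinh_aux]
    simp only [hzdef] at h
    rw [h]; simp
  set A : Polynomial ℂ := ∑ m ∈ Finset.range (n + 1 + 1), Polynomial.C (a m) * Polynomial.X ^ m with hAdef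
  have hAc : ∀ m, m ≤ n + 1 → A.coeff m = a m := by
    intro m hm
    simp [hAdef, Polynomial.finset_sum_coeff, Polynomial.coeff_C_mul, Polynomial.coeff_X_pow]
    intro h; omega
  have hAd : A.natDegree ≤ n + 1 := by
    refine Polynomial.natDegree_sum_le_of_forall_le _ _ fun m hm => ?_
    refine (Polynomial.natDegree_C_mul_X_pow_le _ _).trans ?_
    have := Finset.mem_range.1 hm
    omega
  have hAe : ∀ u, P u = Complex.exp (-(c*u)) ^ (n+1) * A.eval (Complex.exp (2*c*u)) := by
    intro u
    rw [hP, hAdef, Polynomial.eval_finset_sum, ← Complex.exp_nat_mul]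
    congr 1
    · congr 1; push_cast; ring
    · refine Finset.sum_congr rfl fun m _ => ?_
      rw [Polynomial.eval_mul, Polynomial.eval_C, Polynomial.eval_pow, Polynomial.eval_X,
        ← Complex.exp_nat_mul]
      congr 2; ring
  set r : ℂ := Complex.exp (2 * c * (-(p₀ + ρ))) with hr
  have hpz : ∏ k ∈ s, z k = Complex.exp (2 * c * ρ) := by
    rw [hρ, Finset.mul_sum, Complex.exp_sum]
  have hpe : ∏ k ∈ s, (Complex.exp (-(c * y k)) / 2) = Complex.exp (-(c * ρ)) / 2 ^ n := by
    rw [Finset.prod_div_distrib, Finset.prod_const, hs, hρ, Finset.mul_sum, ← Finset.sum_neg_distrib,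
      Complex.exp_sum]
  obtain ⟨Q, hQ1, hQ2⟩ := interp_aux n s hs A hAd z hz (a (n+1)) r (hAc _ le_rfl) (by
    rw [hAc 0 (by omega), ha0, haN, Finset.prod_neg, hs, hpz, hr]
    have : Complex.exp (-(c * p₀)) = Complex.exp (c * p₀) * Complex.exp (2 * c * (-(p₀ + ρ))) *
        Complex.exp (2 * c * ρ) := by
      rw [← Complex.exp_add, ← Complex.exp_add]; ring_nf
    rw [this]; ring)
  intro u
  rw [hAe u, hQ1, mul_add]
  congr 1
  · have e1 : u + p₀ + ρ = u - (-(p₀ + ρ)) := by ring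
    rw [e1, sinh_aux]
    simp only [sinh_aux c u (y _)]
    rw [Finset.prod_mul_distrib, Finset.prod_mul_distrib, Finset.prod_const, hs, hpe, haN]
    have : Complex.exp (c * p₀) = Complex.exp (-(c * -(p₀ + ρ))) * Complex.exp (-(c * ρ)) := by
      rw [← Complex.exp_add]; ring_nf
    rw [this, pow_succ (2:ℂ), mul_inv]
    simp only [hzdef, hr]
    ring
  · rw [hQ2, Finset.mul_sum, Finset.mul_sum]
    refine Finset.sum_congr rfl fun k hk => ?_
    have hAk : P (y k) = Complex.exp (-(c * y k)) ^ (n+1) * (z k * Q.eval (z k)) := by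
      rw [hAe, hQ1, Finset.prod_eq_zero hk (by simp [hzdef])]
      simp [hzdef]
    obtain ⟨m, rfl⟩ : ∃ m, n = m + 1 := ⟨n - 1, by
      have := Finset.card_pos.2 ⟨k, hk⟩
      omega⟩
    have hprod : ∏ l ∈ s.erase k, Complex.sinh (c * (u - y l)) / Complex.sinh (c * (y k - y l)) =
        (Complex.exp (-(c*u)) / Complex.exp (-(c * y k))) ^ m *
          ∏ l ∈ s.erase k, (Complex.exp (2*c*u) - z l) / (z k - z l) := by
      have hc : (s.erase k).card = m := by rw [Finset.card_erase_of_mem hk, hs]; rfl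
      rw [← hc, ← Finset.prod_const, ← Finset.prod_mul_distrib]
      refine Finset.prod_congr rfl fun l _ => ?_
      rw [sinh_aux, sinh_aux, mul_div_mul_comm, mul_div_mul_comm, div_self (by simp), mul_one]
    have hsq : ∀ v, Complex.exp (-(c*v)) ^ 2 * Complex.exp (2*c*v) = 1 := by
      intro v
      rw [← Complex.exp_nat_mul, ← Complex.exp_add, ← Complex.exp_zero]
      congr 1; push_cast; ring
    rw [hAk, hprod, div_pow]
    have h1 := hsq u
    have h2 : Complex.exp (-(c * y k)) ^ 2 * z k = 1 := hsq (y k)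
    have h3 : Complex.exp (-(c * y k)) ^ m ≠ 0 := pow_ne_zero _ (Complex.exp_ne_zero _)
    generalize (∏ l ∈ s.erase k, (Complex.exp (2*c*u) - z l) / (z k - z l)) = R
    generalize Polynomial.eval (z k) Q = q
    generalize z k = zk at *
    generalize Complex.exp (-(c * y k)) = ek at *
    generalize Complex.exp (-(c * u)) = e at *
    generalize Complex.exp (2 * c * u) = zz at *
    calc _ = e ^ m * q * R * (e ^ 2 * zz) := by ring
      _ = e ^ m * q * R * (ek ^ 2 * zk) * (ek ^ m / ek ^ m) := by rw [h1, h2, div_self h3]; ring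
      _ = _ := by ring
end

section
/- For every z ∈ ℝ and every ε with 0 < ε < π, the absolutely convergent contour integral satisfies (1/2)·∫_ℝ exp(−i(t+iε)z) / ((t+iε)·sinh(t+iε)) dt = −log(1 + exp(πz)), where log denotes the (real) natural logarithm of the positive real number 1 + exp(πz). -/
open MeasureTheory

noncomputable def Fk (z : ℝ) (w : ℂ) : ℂ :=
  Complex.exp (-(Complex.I * w * (z : ℂ))) / (w * Complex.sinh w)

lemma inv_cosh_le (t : ℝ) : (Real.cosh t)⁻¹ ≤ 4 * (1 + t ^ 2)⁻¹ := by
  have h1 := Real.quadratic_le_exp_of_nonneg (abs_nonneg t)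
  have h2 : Real.exp |t| / 2 ≤ Real.cosh t := by
    rw [← Real.cosh_abs, Real.cosh_eq]
    have := Real.exp_pos (-|t|)
    linarith
  rw [sq_abs] at h1
  have h3 : (1 + t ^ 2) / 4 ≤ Real.cosh t := by
    have := abs_nonneg t
    nlinarith
  have h4 : 4 * (1 + t ^ 2)⁻¹ = ((1 + t ^ 2) / 4)⁻¹ := by
    rw [inv_div]; rfl
  rw [h4]
  exact inv_anti₀ (by positivity) h3

lemma integrable_inv_cosh : Integrable (fun t : ℝ => (Real.cosh t)⁻¹) := by
  refine (integrable_inv_one_add_sq.const_mul 4).mono' ?_ ?_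
  · exact (Real.continuous_cosh.inv₀ (fun x => (Real.cosh_pos x).ne')).aestronglyMeasurable
  · refine Filter.Eventually.of_forall fun t => ?_
    rw [Real.norm_of_nonneg (inv_nonneg.2 (Real.cosh_pos t).le)]
    exact inv_cosh_le t

lemma sinh_im_aux (t y : ℝ) :
    (Complex.sinh ((t : ℂ) + Complex.I * (y : ℂ))).im = Real.cosh t * Real.sin y := by
  rw [mul_comm, Complex.sinh_add, Complex.sinh_mul_I, Complex.cosh_mul_I,
    ← Complex.ofReal_sinh, ← Complex.ofReal_cosh, ← Complex.ofReal_sin, ← Complex.ofReal_cos]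
  simp only [Complex.add_im, Complex.mul_im, Complex.mul_re, Complex.ofReal_re, Complex.ofReal_im,
    Complex.I_re, Complex.I_im]
  ring

lemma sinh_ne_aux (w : ℂ) (h0 : 0 < w.im) (h1 : w.im < Real.pi) : Complex.sinh w ≠ 0 := by
  intro h
  have := sinh_im_aux w.re w.im
  rw [mul_comm Complex.I, Complex.re_add_im, h, Complex.zero_im] at this
  have h2 := Real.sin_pos_of_pos_of_lt_pi h0 h1
  have h3 := Real.cosh_pos w.re
  have := mul_pos h3 h2
  linarith

lemma norm_Fk (z t y : ℝ) (h0 : 0 < y) (h1 : y < Real.pi) :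
    ‖Fk z ((t : ℂ) + Complex.I * (y : ℂ))‖ ≤
      Real.exp (y * z) / (y * Real.sin y) * (Real.cosh t)⁻¹ := by
  have h2 := Real.sin_pos_of_pos_of_lt_pi h0 h1
  have h3 := Real.cosh_pos t
  unfold Fk
  rw [norm_div, norm_mul, Complex.norm_exp]
  have e : (-(Complex.I * ((t : ℂ) + Complex.I * (y : ℂ)) * (z : ℂ))).re = y * z := by
    simp
  rw [e]
  have a1 : y ≤ ‖(t : ℂ) + Complex.I * (y : ℂ)‖ := by
    have := Complex.abs_im_le_norm ((t : ℂ) + Complex.I * (y : ℂ))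
    simp only [Complex.add_im, Complex.ofReal_im, Complex.mul_im, Complex.I_re, Complex.I_im,
      Complex.ofReal_re] at this
    exact le_trans (by simp [le_abs_self]) this
  have a2 : Real.cosh t * Real.sin y ≤ ‖Complex.sinh ((t : ℂ) + Complex.I * (y : ℂ))‖ := by
    have := Complex.abs_im_le_norm (Complex.sinh ((t : ℂ) + Complex.I * (y : ℂ)))
    rw [sinh_im_aux] at this
    exact (le_abs_self _).trans this
  have : Real.exp (y * z) / (y * Real.sin y) * (Real.cosh t)⁻¹
      = Real.exp (y * z) / (y * (Real.cosh t * Real.sin y)) := by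
    field_simp
  rw [this]
  gcongr

lemma cont_Fk (z y : ℝ) (h0 : 0 < y) (h1 : y < Real.pi) :
    Continuous (fun t : ℝ => Fk z ((t : ℂ) + Complex.I * (y : ℂ))) := by
  unfold Fk
  refine Continuous.div ?_ ?_ ?_
  · fun_prop
  · have := Complex.continuous_sinh
    fun_prop
  · intro t
    refine mul_ne_zero ?_ (sinh_ne_aux _ (by simpa using h0) (by simpa using h1))
    intro h
    have := congrArg Complex.im h
    simp at this
    exact h0.ne' this

lemma int_Fk (z y : ℝ) (h0 : 0 < y) (h1 : y < Real.pi) :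
    Integrable (fun t : ℝ => Fk z ((t : ℂ) + Complex.I * (y : ℂ))) := by
  refine (integrable_inv_cosh.const_mul (Real.exp (y * z) / (y * Real.sin y))).mono'
    (cont_Fk z y h0 h1).aestronglyMeasurable ?_
  exact Filter.Eventually.of_forall fun t => norm_Fk z t y h0 h1

lemma diff_Fk (z : ℝ) (w : ℂ) (h0 : 0 < w.im) (h1 : w.im < Real.pi) :
    DifferentiableAt ℂ (Fk z) w := by
  unfold Fk
  refine DifferentiableAt.div ?_ ?_ ?_
  · fun_prop
  · exact differentiableAt_id.mul Complex.differentiable_sinh.differentiableAt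
  · refine mul_ne_zero ?_ (sinh_ne_aux _ h0 h1)
    rintro rfl
    simp at h0

lemma tendsto_inv_cosh : Filter.Tendsto (fun t : ℝ => (Real.cosh t)⁻¹) Filter.atTop (nhds 0) := by
  refine squeeze_zero' (Filter.Eventually.of_forall fun t => (inv_nonneg.2 (Real.cosh_pos t).le))
    (Filter.Eventually.of_forall inv_cosh_le) ?_
  rw [← mul_zero (4 : ℝ)]
  refine Filter.Tendsto.const_mul 4 (Filter.Tendsto.inv_tendsto_atTop ?_)
  exact Filter.tendsto_atTop_add_const_left _ _ (Filter.tendsto_pow_atTop two_ne_zero)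

lemma unif_Fk (z a b : ℝ) (ha : 0 < a) (hb : b < Real.pi) (hab : a ≤ b) :
    ∃ C : ℝ, ∀ t : ℝ, ∀ y ∈ Set.Icc a b,
      ‖Fk z ((t : ℂ) + Complex.I * (y : ℂ))‖ ≤ C * (Real.cosh t)⁻¹ := by
  have hc : ContinuousOn (fun y : ℝ => Real.exp (y * z) / (y * Real.sin y)) (Set.Icc a b) := by
    refine ContinuousOn.div (by fun_prop) (by fun_prop) ?_
    intro y hy
    have h0 : 0 < y := ha.trans_le hy.1
    exact (mul_pos h0 (Real.sin_pos_of_pos_of_lt_pi h0 (hy.2.trans_lt hb))).ne'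
  obtain ⟨C, hC⟩ := isCompact_Icc.exists_bound_of_continuousOn hc
  refine ⟨C, fun t y hy => ?_⟩
  refine (norm_Fk z t y (ha.trans_le hy.1) (hy.2.trans_lt hb)).trans ?_
  exact mul_le_mul_of_nonneg_right ((le_abs_self _).trans (hC y hy))
    (inv_nonneg.2 (Real.cosh_pos t).le)

lemma shift_Fk (z a b : ℝ) (ha : 0 < a) (hb : b < Real.pi) (hab : a ≤ b) :
    ∫ t : ℝ, Fk z ((t : ℂ) + Complex.I * (a : ℂ)) = ∫ t : ℝ, Fk z ((t : ℂ) + Complex.I * (b : ℂ)) := by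
  obtain ⟨C, hC⟩ := unif_Fk z a b ha hb hab
  have rect : ∀ R : ℝ, (∫ t in (-R)..R, Fk z ((t : ℂ) + Complex.I * (a : ℂ)))
      - (∫ t in (-R)..R, Fk z ((t : ℂ) + Complex.I * (b : ℂ)))
      = Complex.I • (∫ y in a..b, Fk z (((-R : ℝ) : ℂ) + Complex.I * (y : ℂ)))
        - Complex.I • (∫ y in a..b, Fk z ((R : ℂ) + Complex.I * (y : ℂ))) := by
    intro R
    have := Complex.integral_boundary_rect_eq_zero_of_differentiableOn (Fk z)
      ⟨-R, a⟩ ⟨R, b⟩ (by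
        intro w hw
        have h := hw.2
        simp only [Set.mem_preimage, Set.uIcc_of_le hab] at h
        exact (diff_Fk z w (ha.trans_le h.1) (h.2.trans_lt hb)).differentiableWithinAt)
    simp only [mul_comm Complex.I]
    linear_combination this
  have side : ∀ s : ℝ → ℝ, (∀ R, |s R| = |R|) →
      Filter.Tendsto (fun R : ℝ => Complex.I • ∫ y in a..b, Fk z (((s R : ℝ) : ℂ) + Complex.I * (y : ℂ)))
        Filter.atTop (nhds 0) := by
    intro s hs
    have : Filter.Tendsto (fun R : ℝ => C * (Real.cosh R)⁻¹ * |b - a|) Filter.atTop (nhds 0) := by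
      simpa using (tendsto_inv_cosh.const_mul C).mul_const |b - a|
    refine squeeze_zero_norm (fun R => ?_) this
    rw [norm_smul, Complex.norm_I, one_mul]
    refine intervalIntegral.norm_integral_le_of_norm_le_const fun y hy => ?_
    rw [Set.uIoc_of_le hab] at hy
    have := hC (s R) y ⟨hy.1.le, hy.2⟩
    rwa [← Real.cosh_abs (s R), hs, Real.cosh_abs] at this
  have lim1 := (intervalIntegral_tendsto_integral (int_Fk z a ha (hab.trans_lt hb))
    Filter.tendsto_neg_atTop_atBot Filter.tendsto_id).sub
    (intervalIntegral_tendsto_integral (int_Fk z b (ha.trans_le hab) hb)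
    Filter.tendsto_neg_atTop_atBot Filter.tendsto_id)
  have lim2 := (side (fun R => -R) (fun R => abs_neg R)).sub (side (fun R => R) (fun R => rfl))
  simp only [id] at lim1
  simp only [rect] at lim1
  have := tendsto_nhds_unique lim1 lim2
  rw [sub_zero] at this
  exact sub_eq_zero.1 this

lemma sech_ft (z : ℝ) : ∫ t : ℝ, Complex.exp (-(Complex.I * t * z)) / (Real.cosh t : ℂ)
    = Real.pi / (Real.cosh (Real.pi * z / 2) : ℂ) := by
  set s : ℂ := (1 - Complex.I * z) / 2 with hs
  have hre : s.re = 1 / 2 := by simp [hs]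
  have hre2 : (1 - s).re = 1 / 2 := by rw [Complex.sub_re, hre]; norm_num
  have hB := Complex.Gamma_mul_Gamma_eq_betaIntegral (s := s) (t := 1 - s)
    (by rw [hre]; norm_num) (by rw [hre2]; norm_num)
  rw [Complex.Gamma_mul_Gamma_one_sub, add_sub_cancel, Complex.Gamma_one, one_mul] at hB
  have hsin : Complex.sin (Real.pi * s) = (Real.cosh (Real.pi * z / 2) : ℂ) := by
    have : (Real.pi : ℂ) * s = Real.pi / 2 - ((Real.pi * z / 2 : ℝ) : ℂ) * Complex.I := by
      rw [hs]; push_cast; ring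
    rw [this, Complex.sin_pi_div_two_sub, Complex.cos_mul_I, Complex.ofReal_cosh]
  rw [hsin] at hB
  rw [hB, Complex.betaIntegral, intervalIntegral.integral_of_le zero_le_one,
    integral_Ioc_eq_integral_Ioo]
  have hd : ∀ t : ℝ, HasDerivAt (fun t : ℝ => Real.sigmoid (2 * t))
      (Real.sigmoid (2 * t) * (1 - Real.sigmoid (2 * t)) * 2) t := by
    intro t
    have := (Real.hasDerivAt_sigmoid (2 * t)).comp t ((hasDerivAt_id t).const_mul 2)
    exact this.congr_deriv (by simp)
  have him : (fun t : ℝ => Real.sigmoid (2 * t)) '' Set.univ = Set.Ioo 0 1 := by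
    rw [← Real.range_sigmoid, Set.image_univ]
    ext x
    constructor
    · rintro ⟨t, rfl⟩; exact ⟨2 * t, rfl⟩
    · rintro ⟨t, rfl⟩; exact ⟨t / 2, by simp only; congr 1; ring⟩
  rw [← him, integral_image_eq_integral_abs_deriv_smul MeasurableSet.univ
    (fun t _ => (hd t).hasDerivWithinAt)
    (fun x _ y _ h => by have := Real.sigmoid_injective h; linarith), setIntegral_univ]
  refine integral_congr_ae (Filter.Eventually.of_forall fun t => ?_)
  simp only
  have hc := Real.cosh_pos t
  have e1 : Real.sigmoid (2 * t) = Real.exp (t - Real.log (2 * Real.cosh t)) := by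
    rw [Real.exp_sub, Real.exp_log (by positivity), Real.sigmoid_def, Real.cosh_eq,
      show -(2 * t) = -t + -t by ring, Real.exp_add, Real.exp_neg]
    have := Real.exp_pos t
    field_simp
  have e2 : 1 - Real.sigmoid (2 * t) = Real.exp (-t - Real.log (2 * Real.cosh t)) := by
    rw [← Real.sigmoid_neg, Real.exp_sub, Real.exp_log (by positivity), Real.sigmoid_def, Real.cosh_eq,
      show -(-(2 * t)) = t + t by ring, Real.exp_add, Real.exp_neg]
    have := Real.exp_pos t
    field_simp
    try ring
  have e3 : ∀ (a : ℝ) (c : ℂ), ((Real.exp a : ℝ) : ℂ) ^ c = Complex.exp (a * c) := by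
    intro a c
    rw [Complex.cpow_def_of_ne_zero (by simp [Complex.exp_ne_zero]), ← Complex.ofReal_log (Real.exp_pos a).le, Real.log_exp]
  rw [← Complex.ofReal_one, ← Complex.ofReal_sub, Complex.ofReal_one, e2, e1, e3, e3, abs_of_pos (by positivity),
    Complex.real_smul]
  set L := Real.log (2 * Real.cosh t) with hL
  have hcL : (Real.cosh t : ℂ) = Complex.exp L / 2 := by
    rw [← Complex.ofReal_exp, hL, Real.exp_log (by positivity)]; push_cast; ring
  rw [hcL]
  push_cast
  rw [div_div_eq_mul_div, ← div_mul_eq_mul_div, ← Complex.exp_sub, ← Complex.exp_add]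
  have e4 : ∀ a b c d : ℂ, a = b + c + d →
      Complex.exp a * 2 = Complex.exp b * 2 * (Complex.exp c * Complex.exp d) := by
    intro a b c d h
    rw [h, Complex.exp_add, Complex.exp_add]
    ring
  simp only [Complex.exp_add, mul_assoc]
  simp only [← mul_assoc]
  rw [mul_assoc _ (Complex.exp _) (Complex.exp _), ← Complex.exp_add]
  apply e4
  rw [hs]
  ring

lemma hasDeriv_I (z : ℝ) : HasDerivAt
    (fun z : ℝ => ∫ t : ℝ, Fk z ((t : ℂ) + Complex.I * ((Real.pi / 2 : ℝ) : ℂ)))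
    (-(Real.exp (Real.pi * z / 2) : ℂ) * (Real.pi / (Real.cosh (Real.pi * z / 2) : ℂ))) z := by
  have hp := Real.pi_pos
  have hs : ∀ t : ℝ, Complex.sinh ((t : ℂ) + Complex.I * ((Real.pi / 2 : ℝ) : ℂ))
      = Complex.I * (Real.cosh t : ℂ) := by
    intro t
    rw [mul_comm Complex.I, Complex.sinh_add, Complex.sinh_mul_I, Complex.cosh_mul_I,
      ← Complex.ofReal_sin, ← Complex.ofReal_cos]
    simp [mul_comm]
  have key := hasDerivAt_integral_of_dominated_loc_of_deriv_le (μ := volume)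
    (F := fun (z : ℝ) (t : ℝ) => Fk z ((t : ℂ) + Complex.I * ((Real.pi / 2 : ℝ) : ℂ)))
    (F' := fun (z : ℝ) (t : ℝ) => -(Real.exp (Real.pi * z / 2) : ℂ) *
      (Complex.exp (-(Complex.I * t * z)) / (Real.cosh t : ℂ)))
    (bound := fun t => Real.exp (Real.pi * (z + 1) / 2) * (Real.cosh t)⁻¹)
    (x₀ := z) (s := Set.Iio (z + 1)) (Iio_mem_nhds (by linarith))
    (Filter.Eventually.of_forall fun x =>
      (cont_Fk x (Real.pi / 2) (by linarith) (by linarith)).aestronglyMeasurable)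
    (int_Fk z (Real.pi / 2) (by linarith) (by linarith))
    (by
      refine Continuous.aestronglyMeasurable ?_
      refine continuous_const.mul (Continuous.div (by fun_prop) ?_ ?_)
      · exact Complex.continuous_ofReal.comp Real.continuous_cosh
      · intro t; exact_mod_cast (Real.cosh_pos t).ne')
    (by
      refine Filter.Eventually.of_forall fun t x hx => ?_
      have hx' : x < z + 1 := hx
      rw [norm_mul, norm_neg, norm_div, Complex.norm_exp, Complex.norm_real, Complex.norm_real,
        Real.norm_of_nonneg (Real.exp_pos _).le, Real.norm_of_nonneg (Real.cosh_pos t).le]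
      have : (-(Complex.I * (t : ℂ) * (x : ℂ))).re = 0 := by simp
      rw [this, Real.exp_zero, one_div]
      have := Real.cosh_pos t
      gcongr)
    (integrable_inv_cosh.const_mul _)
    (by
      refine Filter.Eventually.of_forall fun t x _ => ?_
      unfold Fk
      simp only [hs]
      set w : ℂ := (t : ℂ) + Complex.I * ((Real.pi / 2 : ℝ) : ℂ) with hw
      have hw0 : w ≠ 0 := by
        intro h
        have := congrArg Complex.im h
        simp [hw] at this
      have hc0 : (Real.cosh t : ℂ) ≠ 0 := by exact_mod_cast (Real.cosh_pos t).ne'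
      have h1 : HasDerivAt (fun x : ℝ => -(Complex.I * w * (x : ℂ))) (-(Complex.I * w * 1)) x :=
        ((Complex.ofRealCLM.hasDerivAt (x := x)).const_mul (Complex.I * w)).neg
      have h2 := (h1.cexp).div_const (w * (Complex.I * (Real.cosh t : ℂ)))
      refine h2.congr_deriv ?_
      have e : -(Complex.I * w * (x : ℂ)) = ((Real.pi * x / 2 : ℝ) : ℂ) + -(Complex.I * t * x) := by
        rw [hw]; push_cast; linear_combination (-(Real.pi : ℂ) / 2 * x) * Complex.I_sq
      rw [e, Complex.exp_add, Complex.ofReal_exp]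
      field_simp)
  have h := key.2
  rw [integral_const_mul, sech_ft] at h
  exact h

lemma I_eq (z : ℝ) : ∫ t : ℝ, Fk z ((t : ℂ) + Complex.I * ((Real.pi / 2 : ℝ) : ℂ))
    = -2 * ((Real.log (1 + Real.exp (Real.pi * z)) : ℝ) : ℂ) := by
  have hp := Real.pi_pos
  set G : ℝ → ℂ := fun z => (∫ t : ℝ, Fk z ((t : ℂ) + Complex.I * ((Real.pi / 2 : ℝ) : ℂ)))
    + 2 * ((Real.log (1 + Real.exp (Real.pi * z)) : ℝ) : ℂ) with hG
  have hd : ∀ z, HasDerivAt G 0 z := by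
    intro z
    have h1 : HasDerivAt (fun z : ℝ => Real.log (1 + Real.exp (Real.pi * z)))
        (Real.exp (Real.pi * z) * (Real.pi * 1) / (1 + Real.exp (Real.pi * z))) z :=
      ((((hasDerivAt_id z).const_mul Real.pi).exp).const_add 1).log (by positivity)
    have h2 := (hasDeriv_I z).add ((h1.ofReal_comp).const_mul 2)
    refine HasDerivAt.congr_deriv (f := G) h2 ?_
    rw [Real.cosh_eq, show Real.pi * z = Real.pi * z / 2 + Real.pi * z / 2 by ring, Real.exp_add,
      show (Real.pi * z / 2 + Real.pi * z / 2) / 2 = Real.pi * z / 2 by ring, Real.exp_neg]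
    have hE := Real.exp_pos (Real.pi * z / 2)
    set E := Real.exp (Real.pi * z / 2)
    have : -E * (Real.pi / ((E + E⁻¹) / 2)) + 2 * (E * E * (Real.pi * 1) / (1 + E * E)) = 0 := by
      field_simp
      ring
    exact_mod_cast this
  have hconst : ∀ x y, G x = G y := is_const_of_deriv_eq_zero
    (fun x => (hd x).differentiableAt) (fun x => (hd x).deriv)
  have hexp : ∀ c : ℝ, 0 < c → Filter.Tendsto (fun x : ℝ => Real.exp (c * x)) Filter.atBot (nhds 0) :=
    fun c hc => Real.tendsto_exp_atBot.comp (Filter.tendsto_id.const_mul_atBot hc)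
  have l1 : Filter.Tendsto (fun z : ℝ => ∫ t : ℝ, Fk z ((t : ℂ) + Complex.I * ((Real.pi / 2 : ℝ) : ℂ)))
      Filter.atBot (nhds 0) := by
    set K : ℝ := ∫ t : ℝ, (Real.cosh t)⁻¹
    have : Filter.Tendsto (fun z : ℝ => Real.exp (Real.pi / 2 * z) / (Real.pi / 2 * Real.sin (Real.pi / 2)) * K)
        Filter.atBot (nhds 0) := by
      simpa using ((hexp (Real.pi / 2) (by linarith)).div_const _).mul_const K
    refine squeeze_zero_norm (fun z => ?_) this
    rw [← integral_const_mul]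
    exact norm_integral_le_of_norm_le (integrable_inv_cosh.const_mul _)
      (Filter.Eventually.of_forall fun t => norm_Fk z t _ (by linarith) (by linarith))
  have l2 : Filter.Tendsto (fun z : ℝ => 2 * ((Real.log (1 + Real.exp (Real.pi * z)) : ℝ) : ℂ))
      Filter.atBot (nhds 0) := by
    have : Filter.Tendsto (fun z : ℝ => Real.log (1 + Real.exp (Real.pi * z))) Filter.atBot (nhds 0) := by
      have h := ((hexp Real.pi hp).const_add 1).log (by norm_num)
      simpa using h
    have := ((Complex.continuous_ofReal.tendsto _).comp this).const_mul 2
    simpa using this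
  have l3 := l1.add l2
  rw [add_zero] at l3
  have l4 : Filter.Tendsto G Filter.atBot (nhds (G z)) := by
    refine tendsto_const_nhds.congr (fun x => hconst z x)
  have := tendsto_nhds_unique l4 l3
  simp only [hG] at this
  linear_combination this

/-- Evaluation of the shifted contour integral
`(1/2)·∫_ℝ exp(−i(t+iε)z)/((t+iε)·sinh(t+iε)) dt = −log(1+exp(πz))`. -/
theorem contour_integral_log (z : ℝ) (ε : ℝ) (hε0 : 0 < ε) (hεπ : ε < Real.pi) :
    Integrable (fun t : ℝ =>
        Complex.exp (-(Complex.I * ((t : ℂ) + Complex.I * (ε : ℂ)) * (z : ℂ))) /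
          (((t : ℂ) + Complex.I * (ε : ℂ)) *
            Complex.sinh ((t : ℂ) + Complex.I * (ε : ℂ)))) ∧
      (1 / 2 : ℂ) *
          ∫ t : ℝ,
            Complex.exp (-(Complex.I * ((t : ℂ) + Complex.I * (ε : ℂ)) * (z : ℂ))) /
              (((t : ℂ) + Complex.I * (ε : ℂ)) *
                Complex.sinh ((t : ℂ) + Complex.I * (ε : ℂ))) =
        -((Real.log (1 + Real.exp (Real.pi * z)) : ℝ) : ℂ) := by
  have hp := Real.pi_pos
  refine ⟨int_Fk z ε hε0 hεπ, ?_⟩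
  have h : ∫ t : ℝ, Fk z ((t : ℂ) + Complex.I * (ε : ℂ))
      = ∫ t : ℝ, Fk z ((t : ℂ) + Complex.I * ((Real.pi / 2 : ℝ) : ℂ)) := by
    rcases le_total ε (Real.pi / 2) with h | h
    · exact shift_Fk z ε _ hε0 (by linarith) h
    · exact (shift_Fk z _ ε (by linarith) hεπ h).symm
  rw [I_eq] at h
  change (1 / 2 : ℂ) * (∫ t : ℝ, Fk z ((t : ℂ) + Complex.I * (ε : ℂ))) = _
  rw [h]
  ring
end

section
/- For every z ∈ ℂ with |Im z| < Q/2 and every admissible ε, the reflection property w_b(z)·w_b(−z) = 1 holds; equivalently, ∫_ℝ cos(2(t+iε)z) / (2·(t+iε)·sinh(b(t+iε))·sinh((t+iε)/b)) dt = iπ·(z² + (b² + b⁻²)/12). -/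
open MeasureTheory

/-- The non-compact quantum dilogarithm `w_b` (defined for `|Im z| < Q/2`,
`Q = b + b⁻¹`, via a regularized contour integral over `ℝ + iε`). -/
noncomputable def wb (b ε : ℝ) (z : ℂ) : ℂ :=
  Complex.exp (Complex.I * ((Real.pi : ℝ) : ℂ) / 2 * z ^ 2 +
    Complex.I * ((Real.pi : ℝ) : ℂ) / 24 * ((b : ℂ) ^ 2 + ((b : ℂ))⁻¹ ^ 2) -
    ∫ t : ℝ,
      Complex.exp (-(2 * Complex.I * ((t : ℂ) + Complex.I * (ε : ℂ)) * z)) /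
        (4 * ((t : ℂ) + Complex.I * (ε : ℂ)) *
          Complex.sinh ((b : ℂ) * ((t : ℂ) + Complex.I * (ε : ℂ))) *
          Complex.sinh (((t : ℂ) + Complex.I * (ε : ℂ)) / (b : ℂ))))

section aux
open Complex

lemma aux_factor (F : ℂ → ℂ) (hF : Differentiable ℂ F) (n : ℕ) (hn : n ≠ 0) (C : ℝ)
    (hb : ∀ x : ℂ, ‖x‖ ≤ 1 → ‖F x‖ ≤ C * ‖x‖ ^ n) :
    ∃ G : ℂ → ℂ, Differentiable ℂ G ∧ ∀ x, F x = x ^ n * G x := by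
  have h1 : DifferentiableOn ℂ (fun x => F x / x ^ n) (Set.univ \ {0}) := by
    intro x hx
    have hx0 : x ≠ 0 := by simpa using hx
    exact ((hF x).div (differentiableAt_id.pow n) (pow_ne_zero n hx0)).differentiableWithinAt
  have h2 : DifferentiableOn ℂ (fun x => F x / x ^ n) (Metric.ball 0 1 \ {0}) :=
    h1.mono (by intro x hx; exact ⟨trivial, hx.2⟩)
  have h3 := Complex.differentiableOn_update_limUnder_of_bddAbove
    (Metric.ball_mem_nhds (0:ℂ) one_pos) h2 (by
      refine ⟨C, ?_⟩
      rintro _ ⟨x, ⟨hx, hx0⟩, rfl⟩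
      have hx0 : x ≠ 0 := by simpa using hx0
      have := hb x (by simpa using (le_of_lt (mem_ball_zero_iff.1 hx)))
      simp only [Function.comp, norm_div, norm_pow]
      rw [div_le_iff₀ (by positivity)]
      exact this)
  refine ⟨Function.update (fun x => F x / x ^ n) 0 ((nhdsWithin 0 {0}ᶜ).limUnder (fun x => F x / x ^ n)), ?_, ?_⟩
  · intro x
    by_cases hx : x = 0
    · subst hx
      exact h3.differentiableAt (Metric.ball_mem_nhds (0:ℂ) one_pos)
    · have := h1.differentiableAt (x := x) (by
        apply IsOpen.mem_nhds
        · exact isOpen_univ.sdiff isClosed_singleton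
        · simpa using hx)
      refine this.congr_of_eventuallyEq ?_
      filter_upwards [isOpen_ne.mem_nhds hx] with y hy
      exact Function.update_of_ne hy _ _
  · intro x
    by_cases hx : x = 0
    · subst hx
      have := hb 0 (by simp)
      simp [hn] at this ⊢
      exact this
    · rw [Function.update_of_ne hx]
      field_simp

lemma aux_exp (x : ℂ) (hx : ‖x‖ ≤ 1) (n : ℕ) (hn : 0 < n) :
    ‖exp x - ∑ m ∈ Finset.range n, x ^ m / m.factorial‖ ≤ 2 * ‖x‖ ^ n := by
  refine (Complex.exp_bound hx hn).trans ?_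
  rw [mul_comm]
  gcongr
  have h1 : (1:ℝ) ≤ n.factorial := by exact_mod_cast Nat.factorial_pos n
  have h2 : (1:ℝ) ≤ n := by exact_mod_cast hn
  have : (n.succ : ℝ) ≤ 2 * n := by push_cast; linarith
  rw [← div_eq_mul_inv, div_le_iff₀ (by positivity)]
  nlinarith

lemma aux_sinh : ∃ u : ℂ → ℂ, Differentiable ℂ u ∧ ∀ x, sinh x = x + x ^ 3 / 6 + x ^ 5 * u x := by
  obtain ⟨u, hu, h⟩ := aux_factor (fun x => sinh x - x - x ^ 3 / 6) (by fun_prop) 5 (by norm_num) 2 (by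
    intro x hx
    have h1 := aux_exp x hx 5 (by norm_num)
    have h2 := aux_exp (-x) (by simpa using hx) 5 (by norm_num)
    rw [norm_neg] at h2
    have : sinh x - x - x ^ 3 / 6 = ((exp x - ∑ m ∈ Finset.range 5, x ^ m / m.factorial) - (exp (-x) - ∑ m ∈ Finset.range 5, (-x) ^ m / m.factorial)) / 2 := by
      simp [Finset.sum_range_succ, Nat.factorial, sinh]; ring
    rw [this, norm_div]
    have := norm_sub_le (exp x - ∑ m ∈ Finset.range 5, x ^ m / m.factorial) (exp (-x) - ∑ m ∈ Finset.range 5, (-x) ^ m / m.factorial)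
    simp only [Complex.norm_ofNat]
    linarith)
  exact ⟨u, hu, fun x => by rw [← h x]; ring⟩

lemma aux_cos : ∃ u : ℂ → ℂ, Differentiable ℂ u ∧ ∀ x, cos x = 1 - x ^ 2 / 2 + x ^ 4 * u x := by
  obtain ⟨u, hu, h⟩ := aux_factor (fun x => cos x - 1 + x ^ 2 / 2) (by fun_prop) 4 (by norm_num) 2 (by
    intro x hx
    have h1 := aux_exp (x * I) (by simpa using hx) 4 (by norm_num)
    have h2 := aux_exp (-x * I) (by simpa using hx) 4 (by norm_num)
    rw [norm_mul, norm_I, mul_one] at h1 h2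
    rw [norm_neg] at h2
    have : cos x - 1 + x ^ 2 / 2 = ((exp (x * I) - ∑ m ∈ Finset.range 4, (x * I) ^ m / m.factorial) + (exp (-x * I) - ∑ m ∈ Finset.range 4, (-x * I) ^ m / m.factorial)) / 2 := by
      simp [Finset.sum_range_succ, Nat.factorial, cos, mul_pow]
      linear_combination (-x ^ 3 / 12) * I_pow_three
    rw [this, norm_div]
    have := norm_add_le (exp (x * I) - ∑ m ∈ Finset.range 4, (x * I) ^ m / m.factorial) (exp (-x * I) - ∑ m ∈ Finset.range 4, (-x * I) ^ m / m.factorial)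
    simp only [Complex.norm_ofNat]
    linarith)
  exact ⟨u, hu, fun x => by rw [← h x]; ring⟩

lemma aux_sinh_norm (w : ℂ) : Real.sinh |w.re| ≤ ‖sinh w‖ := by
  have h : ∀ w : ℂ, Real.sinh w.re ≤ ‖sinh w‖ := by
    intro w
    rw [sinh, norm_div, Real.sinh_eq]
    have := norm_sub_norm_le (exp w) (exp (-w))
    rw [norm_exp, norm_exp] at this
    simp only [Complex.norm_ofNat, neg_re] at *
    linarith
  rcases abs_choice w.re with h1 | h1 <;> rw [h1]
  · exact h w
  · simpa using h (-w)

lemma aux_sinh_low (a x : ℝ) (ha : a ≤ x) :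
    (1 - Real.exp (-2 * a)) / 2 * Real.exp x ≤ Real.sinh x := by
  rw [Real.sinh_eq]
  have : Real.exp (-x) = Real.exp (-2 * x) * Real.exp x := by rw [← Real.exp_add]; ring_nf
  rw [this]
  have h : Real.exp (-2 * x) ≤ Real.exp (-2 * a) := Real.exp_le_exp.2 (by linarith)
  nlinarith [Real.exp_pos x]

lemma aux_sinh_ne (w : ℂ) (h0 : 0 ≤ w.im) (h1 : w.im < Real.pi) (hw : w ≠ 0) : sinh w ≠ 0 := by
  by_cases hr : w.re = 0
  · have : w = (w.im : ℂ) * I := by apply Complex.ext <;> simp [hr]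
    rw [this, Complex.sinh_mul_I]
    have h2 : w.im ≠ 0 := fun h => hw (by apply Complex.ext <;> simp [hr, h])
    have := Real.sin_pos_of_pos_of_lt_pi (lt_of_le_of_ne h0 h2.symm) h1
    apply mul_ne_zero _ I_ne_zero
    rw [← ofReal_sin]
    exact_mod_cast this.ne'
  · have := aux_sinh_norm w
    have h2 : 0 < Real.sinh |w.re| := Real.sinh_pos_iff.2 (abs_pos.2 hr)
    intro h
    rw [h, norm_zero] at this
    linarith

lemma aux_tail (b ε : ℝ) (hb : 0 < b) (hε0 : 0 < ε) (z : ℂ) (hz : |z.im| < (b + b⁻¹) / 2) :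
    ∃ C c : ℝ, 0 < C ∧ 0 < c ∧ ∀ s : ℂ, 1 ≤ |s.re| → 0 ≤ s.im → s.im ≤ ε →
      ‖exp (-(2 * I * s * z)) / (4 * s * sinh (b * s) * sinh (s / b))‖ ≤ C * Real.exp (-c * |s.re|) := by
  set k1 := (1 - Real.exp (-2 * b)) / 2 with hk1
  set k2 := (1 - Real.exp (-2 * b⁻¹)) / 2 with hk2
  have hbi : 0 < b⁻¹ := inv_pos.2 hb
  have k1p : 0 < k1 := by
    have : Real.exp (-2 * b) < 1 := Real.exp_lt_one_iff.2 (by linarith)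
    rw [hk1]; linarith
  have k2p : 0 < k2 := by
    have : Real.exp (-2 * b⁻¹) < 1 := Real.exp_lt_one_iff.2 (by linarith)
    rw [hk2]; linarith
  refine ⟨Real.exp (2 * ε * |z.re|) / (4 * k1 * k2), b + b⁻¹ - 2 * |z.im|, by positivity, by linarith, ?_⟩
  intro s h1 h2 h3
  have e1 : ‖exp (-(2 * I * s * z))‖ ≤ Real.exp (2 * ε * |z.re|) * Real.exp (2 * |s.re| * |z.im|) := by
    rw [norm_exp, ← Real.exp_add, Real.exp_le_exp]
    have : (-(2 * I * s * z)).re = 2 * (s.im * z.re) + 2 * (s.re * z.im) := by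
      simp; ring
    rw [this]
    have a1 : s.im * z.re ≤ ε * |z.re| :=
      (mul_le_mul_of_nonneg_left (le_abs_self _) h2).trans (mul_le_mul_of_nonneg_right h3 (abs_nonneg _))
    have a2 : s.re * z.im ≤ |s.re| * |z.im| := by rw [← abs_mul]; exact le_abs_self _
    linarith
  have e2 : k1 * Real.exp (b * |s.re|) ≤ ‖sinh (b * s)‖ := by
    refine (aux_sinh_low b _ (le_mul_of_one_le_right hb.le h1)).trans ?_
    have := aux_sinh_norm (b * s)
    rwa [re_ofReal_mul, abs_mul, abs_of_pos hb] at this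
  have e3 : k2 * Real.exp (b⁻¹ * |s.re|) ≤ ‖sinh (s / b)‖ := by
    refine (aux_sinh_low b⁻¹ _ (le_mul_of_one_le_right hbi.le h1)).trans ?_
    have := aux_sinh_norm ((b⁻¹ : ℝ) * s)
    rw [re_ofReal_mul, abs_mul, abs_of_pos hbi] at this
    rwa [div_eq_inv_mul, ← ofReal_inv]
  have e4 : 1 ≤ ‖s‖ := h1.trans (abs_re_le_norm s)
  have e5 : 4 * 1 * (k1 * Real.exp (b * |s.re|)) * (k2 * Real.exp (b⁻¹ * |s.re|)) ≤
      ‖4 * s * sinh (b * s) * sinh (s / b)‖ := by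
    rw [norm_mul, norm_mul, norm_mul, Complex.norm_ofNat]
    gcongr
  rw [norm_div]
  calc _ ≤ Real.exp (2 * ε * |z.re|) * Real.exp (2 * |s.re| * |z.im|) /
        (4 * 1 * (k1 * Real.exp (b * |s.re|)) * (k2 * Real.exp (b⁻¹ * |s.re|))) := by
        gcongr
    _ = _ := by
        have : -(b + b⁻¹ - 2 * |z.im|) * |s.re| = 2 * |s.re| * |z.im| - b * |s.re| - b⁻¹ * |s.re| := by ring
        rw [this, Real.exp_sub, Real.exp_sub]
        field_simp

lemma aux_ne (b ε : ℝ) (hb : 0 < b) (hε : ε < Real.pi * min b b⁻¹) (s : ℂ) (h0 : 0 ≤ s.im)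
    (h1 : s.im ≤ ε) (hs : s ≠ 0) : sinh (b * s) ≠ 0 ∧ sinh (s / b) ≠ 0 := by
  have hbi : 0 < b⁻¹ := inv_pos.2 hb
  have p := Real.pi_pos
  have m1 : ε < Real.pi * b := hε.trans_le (mul_le_mul_of_nonneg_left (min_le_left _ _) p.le)
  have m2 : ε < Real.pi * b⁻¹ := hε.trans_le (mul_le_mul_of_nonneg_left (min_le_right _ _) p.le)
  have hbc : (b : ℂ) ≠ 0 := by exact_mod_cast hb.ne'
  constructor
  · apply aux_sinh_ne
    · rw [im_ofReal_mul]; positivity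
    · rw [im_ofReal_mul]
      have : b * s.im < b * (Real.pi * b⁻¹) := mul_lt_mul_of_pos_left (by linarith) hb
      refine this.trans_le (le_of_eq ?_)
      field_simp
    · exact mul_ne_zero hbc hs
  · apply aux_sinh_ne
    · rw [div_ofReal_im]; positivity
    · rw [div_ofReal_im, div_lt_iff₀ hb]; linarith
    · exact div_ne_zero hs hbc

lemma aux_int (b ε : ℝ) (hb : 0 < b) (hε0 : 0 < ε) (hε : ε < Real.pi * min b b⁻¹) (z : ℂ)
    (hz : |z.im| < (b + b⁻¹) / 2) :
    Integrable (fun t : ℝ => exp (-(2 * I * ((t : ℂ) + I * (ε : ℂ)) * z)) /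
        (4 * ((t : ℂ) + I * (ε : ℂ)) * sinh ((b : ℂ) * ((t : ℂ) + I * (ε : ℂ))) *
          sinh (((t : ℂ) + I * (ε : ℂ)) / (b : ℂ)))) := by
  obtain ⟨C, c, hC, hc, h⟩ := aux_tail b ε hb hε0 z hz
  have hcont : Continuous (fun t : ℝ => exp (-(2 * I * ((t : ℂ) + I * (ε : ℂ)) * z)) /
        (4 * ((t : ℂ) + I * (ε : ℂ)) * sinh ((b : ℂ) * ((t : ℂ) + I * (ε : ℂ))) *
          sinh (((t : ℂ) + I * (ε : ℂ)) / (b : ℂ)))) := by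
    apply Continuous.div
    · fun_prop
    · fun_prop
    · intro t
      have hs : (t : ℂ) + I * (ε : ℂ) ≠ 0 := by
        intro h; have := congrArg Complex.im h; simp at this; linarith
      have := aux_ne b ε hb hε ((t : ℂ) + I * (ε : ℂ)) (by simp; linarith) (by simp) hs
      exact mul_ne_zero (mul_ne_zero (mul_ne_zero (by norm_num) hs) this.1) this.2
  have hbd : ∀ t : ℝ, 1 ≤ |t| → ‖exp (-(2 * I * ((t : ℂ) + I * (ε : ℂ)) * z)) /
        (4 * ((t : ℂ) + I * (ε : ℂ)) * sinh ((b : ℂ) * ((t : ℂ) + I * (ε : ℂ))) *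
          sinh (((t : ℂ) + I * (ε : ℂ)) / (b : ℂ)))‖ ≤ C * Real.exp (-c * |t|) := by
    intro t ht
    have := h ((t : ℂ) + I * (ε : ℂ)) (by simpa using ht) (by simp; linarith) (by simp)
    simpa using this
  refine hcont.locallyIntegrable.integrable_of_isBigO_atBot_atTop (g := fun t => Real.exp (c * t))
    (g' := fun t => Real.exp (-c * t)) ?_ ?_ ?_ ?_
  · apply Asymptotics.IsBigO.of_bound C
    filter_upwards [Filter.eventually_le_atBot (-1)] with t ht
    have := hbd t (by rw [abs_of_nonpos (by linarith)]; linarith)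
    rw [abs_of_nonpos (by linarith)] at this
    rw [Real.norm_eq_abs, Real.abs_exp]
    simpa using this
  · refine ⟨Set.Iic 0, Filter.Iic_mem_atBot 0, ?_⟩
    exact integrableOn_exp_mul_Iic hc 0
  · apply Asymptotics.IsBigO.of_bound C
    filter_upwards [Filter.eventually_ge_atTop 1] with t ht
    have := hbd t (by rw [abs_of_nonneg (by linarith)]; linarith)
    rw [abs_of_nonneg (by linarith)] at this
    rw [Real.norm_eq_abs, Real.abs_exp]
    exact this
  · refine ⟨Set.Ioi 0, Filter.Ioi_mem_atTop 0, ?_⟩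
    exact exp_neg_integrableOn_Ioi 0 hc

lemma aux_g (b ε : ℝ) (hb : 0 < b) (hε : ε < Real.pi * min b b⁻¹) (z : ℂ) :
    ∃ g : ℂ → ℂ, g 0 = 0 ∧ (∀ s : ℂ, 0 ≤ s.im → s.im ≤ ε → DifferentiableAt ℂ g s) ∧
      ∀ s : ℂ, 0 ≤ s.im → s.im ≤ ε → s ≠ 0 →
        cos (2 * s * z) / (2 * s * sinh (b * s) * sinh (s / b)) =
          g s + 1 / 2 * (1 / s ^ 3) + -(z ^ 2 + ((b : ℂ) ^ 2 + ((b : ℂ))⁻¹ ^ 2) / 12) * (1 / s) := by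
  obtain ⟨u, hu, hu'⟩ := aux_sinh
  obtain ⟨v, hv, hv'⟩ := aux_cos
  have hbc : (b : ℂ) ≠ 0 := by exact_mod_cast hb.ne'
  set B : ℂ := (b : ℂ) with hB
  set D : ℂ → ℂ := fun s => (1 + (B * s) ^ 2 / 6 + (B * s) ^ 4 * u (B * s)) *
    (1 + (s / B) ^ 2 / 6 + (s / B) ^ 4 * u (s / B)) with hD
  have hDd : Differentiable ℂ D := by fun_prop
  have hDs : ∀ s, sinh (B * s) * sinh (s / B) = s ^ 2 * D s := by
    intro s
    rw [hu', hu', hD]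
    field_simp
  have hDne : ∀ s : ℂ, 0 ≤ s.im → s.im ≤ ε → D s ≠ 0 := by
    intro s h0 h1
    by_cases hs : s = 0
    · simp [hs, hD]
    · have := aux_ne b ε hb hε s h0 h1 hs
      have := mul_ne_zero this.1 this.2
      rw [hDs] at this
      exact right_ne_zero_of_mul this
  set R : ℂ := -(z ^ 2 + (B ^ 2 + B⁻¹ ^ 2) / 12) with hR
  set K : ℂ → ℂ := fun s => 1 / 36 + B ^ 4 * u (B * s) + B⁻¹ ^ 4 * u (s / B) +
    s ^ 2 * (B ^ 2 / 6 * (B⁻¹ ^ 4 * u (s / B)) + B⁻¹ ^ 2 / 6 * (B ^ 4 * u (B * s))) +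
    s ^ 4 * (u (B * s) * u (s / B)) with hK
  have hDK : ∀ s, D s = 1 + (B ^ 2 + B⁻¹ ^ 2) / 6 * s ^ 2 + s ^ 4 * K s := by
    intro s
    simp only [hD, hK]
    field_simp
    ring
  set W : ℂ → ℂ := fun s => 16 * z ^ 4 * v (2 * s * z) - K s - 2 * R * ((B ^ 2 + B⁻¹ ^ 2) / 6)
    - 2 * R * s ^ 2 * K s with hW
  have hWd : Differentiable ℂ W := by fun_prop
  refine ⟨fun s => s * W s / (2 * D s), by simp, ?_, ?_⟩
  · intro s h0 h1
    have := hDne s h0 h1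
    exact DifferentiableAt.div (differentiableAt_id.mul (hWd s)) ((hDd s).const_mul 2)
      (mul_ne_zero two_ne_zero this)
  · intro s h0 h1 hs
    have hd := hDne s h0 h1
    have e1 : 2 * s * sinh (B * s) * sinh (s / B) = 2 * s ^ 3 * D s := by
      rw [mul_assoc, hDs]; ring
    have e2 : cos (2 * s * z) = s ^ 4 * W s + (1 + 2 * R * s ^ 2) * D s := by
      rw [hv', hDK]
      simp only [hW]
      have : z ^ 2 = - R - (B ^ 2 + B⁻¹ ^ 2) / 12 := by rw [hR]; ring
      linear_combination (-2 * s ^ 2) * this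
    rw [e1, e2]
    field_simp
    ring

lemma aux_sne (ε : ℝ) (hε0 : 0 < ε) (t : ℝ) : (t : ℂ) + I * (ε : ℂ) ≠ 0 := by
  intro h; have := congrArg Complex.im h; simp at this; linarith

lemma aux_A (ε : ℝ) (hε0 : 0 < ε) :
    Filter.Tendsto (fun T : ℝ => ∫ t in (-T)..T, 1 / ((t : ℂ) + I * (ε : ℂ)) ^ 3) Filter.atTop (nhds 0) := by
  have hc : Continuous (fun t : ℝ => 1 / ((t : ℂ) + I * (ε : ℂ)) ^ 3) :=
    Continuous.div (by fun_prop) (by fun_prop) (fun t => pow_ne_zero _ (aux_sne ε hε0 t))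
  have h : ∀ T : ℝ, ∫ t in (-T)..T, 1 / ((t : ℂ) + I * (ε : ℂ)) ^ 3 =
      -(1 / 2) * (1 / ((T : ℂ) + I * ε) ^ 2) - -(1 / 2) * (1 / (((-T : ℝ) : ℂ) + I * ε) ^ 2) := by
    intro T
    refine intervalIntegral.integral_eq_sub_of_hasDerivAt (f := fun t : ℝ => -(1 / 2) * (1 / ((t : ℂ) + I * ε) ^ 2)) ?_ (hc.intervalIntegrable _ _)
    intro t _
    have h0 := aux_sne ε hε0 t
    have h1 : HasDerivAt (fun t : ℝ => ((t : ℂ) + I * (ε : ℂ))) 1 t :=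
      (Complex.ofRealCLM.hasDerivAt (x := t)).add_const _
    have h2 := ((h1.pow 2).inv (pow_ne_zero 2 h0)).const_mul (-(1 / 2 : ℂ))
    have h3 : HasDerivAt (fun t : ℝ => -(1 / 2) * (1 / ((t : ℂ) + I * ε) ^ 2))
        (-(1 / 2 : ℂ) * (-(((2 : ℕ) : ℂ) * ((t : ℂ) + I * ε) ^ (2 - 1) * 1) / (((t : ℂ) + I * ε) ^ 2) ^ 2)) t := by
      simp only [one_div ((_ : ℂ) ^ 2)]
      exact h2
    refine HasDerivAt.congr_deriv h3 ?_
    clear h1 h2 h3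
    generalize (t : ℂ) + I * ε = s at h0
    rw [show 2 - 1 = 1 from rfl, pow_one, Nat.cast_ofNat]
    field_simp
  have hn : ∀ T : ℝ, 0 < T → ‖∫ t in (-T)..T, 1 / ((t : ℂ) + I * (ε : ℂ)) ^ 3‖ ≤ (T ^ 2)⁻¹ := by
    intro T hT
    have hk : ∀ t : ℝ, |t| = T → ‖-(1 / 2) * (1 / ((t : ℂ) + I * ε) ^ 2)‖ ≤ 1 / 2 * (T ^ 2)⁻¹ := by
      intro t ht
      have : T ≤ ‖(t : ℂ) + I * ε‖ := by
        have := abs_re_le_norm ((t : ℂ) + I * ε)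
        simp at this; simpa [ht] using this
      rw [norm_mul, norm_div, norm_pow]
      simp only [norm_neg, norm_one, one_div, norm_inv, Complex.norm_ofNat]
      gcongr
    rw [h]
    refine (norm_sub_le _ _).trans ?_
    have a := hk T (abs_of_pos hT)
    have b := hk (-T) (by rw [abs_neg]; exact abs_of_pos hT)
    linarith
  refine squeeze_zero_norm' ((Filter.eventually_gt_atTop 0).mono hn) ?_
  exact (Filter.tendsto_pow_atTop two_ne_zero).inv_tendsto_atTop

lemma aux_B (ε : ℝ) (hε0 : 0 < ε) :
    Filter.Tendsto (fun T : ℝ => ∫ t in (-T)..T, 1 / ((t : ℂ) + I * (ε : ℂ))) Filter.atTop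
      (nhds (-(I * (Real.pi : ℂ)))) := by
  have hc : Continuous (fun t : ℝ => 1 / ((t : ℂ) + I * (ε : ℂ))) :=
    Continuous.div (by fun_prop) (by fun_prop) (fun t => (aux_sne ε hε0 t))
  have h : ∀ T : ℝ, ∫ t in (-T)..T, 1 / ((t : ℂ) + I * (ε : ℂ)) =
      -(I * ((2 * Real.arctan (T / ε) : ℝ) : ℂ)) := by
    intro T
    have := intervalIntegral.integral_eq_sub_of_hasDerivAt (a := -T) (b := T)
      (f := fun t : ℝ => ((Real.log (t ^ 2 + ε ^ 2) / 2 : ℝ) : ℂ) - I * ((Real.arctan (t / ε) : ℝ) : ℂ))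
      (f' := fun t : ℝ => 1 / ((t : ℂ) + I * (ε : ℂ))) ?_ (hc.intervalIntegrable _ _)
    · rw [this]
      simp [neg_div, Real.arctan_neg]
      ring
    intro t _
    have h0 := aux_sne ε hε0 t
    have hp : t ^ 2 + ε ^ 2 ≠ 0 := by positivity
    have h1 : HasDerivAt (fun t : ℝ => Real.log (t ^ 2 + ε ^ 2) / 2) (t / (t ^ 2 + ε ^ 2)) t := by
      have := ((((hasDerivAt_id t).pow 2).add_const (ε ^ 2)).log hp).div_const 2
      have h' : HasDerivAt (fun t : ℝ => Real.log (t ^ 2 + ε ^ 2) / 2) (((2 : ℕ) : ℝ) * t ^ (2 - 1) * 1 / (t ^ 2 + ε ^ 2) / 2) t := this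
      convert h' using 1
      norm_num
      field_simp
    have h2 : HasDerivAt (fun t : ℝ => Real.arctan (t / ε)) (ε / (t ^ 2 + ε ^ 2)) t := by
      have := ((hasDerivAt_id t).div_const ε).arctan
      have h' : HasDerivAt (fun t : ℝ => Real.arctan (t / ε)) (1 / (1 + (t / ε) ^ 2) * (1 / ε)) t := this
      convert h' using 1
      field_simp
      ring
    have h3 := h1.ofReal_comp.sub (h2.ofReal_comp.const_mul I)
    refine HasDerivAt.congr_deriv h3 ?_
    have hp' : (t : ℂ) ^ 2 + (ε : ℂ) ^ 2 ≠ 0 := by exact_mod_cast hp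
    push_cast
    rw [← mul_div_assoc, ← sub_div, div_eq_div_iff hp' h0]
    linear_combination -(ε : ℂ) ^ 2 * I_sq
  simp_rw [h]
  have h1 : Filter.Tendsto (fun T : ℝ => 2 * Real.arctan (T / ε)) Filter.atTop (nhds Real.pi) := by
    have := ((Real.tendsto_arctan_atTop.mono_right nhdsWithin_le_nhds).comp
      (Filter.tendsto_id.atTop_div_const hε0)).const_mul 2
    rw [mul_div_cancel₀ _ (two_ne_zero' ℝ)] at this
    exact this
  exact (((Complex.continuous_ofReal.tendsto _).comp h1).const_mul I).neg

lemma aux_main (b ε : ℝ) (hb : 0 < b) (hε0 : 0 < ε)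
    (hε : ε < Real.pi * min b b⁻¹) (z : ℂ) (hz : |z.im| < (b + b⁻¹) / 2)
    (hint : Integrable (fun t : ℝ => cos (2 * ((t : ℂ) + I * (ε : ℂ)) * z) /
            (2 * ((t : ℂ) + I * (ε : ℂ)) * sinh ((b : ℂ) * ((t : ℂ) + I * (ε : ℂ))) *
              sinh (((t : ℂ) + I * (ε : ℂ)) / (b : ℂ))))) :
    ∫ t : ℝ, cos (2 * ((t : ℂ) + I * (ε : ℂ)) * z) /
            (2 * ((t : ℂ) + I * (ε : ℂ)) * sinh ((b : ℂ) * ((t : ℂ) + I * (ε : ℂ))) *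
              sinh (((t : ℂ) + I * (ε : ℂ)) / (b : ℂ))) =
        I * ((Real.pi : ℝ) : ℂ) * (z ^ 2 + ((b : ℂ) ^ 2 + ((b : ℂ))⁻¹ ^ 2) / 12) := by
  obtain ⟨g, hg0, hgd, hg⟩ := aux_g b ε hb hε z
  obtain ⟨C1, c1, hC1, hc1, ht1⟩ := aux_tail b ε hb hε0 z hz
  obtain ⟨C2, c2, hC2, hc2, ht2⟩ := aux_tail b ε hb hε0 (-z) (by simpa using hz)
  set R : ℂ := -(z ^ 2 + ((b : ℂ) ^ 2 + ((b : ℂ))⁻¹ ^ 2) / 12) with hR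
  -- side bound
  set M : ℝ → ℝ := fun T => C1 * Real.exp (-c1 * T) + C2 * Real.exp (-c2 * T) +
    1 / 2 * (T ^ 3)⁻¹ + ‖R‖ * T⁻¹ with hM
  have hM0 : Filter.Tendsto M Filter.atTop (nhds 0) := by
    have e : ∀ c : ℝ, 0 < c → Filter.Tendsto (fun T : ℝ => Real.exp (-c * T)) Filter.atTop (nhds 0) := by
      intro c hc
      refine Real.tendsto_exp_atBot.comp ?_
      exact Filter.tendsto_id.const_mul_atTop_of_neg (by linarith)
    have := ((((e c1 hc1).const_mul C1).add ((e c2 hc2).const_mul C2)).add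
      ((Filter.tendsto_pow_atTop (α := ℝ) (n := 3) (by norm_num)).inv_tendsto_atTop.const_mul (1 / 2))).add
      (tendsto_inv_atTop_zero.const_mul ‖R‖)
    simp only [mul_zero, add_zero] at this
    exact this
  have hside : ∀ T : ℝ, 1 ≤ T → ∀ s : ℂ, |s.re| = T → 0 ≤ s.im → s.im ≤ ε → ‖g s‖ ≤ M T := by
    intro T hT s hs h0 h1
    have hTs : T ≤ ‖s‖ := hs ▸ abs_re_le_norm s
    have hs0 : s ≠ 0 := by
      intro h; rw [h, norm_zero] at hTs; linarith
    have e : g s = exp (-(2 * I * s * z)) / (4 * s * sinh (b * s) * sinh (s / b)) +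
        exp (-(2 * I * s * (-z))) / (4 * s * sinh (b * s) * sinh (s / b)) - 1 / 2 * (1 / s ^ 3) - R * (1 / s) := by
      have := hg s h0 h1 hs0
      have e2 : cos (2 * s * z) / (2 * s * sinh (b * s) * sinh (s / b)) =
         exp (-(2 * I * s * z)) / (4 * s * sinh (b * s) * sinh (s / b)) +
        exp (-(2 * I * s * (-z))) / (4 * s * sinh (b * s) * sinh (s / b)) := by
        rw [cos, ← add_div, div_div]
        congr 1
        · rw [add_comm]; congr 2 <;> ring
        · ring
      rw [← e2, this]; ring
    rw [e]
    have n1 := ht1 s (by rw [hs]; exact hT) h0 h1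
    have n2 := ht2 s (by rw [hs]; exact hT) h0 h1
    rw [hs] at n1 n2
    have n3 : ‖1 / 2 * (1 / s ^ 3)‖ ≤ 1 / 2 * (T ^ 3)⁻¹ := by
      rw [norm_mul, norm_div, norm_div, norm_pow]
      simp only [norm_one, Complex.norm_ofNat, one_div]
      gcongr
    have n4 : ‖R * (1 / s)‖ ≤ ‖R‖ * T⁻¹ := by
      rw [norm_mul, norm_div]
      simp only [norm_one, one_div]
      gcongr
    refine (norm_sub_le _ _).trans (add_le_add ((norm_sub_le _ _).trans (add_le_add ((norm_add_le _ _).trans (add_le_add n1 n2)) n3)) n4)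
  -- oddness
  have hodd : ∀ t : ℝ, g ((-t : ℝ) : ℂ) = - g (t : ℂ) := by
    intro t
    by_cases ht : t = 0
    · simp [ht, hg0]
    have a := hg (t : ℂ) (by simp) (by simpa using hε0.le) (by exact_mod_cast ht)
    have a' := hg ((-t : ℝ) : ℂ) (by simp) (by simpa using hε0.le) (by simpa using ht)
    push_cast at a' ⊢
    have e : cos (2 * (-(t : ℂ)) * z) / (2 * (-(t : ℂ)) * sinh (b * (-(t : ℂ))) * sinh (-(t : ℂ) / b)) =
        - (cos (2 * t * z) / (2 * t * sinh (b * t) * sinh (t / b))) := by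
      rw [show 2 * (-(t : ℂ)) * z = -(2 * t * z) by ring, cos_neg, mul_neg (b : ℂ), neg_div, sinh_neg, sinh_neg,
        ← div_neg]
      congr 1; ring
    rw [e, a] at a'
    have ht' : (t : ℂ) ≠ 0 := by exact_mod_cast ht
    have e3 : (1 : ℂ) / (-(t : ℂ)) ^ 3 = - (1 / (t : ℂ) ^ 3) := by
      rw [show (-(t : ℂ)) ^ 3 = -((t : ℂ) ^ 3) by ring, div_neg]
    have e4 : (1 : ℂ) / (-(t : ℂ)) = - (1 / (t : ℂ)) := by rw [div_neg]
    rw [e3, e4] at a'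
    linear_combination -a'
  have hzero : ∀ T : ℝ, ∫ t in (-T)..T, g (t : ℂ) = 0 := by
    intro T
    have := intervalIntegral.integral_comp_neg (a := -T) (b := T) (fun t : ℝ => g (t : ℂ))
    simp only [hodd, intervalIntegral.integral_neg, neg_neg] at this
    exact self_eq_neg.1 this.symm
  have hG : Filter.Tendsto (fun T : ℝ => ∫ t in (-T)..T, g ((t : ℂ) + I * (ε : ℂ))) Filter.atTop (nhds 0) := by
    have hn : ∀ T : ℝ, 1 ≤ T → ‖∫ t in (-T)..T, g ((t : ℂ) + I * (ε : ℂ))‖ ≤ 2 * (M T * ε) := by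
      intro T hT
      have hr := Complex.integral_boundary_rect_eq_zero_of_differentiableOn g ((-T : ℝ) : ℂ) ((T : ℂ) + I * ε) (by
        intro s hs
        have hs2 := hs.2
        simp [Set.uIcc_of_le hε0.le] at hs2
        exact (hgd s hs2.1 hs2.2).differentiableWithinAt)
      have hb1 : ∀ x : ℝ, |x| = T → ‖∫ y : ℝ in (0:ℝ)..ε, g ((x : ℂ) + y * I)‖ ≤ M T * ε := by
        intro x hx
        have := intervalIntegral.norm_integral_le_of_norm_le_const (a := 0) (b := ε) (C := M T)
          (f := fun y : ℝ => g ((x : ℂ) + y * I)) (by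
            intro y hy
            rw [Set.uIoc_of_le hε0.le] at hy
            exact hside T hT _ (by simpa using hx) (by simpa using hy.1.le) (by simpa using hy.2))
        rwa [sub_zero, abs_of_pos hε0] at this
      have a := hb1 T (abs_of_pos (by linarith))
      have a' := hb1 (-T) (by rw [abs_neg]; exact abs_of_pos (by linarith))
      simp only [ofReal_re, ofReal_im, add_re, add_im, mul_re, mul_im, I_re, I_im, zero_mul, one_mul,
        mul_zero, sub_zero, zero_sub, add_zero, zero_add, neg_zero, ofReal_zero] at hr
      rw [hzero] at hr
      have e : ∫ t in (-T)..T, g ((t : ℂ) + I * (ε : ℂ)) = I • (∫ y : ℝ in (0:ℝ)..ε, g ((T : ℂ) + y * I))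
        - I • (∫ y : ℝ in (0:ℝ)..ε, g (((-T : ℝ) : ℂ) + y * I)) := by
        simp_rw [mul_comm I (ε : ℂ)]
        linear_combination -hr
      rw [e]
      refine (norm_sub_le _ _).trans ?_
      rw [norm_smul, norm_smul, norm_I]
      linarith
    refine squeeze_zero_norm' ((Filter.eventually_ge_atTop 1).mono hn) ?_
    simpa using (hM0.mul_const ε).const_mul 2
  have hlim := MeasureTheory.intervalIntegral_tendsto_integral hint Filter.tendsto_neg_atTop_atBot Filter.tendsto_id
  have hlim2 := (hG.add ((aux_A ε hε0).const_mul (1 / 2))).add ((aux_B ε hε0).const_mul R)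
  have hcg : Continuous (fun t : ℝ => g ((t : ℂ) + I * (ε : ℂ))) := by
    rw [continuous_iff_continuousAt]
    intro t
    have h1 : ContinuousAt g ((t : ℂ) + I * (ε : ℂ)) := (hgd _ (by simpa using hε0.le) (by simp)).continuousAt
    exact ContinuousAt.comp (f := fun t : ℝ => ((t : ℂ) + I * (ε : ℂ))) h1 (by fun_prop)
  have hcA : Continuous (fun t : ℝ => 1 / ((t : ℂ) + I * (ε : ℂ)) ^ 3) :=
    Continuous.div (by fun_prop) (by fun_prop) (fun t => pow_ne_zero _ (aux_sne ε hε0 t))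
  have hcB : Continuous (fun t : ℝ => 1 / ((t : ℂ) + I * (ε : ℂ))) :=
    Continuous.div (by fun_prop) (by fun_prop) (fun t => (aux_sne ε hε0 t))
  have hcA' : Continuous (fun t : ℝ => 1 / 2 * (1 / ((t : ℂ) + I * (ε : ℂ)) ^ 3)) := continuous_const.mul hcA
  have hcB' : Continuous (fun t : ℝ => R * (1 / ((t : ℂ) + I * (ε : ℂ)))) := continuous_const.mul hcB
  have hcgA : Continuous (fun t : ℝ => g ((t : ℂ) + I * (ε : ℂ)) + 1 / 2 * (1 / ((t : ℂ) + I * (ε : ℂ)) ^ 3)) :=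
    hcg.add hcA'
  have := tendsto_nhds_unique (hlim.congr (fun T => ?_)) hlim2
  · rw [this, hR]; ring
  · rw [← intervalIntegral.integral_const_mul, ← intervalIntegral.integral_const_mul,
      ← intervalIntegral.integral_add (hcg.intervalIntegrable _ _) (hcA'.intervalIntegrable _ _),
      ← intervalIntegral.integral_add (hcgA.intervalIntegrable _ _) (hcB'.intervalIntegrable _ _)]
    apply intervalIntegral.integral_congr
    intro t _
    exact hg _ (by simpa using hε0.le) (by simp) (aux_sne ε hε0 t)

end aux

/-- The reflection property `w_b(z)·w_b(−z) = 1`; equivalently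
the value of the regularizing integral for even test exponent. -/
theorem wb_reflection (b ε : ℝ) (hb : 0 < b) (hε0 : 0 < ε)
    (hε : ε < Real.pi * min b b⁻¹) (z : ℂ) (hz : |z.im| < (b + b⁻¹) / 2) :
    wb b ε z * wb b ε (-z) = 1 ∧
      ∫ t : ℝ,
          Complex.cos (2 * ((t : ℂ) + Complex.I * (ε : ℂ)) * z) /
            (2 * ((t : ℂ) + Complex.I * (ε : ℂ)) *
              Complex.sinh ((b : ℂ) * ((t : ℂ) + Complex.I * (ε : ℂ))) *
              Complex.sinh (((t : ℂ) + Complex.I * (ε : ℂ)) / (b : ℂ))) =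
        Complex.I * ((Real.pi : ℝ) : ℂ) *
          (z ^ 2 + ((b : ℂ) ^ 2 + ((b : ℂ))⁻¹ ^ 2) / 12) := by
  have i1 := aux_int b ε hb hε0 hε z hz
  have i2 := aux_int b ε hb hε0 hε (-z) (by simpa using hz)
  have e : ∀ t : ℝ, Complex.cos (2 * ((t : ℂ) + Complex.I * (ε : ℂ)) * z) /
            (2 * ((t : ℂ) + Complex.I * (ε : ℂ)) *
              Complex.sinh ((b : ℂ) * ((t : ℂ) + Complex.I * (ε : ℂ))) *
              Complex.sinh (((t : ℂ) + Complex.I * (ε : ℂ)) / (b : ℂ))) =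
      Complex.exp (-(2 * Complex.I * ((t : ℂ) + Complex.I * (ε : ℂ)) * z)) /
        (4 * ((t : ℂ) + Complex.I * (ε : ℂ)) *
          Complex.sinh ((b : ℂ) * ((t : ℂ) + Complex.I * (ε : ℂ))) *
          Complex.sinh (((t : ℂ) + Complex.I * (ε : ℂ)) / (b : ℂ))) +
      Complex.exp (-(2 * Complex.I * ((t : ℂ) + Complex.I * (ε : ℂ)) * (-z))) /
        (4 * ((t : ℂ) + Complex.I * (ε : ℂ)) *
          Complex.sinh ((b : ℂ) * ((t : ℂ) + Complex.I * (ε : ℂ))) *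
          Complex.sinh (((t : ℂ) + Complex.I * (ε : ℂ)) / (b : ℂ))) := by
    intro t
    rw [Complex.cos, ← add_div, div_div]
    congr 1
    · rw [add_comm]; congr 2 <;> ring
    · ring
  have h := aux_main b ε hb hε0 hε z hz (by simp_rw [e]; exact i1.add i2)
  refine ⟨?_, h⟩
  simp_rw [e] at h
  rw [integral_add i1 i2] at h
  rw [wb, wb, ← Complex.exp_add, Complex.exp_eq_one_iff]
  refine ⟨0, ?_⟩
  linear_combination -h
end

section
/- For every x ∈ ℂ with |Im x| < 1/(2b) and every admissible ε, the functional equation w_b(x + ib/2) = 2·cosh(πbx)·w_b(x − ib/2) holds. -/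
open MeasureTheory

lemma sig_aux (t : ℝ) : Real.sigmoid (2*t) = Real.exp t / (2 * Real.cosh t) := by
  rw [Real.sigmoid_def, Real.cosh_eq]
  have h1 : Real.exp (-(2*t)) = Real.exp (-t) * Real.exp (-t) := by rw [← Real.exp_add]; ring_nf
  have h2 : Real.exp t * Real.exp (-t) = 1 := by rw [← Real.exp_add]; simp
  have := Real.exp_pos t
  have := Real.exp_pos (-t)
  rw [h1]
  field_simp
  linear_combination -Real.exp (-t) * h2

lemma beta_aux (p : ℂ) (h0 : 0 < p.re) (h1 : p.re < 1) :
    ∫ t : ℝ, Complex.exp ((2*p-1)*t) / Complex.cosh t =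
      (Real.pi : ℂ) / Complex.sin ((Real.pi : ℂ) * p) := by
  rw [← Complex.Gamma_mul_Gamma_one_sub,
    Complex.Gamma_mul_Gamma_eq_betaIntegral h0 (by simpa using h1)]
  have e : p + (1 - p) = 1 := by ring
  rw [e, Complex.Gamma_one, one_mul, Complex.betaIntegral,
    intervalIntegral.integral_of_le zero_le_one, integral_Ioc_eq_integral_Ioo]
  have hr : Set.Ioo (0:ℝ) 1 = (fun t : ℝ => Real.sigmoid (2*t)) '' Set.univ := by
    rw [← Real.range_sigmoid, Set.image_univ]
    ext y; constructor
    · rintro ⟨t, rfl⟩; exact ⟨t/2, by simp; ring_nf⟩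
    · rintro ⟨t, rfl⟩; exact ⟨2*t, rfl⟩
  have hd : ∀ t ∈ (Set.univ : Set ℝ), HasDerivWithinAt (fun t : ℝ => Real.sigmoid (2*t))
      (Real.sigmoid (2*t) * (1 - Real.sigmoid (2*t)) * 2) Set.univ t := by
    intro t _
    have := (Real.hasDerivAt_sigmoid (2*t)).comp t ((hasDerivAt_id t).const_mul 2)
    simp only [id, mul_one] at this
    exact this.hasDerivWithinAt
  rw [hr, integral_image_eq_integral_abs_deriv_smul MeasurableSet.univ hd]
  · rw [Measure.restrict_univ]
    refine integral_congr_ae (Filter.Eventually.of_forall fun t => ?_)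
    have hv : 0 < Real.sigmoid (2*t) := Real.sigmoid_pos _
    have hw : 0 < 1 - Real.sigmoid (2*t) := sub_pos.2 (Real.sigmoid_lt_one _)
    have hc := Real.cosh_pos t
    have e1 := sig_aux t
    have e2 : 1 - Real.sigmoid (2*t) = Real.exp (-t) / (2 * Real.cosh t) := by
      rw [← Real.sigmoid_neg, ← mul_neg, sig_aux, Real.cosh_neg]
    have l1 : Real.log (Real.sigmoid (2*t)) = t - Real.log (2 * Real.cosh t) := by
      rw [e1, Real.log_div (Real.exp_ne_zero _) (by positivity), Real.log_exp]
    have l2 : Real.log (1 - Real.sigmoid (2*t)) = -t - Real.log (2 * Real.cosh t) := by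
      rw [e2, Real.log_div (Real.exp_ne_zero _) (by positivity), Real.log_exp]
    simp only
    have hv' : ((Real.sigmoid (2*t) : ℝ) : ℂ) ≠ 0 := by exact_mod_cast hv.ne'
    have hw' : ((1 - Real.sigmoid (2*t) : ℝ) : ℂ) ≠ 0 := by exact_mod_cast hw.ne'
    rw [abs_of_pos (by positivity), ← Complex.ofReal_one, ← Complex.ofReal_sub,
      Complex.cpow_sub _ _ hv', Complex.cpow_sub _ _ hw', Complex.real_smul]
    simp only [Complex.ofReal_one, Complex.cpow_one]
    rw [Complex.cpow_def_of_ne_zero hv', Complex.cpow_def_of_ne_zero hw',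
      ← Complex.ofReal_log hv.le, ← Complex.ofReal_log hw.le, l1, l2]
    have hcc : (Complex.cosh t) ≠ 0 := by rw [← Complex.ofReal_cosh]; exact_mod_cast hc.ne'
    have hL : Complex.exp (-(Real.log (2 * Real.cosh t) : ℂ)) = 1 / (2 * Complex.cosh t) := by
      rw [Complex.exp_neg, ← Complex.ofReal_exp, Real.exp_log (by positivity)]
      push_cast; simp
    have : Complex.exp (((t - Real.log (2 * Real.cosh t) : ℝ) : ℂ) * p) *
        Complex.exp (((-t - Real.log (2 * Real.cosh t) : ℝ) : ℂ) * (1-p)) =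
        Complex.exp ((2*p-1)*t) * (1 / (2 * Complex.cosh t)) := by
      rw [← hL, ← Complex.exp_add, ← Complex.exp_add]
      congr 1; push_cast; ring
    rw [Complex.ofReal_mul, Complex.ofReal_mul]
    generalize Complex.exp (((t - Real.log (2 * Real.cosh t) : ℝ) : ℂ) * p) = A at *
    generalize Complex.exp (((-t - Real.log (2 * Real.cosh t) : ℝ) : ℂ) * (1-p)) = B at *
    generalize ((Real.sigmoid (2*t) : ℝ) : ℂ) = v at *
    generalize ((1 - Real.sigmoid (2*t) : ℝ) : ℂ) = w at *
    have : v * w * ((2:ℝ):ℂ) * (A / v * (B / w)) = 2 * (A * B) := by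
      field_simp; push_cast; ring
    rw [this, ‹A * B = _›]
    field_simp
  · intro a _ c _ h
    have := Real.sigmoid_injective h
    linarith

lemma int_exp_abs {c : ℝ} (hc : 0 < c) : Integrable (fun t : ℝ => Real.exp (-c * |t|)) := by
  have h1 : IntegrableOn (fun t : ℝ => Real.exp (-c * |t|)) (Set.Ioi 0) := by
    refine (integrableOn_exp_mul_Ioi (a := -c) (by linarith) 0).congr_fun (fun t ht => ?_) measurableSet_Ioi
    simp only [Set.mem_Ioi] at ht
    simp [abs_of_pos ht]
  have h2 : IntegrableOn (fun t : ℝ => Real.exp (-c * |t|)) (Set.Iic 0) := by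
    refine (integrableOn_exp_mul_Iic (a := c) hc 0).congr_fun (fun t ht => ?_) measurableSet_Iic
    simp only [Set.mem_Iic] at ht
    simp [abs_of_nonpos ht]
  have := h2.union h1
  rwa [Set.Iic_union_Ioi, integrableOn_univ] at this

lemma cosh_ge (t : ℝ) : Real.exp |t| / 2 ≤ Real.cosh t := by
  rw [← Real.cosh_abs, Real.cosh_eq]
  have := Real.exp_pos (-|t|)
  linarith

lemma norm_sinh_ge (t y : ℝ) : Real.cosh t * Real.sin y ≤ ‖Complex.sinh (t + y * Complex.I)‖ := by
  have h := (le_abs_self _).trans (Complex.abs_im_le_norm (Complex.sinh (t + y * Complex.I)))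
  have : (Complex.sinh (t + y * Complex.I)).im = Real.cosh t * Real.sin y := by
    rw [Complex.sinh_add, Complex.sinh_mul_I, Complex.cosh_mul_I, ← Complex.ofReal_sinh,
      ← Complex.ofReal_cosh, ← Complex.ofReal_cos, ← Complex.ofReal_sin]
    simp only [Complex.add_im, Complex.mul_im, Complex.mul_re, Complex.ofReal_re, Complex.ofReal_im,
      Complex.I_re, Complex.I_im]
    ring
  linarith

lemma sinh_ne {t y : ℝ} (hy : 0 < Real.sin y) : Complex.sinh (t + y * Complex.I) ≠ 0 := by
  intro h
  have := norm_sinh_ge t y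
  rw [h, norm_zero] at this
  have := mul_pos (Real.cosh_pos t) hy
  linarith

lemma norm_numer (k : ℂ) (t y : ℝ) : ‖Complex.exp (-(Complex.I * k * (t + y * Complex.I)))‖ =
    Real.exp (k.re * y + k.im * t) := by
  rw [Complex.norm_exp]
  congr 1
  simp

lemma f_bound (k : ℂ) (t y s c : ℝ) (hs : 0 < s) (hy : s ≤ Real.sin y) (hc : |k.im| ≤ 1 - c) :
    ‖Complex.exp (-(Complex.I * k * (t + y * Complex.I))) / Complex.sinh (t + y * Complex.I)‖ ≤
      Real.exp (k.re * y) * (2 / s) * Real.exp (-c * |t|) := by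
  rw [norm_div, norm_numer]
  have h1 : Real.exp |t| / 2 * s ≤ ‖Complex.sinh (t + y * Complex.I)‖ :=
    le_trans (mul_le_mul (cosh_ge t) hy hs.le (Real.cosh_pos t).le) (norm_sinh_ge t y)
  have h2 : k.re * y + k.im * t ≤ k.re * y + (-c * |t|) + |t| := by
    have : k.im * t ≤ |k.im| * |t| := by rw [← abs_mul]; exact le_abs_self _
    nlinarith [abs_nonneg t]
  calc _ ≤ Real.exp (k.re * y + (-c * |t|) + |t|) / (Real.exp |t| / 2 * s) := by gcongr
    _ = _ := by
      rw [Real.exp_add, Real.exp_add]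
      field_simp

lemma f_cont (k : ℂ) (y : ℝ) (hy : 0 < Real.sin y) : Continuous (fun t : ℝ =>
    Complex.exp (-(Complex.I * k * (t + y * Complex.I))) / Complex.sinh (t + y * Complex.I)) := by
  refine Continuous.div (by fun_prop) ?_ (fun t => sinh_ne hy)
  exact Complex.continuous_sinh.comp (by fun_prop)

lemma f_int (k : ℂ) (hk : |k.im| < 1) (y : ℝ) (hy : 0 < Real.sin y) : Integrable (fun t : ℝ =>
    Complex.exp (-(Complex.I * k * (t + y * Complex.I))) / Complex.sinh (t + y * Complex.I)) := by
  refine ((int_exp_abs (c := 1 - |k.im|) (by linarith)).const_mul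
    (Real.exp (k.re * y) * (2 / Real.sin y))).mono' (f_cont k y hy).aestronglyMeasurable ?_
  exact Filter.Eventually.of_forall fun t => f_bound k t y _ _ hy le_rfl (by linarith)

lemma shift (k : ℂ) (hk : |k.im| < 1) (d e : ℝ) (hd : 0 < d) (hd' : d < Real.pi)
    (he : 0 < e) (he' : e < Real.pi) :
    ∫ t : ℝ, Complex.exp (-(Complex.I * k * (t + d * Complex.I))) / Complex.sinh (t + d * Complex.I)
    = ∫ t : ℝ, Complex.exp (-(Complex.I * k * (t + e * Complex.I))) /
        Complex.sinh (t + e * Complex.I) := by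
  set f : ℂ → ℂ := fun u => Complex.exp (-(Complex.I * k * u)) / Complex.sinh u with hf
  have hsin : ∀ y ∈ Set.uIcc d e, 0 < Real.sin y := by
    intro y hy
    have : y ∈ Set.Ioo 0 Real.pi :=
      Set.OrdConnected.uIcc_subset Set.ordConnected_Ioo ⟨hd, hd'⟩ ⟨he, he'⟩ hy
    exact Real.sin_pos_of_mem_Ioo this
  obtain ⟨y0, hy0, hmin⟩ := isCompact_uIcc.exists_isMinOn (Set.nonempty_uIcc (a := d) (b := e))
    Real.continuous_sin.continuousOn
  obtain ⟨y1, hy1, hmax⟩ := isCompact_uIcc.exists_isMaxOn (Set.nonempty_uIcc (a := d) (b := e))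
    (f := fun y => Real.exp (k.re * y)) (by fun_prop)
  have hrect : ∀ T : ℝ, (∫ x : ℝ in (-T)..T, f (x + d * Complex.I)) -
      (∫ x : ℝ in (-T)..T, f (x + e * Complex.I)) +
      Complex.I • (∫ y : ℝ in d..e, f (T + y * Complex.I)) -
      Complex.I • (∫ y : ℝ in d..e, f ((-T : ℝ) + y * Complex.I)) = 0 := by
    intro T
    have := Complex.integral_boundary_rect_eq_zero_of_differentiableOn f (⟨-T, d⟩ : ℂ) (⟨T, e⟩ : ℂ) ?_
    · simpa using this
    · intro u hu
      have hu2 : u.im ∈ Set.uIcc d e := hu.2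
      have hs := sinh_ne (t := u.re) (hsin _ hu2)
      rw [Complex.re_add_im] at hs
      refine DifferentiableAt.differentiableWithinAt ?_
      exact DifferentiableAt.div (by fun_prop) (Complex.differentiable_sinh _) hs
  have hlim : ∀ y, 0 < Real.sin y → Filter.Tendsto
      (fun T : ℝ => ∫ x : ℝ in (-T)..T, f (x + y * Complex.I)) Filter.atTop
      (nhds (∫ x : ℝ, f (x + y * Complex.I))) := fun y hy =>
    intervalIntegral_tendsto_integral (f_int k hk y hy) Filter.tendsto_neg_atTop_atBot Filter.tendsto_id
  set C := Real.exp (k.re * y1) * (2 / Real.sin y0)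
  have hb : ∀ T : ℝ, ‖∫ y : ℝ in d..e, f (T + y * Complex.I)‖ ≤
      C * Real.exp (-(1 - |k.im|) * |T|) * |e - d| := by
    intro T
    refine intervalIntegral.norm_integral_le_of_norm_le_const fun y hy => ?_
    have hy' : y ∈ Set.uIcc d e := Set.uIoc_subset_uIcc hy
    refine (f_bound k T y (Real.sin y0) (1 - |k.im|) (hsin _ hy0) (hmin hy') (by linarith)).trans ?_
    have := hmax hy'
    have h0 := hsin _ hy0
    exact mul_le_mul_of_nonneg_right (mul_le_mul_of_nonneg_right this (by positivity))
      (Real.exp_pos _).le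
  have hb0 : Filter.Tendsto (fun T : ℝ => C * Real.exp (-(1 - |k.im|) * |T|) * |e - d|)
      Filter.atTop (nhds 0) := by
    have h1 : Filter.Tendsto (fun T : ℝ => Real.exp (-(1 - |k.im|) * |T|)) Filter.atTop (nhds 0) :=
      Real.tendsto_exp_atBot.comp
        (Filter.tendsto_abs_atTop_atTop.const_mul_atTop_of_neg (by linarith))
    simpa using (h1.const_mul C).mul_const |e - d|
  have s1 : Filter.Tendsto (fun T : ℝ => ∫ y : ℝ in d..e, f (T + y * Complex.I))
      Filter.atTop (nhds 0) := squeeze_zero_norm hb hb0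
  have s2 : Filter.Tendsto (fun T : ℝ => ∫ y : ℝ in d..e, f ((-T : ℝ) + y * Complex.I))
      Filter.atTop (nhds 0) := squeeze_zero_norm (fun T => by simpa using hb (-T)) hb0
  have hall := (((hlim d (hsin d Set.left_mem_uIcc)).sub (hlim e (hsin e Set.right_mem_uIcc))).add
    (s1.const_smul Complex.I)).sub (s2.const_smul Complex.I)
  simp_rw [hrect] at hall
  have := tendsto_nhds_unique hall tendsto_const_nhds
  simp only [smul_zero, add_zero, sub_zero] at this
  exact sub_eq_zero.1 this

lemma one_add_ne (k : ℂ) (hk : |k.im| < 1) : 1 + Complex.exp (Real.pi * k) ≠ 0 := by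
  intro h
  have h2 : Complex.cosh (Real.pi * k / 2) = 0 := by
    have e : 2 * Complex.cosh (Real.pi * k / 2) =
        Complex.exp (-(Real.pi * k / 2)) * (1 + Complex.exp (Real.pi * k)) := by
      rw [Complex.two_cosh, mul_add, ← Complex.exp_add, mul_one, add_comm]
      congr 2; ring
    rw [h, mul_zero] at e
    simpa using e
  have h3 := congrArg Complex.re h2
  have e4 : (Real.pi * k / 2 : ℂ) = ((Real.pi * k.re / 2 : ℝ) : ℂ) +
      ((Real.pi * k.im / 2 : ℝ) : ℂ) * Complex.I := by
    conv_lhs => rw [← Complex.re_add_im k]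
    push_cast; ring
  rw [e4, Complex.cosh_add, Complex.cosh_mul_I, Complex.sinh_mul_I, ← Complex.ofReal_cosh,
    ← Complex.ofReal_sinh, ← Complex.ofReal_cos, ← Complex.ofReal_sin] at h3
  simp only [Complex.add_re, Complex.mul_re, Complex.ofReal_re, Complex.ofReal_im, Complex.I_re,
    Complex.I_im, Complex.zero_re, Complex.mul_im] at h3
  have hpi := Real.pi_pos
  obtain ⟨ha, hb⟩ := abs_lt.1 hk
  have : 0 < Real.cos (Real.pi * k.im / 2) := Real.cos_pos_of_mem_Ioo ⟨by nlinarith, by nlinarith⟩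
  have := mul_pos (Real.cosh_pos (Real.pi * k.re / 2)) this
  linarith

lemma F_val (k : ℂ) (hk : |k.im| < 1) (d : ℝ) (hd : 0 < d) (hd' : d < Real.pi) :
    ∫ t : ℝ, Complex.exp (-(Complex.I * k * (t + d * Complex.I))) / Complex.sinh (t + d * Complex.I)
    = -2 * Real.pi * Complex.I * Complex.exp (Real.pi * k) / (1 + Complex.exp (Real.pi * k)) := by
  have hpi := Real.pi_pos
  rw [shift k hk d (Real.pi / 2) hd hd' (by positivity) (by linarith)]
  have e : ∀ t : ℝ, Complex.exp (-(Complex.I * k * (t + (Real.pi / 2 : ℝ) * Complex.I))) /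
      Complex.sinh (t + (Real.pi / 2 : ℝ) * Complex.I) =
      (-Complex.I * Complex.exp (Real.pi * k / 2)) *
        (Complex.exp ((2 * ((1 - Complex.I * k) / 2) - 1) * t) / Complex.cosh t) := by
    intro t
    have h1 : Complex.sinh (t + (Real.pi / 2 : ℝ) * Complex.I) = Complex.I * Complex.cosh t := by
      rw [Complex.sinh_add, Complex.sinh_mul_I, Complex.cosh_mul_I]
      push_cast
      simp [mul_comm]
    have h2 : Complex.exp (-(Complex.I * k * (t + (Real.pi / 2 : ℝ) * Complex.I))) =
        Complex.exp (Real.pi * k / 2) *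
        Complex.exp ((2 * ((1 - Complex.I * k) / 2) - 1) * t) := by
      rw [← Complex.exp_add]
      congr 1
      push_cast
      linear_combination (-(Real.pi * k / 2) : ℂ) * Complex.I_sq
    rw [h1, h2, mul_comm Complex.I, ← div_div, Complex.div_I]
    ring
  simp_rw [e]
  obtain ⟨ha, hb⟩ := abs_lt.1 hk
  rw [integral_const_mul, beta_aux _ (by simp; linarith) (by simp; linarith)]
  have h3 : Complex.sin (Real.pi * ((1 - Complex.I * k) / 2)) = Complex.cosh (Real.pi * k / 2) := by
    rw [← Complex.cos_mul_I, ← Complex.sin_pi_div_two_sub]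
    congr 1; ring
  have e5 : 2 * Complex.cosh (Real.pi * k / 2) * Complex.exp (Real.pi * k / 2) =
       (1 + Complex.exp (Real.pi * k)) := by
    rw [Complex.two_cosh, add_mul, ← Complex.exp_add, ← Complex.exp_add, add_comm]
    ring_nf; simp
  have e6 : Complex.exp (Real.pi * k) = Complex.exp (Real.pi * k / 2) * Complex.exp (Real.pi * k / 2) := by
    rw [← Complex.exp_add]; ring_nf
  have hne := one_add_ne k hk
  have hc : Complex.cosh (Real.pi * k / 2) ≠ 0 := by
    intro h; rw [h] at e5; simp at e5; exact hne e5.symm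
  rw [h3, ← e5, e6]
  have := Complex.exp_ne_zero (Real.pi * k / 2)
  field_simp

lemma g_bound (k : ℂ) (t d s c : ℝ) (hd : 0 < d) (hs : 0 < s) (hy : s ≤ Real.sin d)
    (hc : |k.im| ≤ 1 - c) :
    ‖Complex.exp (-(Complex.I * k * (t + d * Complex.I))) /
      (2 * (t + d * Complex.I) * Complex.sinh (t + d * Complex.I))‖ ≤
      Real.exp (k.re * d) * (2 / s) * Real.exp (-c * |t|) * (1 / (2 * d)) := by
  have h := f_bound k t d s c hs hy hc
  have h2 : d ≤ ‖(t + d * Complex.I : ℂ)‖ := by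
    have := (le_abs_self _).trans (Complex.abs_im_le_norm (t + d * Complex.I : ℂ))
    simpa using this
  have e : Complex.exp (-(Complex.I * k * (t + d * Complex.I))) /
      (2 * (t + d * Complex.I) * Complex.sinh (t + d * Complex.I)) =
      Complex.exp (-(Complex.I * k * (t + d * Complex.I))) / Complex.sinh (t + d * Complex.I) *
      (1 / (2 * (t + d * Complex.I))) := by
    rw [div_mul_div_comm, mul_one, mul_comm (Complex.sinh _)]
  rw [e, norm_mul, norm_div 1, norm_mul 2, norm_one, Complex.norm_two]
  gcongr

lemma u_ne (t d : ℝ) (hd : 0 < d) : (t + d * Complex.I : ℂ) ≠ 0 := by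
  intro h
  have := congrArg Complex.im h
  simp at this
  linarith

lemma g_cont (k : ℂ) (d : ℝ) (hd : 0 < d) (hs : 0 < Real.sin d) : Continuous (fun t : ℝ =>
    Complex.exp (-(Complex.I * k * (t + d * Complex.I))) /
      (2 * (t + d * Complex.I) * Complex.sinh (t + d * Complex.I))) := by
  refine Continuous.div (by fun_prop) ?_
    (fun t => mul_ne_zero (mul_ne_zero two_ne_zero (u_ne t d hd)) (sinh_ne hs))
  exact Continuous.mul (by fun_prop) (Complex.continuous_sinh.comp (by fun_prop))

lemma J_deriv (k : ℂ) (hk : |k.im| < 1) (d : ℝ) (hd : 0 < d) (hd' : d < Real.pi) :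
    HasDerivAt (fun k : ℂ => ∫ t : ℝ, Complex.exp (-(Complex.I * k * (t + d * Complex.I))) /
      (2 * (t + d * Complex.I) * Complex.sinh (t + d * Complex.I)))
      (-(Real.pi * Complex.exp (Real.pi * k) / (1 + Complex.exp (Real.pi * k)))) k := by
  have hs : 0 < Real.sin d := Real.sin_pos_of_pos_of_lt_pi hd hd'
  set r := (1 - |k.im|) / 2 with hr
  have hr0 : 0 < r := by rw [hr]; linarith
  have key := hasDerivAt_integral_of_dominated_loc_of_deriv_le (μ := volume) (𝕜 := ℂ)
    (F := fun k t => Complex.exp (-(Complex.I * k * ((t:ℝ) + d * Complex.I))) /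
      (2 * (t + d * Complex.I) * Complex.sinh (t + d * Complex.I)))
    (F' := fun k t => (-Complex.I / 2) * (Complex.exp (-(Complex.I * k * ((t:ℝ) + d * Complex.I))) /
      Complex.sinh (t + d * Complex.I)))
    (x₀ := k) (s := Metric.ball k r)
    (bound := fun t => Real.exp ((|k.re| + r) * d) * (2 / Real.sin d) * Real.exp (-r * |t|))
    (Metric.ball_mem_nhds k hr0)
    (Filter.Eventually.of_forall fun k => (g_cont k d hd hs).aestronglyMeasurable)
    ?_ ((f_cont k d hs).aestronglyMeasurable.const_mul _) ?_ ((int_exp_abs hr0).const_mul _) ?_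
  · have h2 := key.2
    rw [integral_const_mul, F_val k hk d hd hd'] at h2
    refine h2.congr_deriv ?_
    have := one_add_ne k hk
    field_simp
    rw [Complex.I_sq]
  · refine (((int_exp_abs (c := 1 - |k.im|) (by linarith)).const_mul
      (Real.exp (k.re * d) * (2 / Real.sin d))).mul_const (1 / (2*d))).mono'
        (g_cont k d hd hs).aestronglyMeasurable ?_
    exact Filter.Eventually.of_forall fun t => g_bound k t d _ _ hd hs le_rfl (by linarith)
  · refine Filter.Eventually.of_forall fun t z hz => ?_
    rw [Metric.mem_ball, dist_eq_norm] at hz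
    have h1 : |z.im| ≤ 1 - r := by
      have a1 := Complex.abs_im_le_norm (z - k)
      have a2 := abs_sub_abs_le_abs_sub z.im k.im
      rw [Complex.sub_im] at a1
      linarith
    have h2 : z.re ≤ |k.re| + r := by
      have a1 := (le_abs_self _).trans (Complex.abs_re_le_norm (z - k))
      rw [Complex.sub_re] at a1
      have := le_abs_self k.re
      linarith
    have h3 := f_bound z t d _ _ hs le_rfl h1
    have h4 : ‖(-Complex.I / 2 : ℂ)‖ ≤ 1 := by
      rw [norm_div, norm_neg, Complex.norm_I, Complex.norm_two]; norm_num
    rw [norm_mul]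
    refine (mul_le_of_le_one_left (norm_nonneg _) h4).trans (h3.trans ?_)
    gcongr
  · refine Filter.Eventually.of_forall fun t z _ => ?_
    have hu := u_ne t d hd
    have hsn := sinh_ne (t := t) hs
    have h1 : HasDerivAt (fun z : ℂ => -(Complex.I * z * (t + d * Complex.I)))
        (-(Complex.I * (t + d * Complex.I))) z := by
      have := ((((hasDerivAt_id z).const_mul Complex.I)).mul_const (t + d * Complex.I : ℂ)).neg
      rw [mul_one] at this
      exact this
    have h2 := h1.cexp.div_const (2 * (t + d * Complex.I) * Complex.sinh (t + d * Complex.I))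
    refine h2.congr_deriv ?_
    generalize Complex.exp (-(Complex.I * z * (t + d * Complex.I))) = E
    generalize Complex.sinh (t + d * Complex.I) = S at *
    generalize (t + d * Complex.I : ℂ) = u at *
    field_simp

lemma J_val (k : ℂ) (hk : |k.im| < 1) (d : ℝ) (hd : 0 < d) (hd' : d < Real.pi) :
    Complex.exp (∫ t : ℝ, Complex.exp (-(Complex.I * k * (t + d * Complex.I))) /
      (2 * (t + d * Complex.I) * Complex.sinh (t + d * Complex.I))) *
      (1 + Complex.exp (Real.pi * k)) = 1 := by
  have hs : 0 < Real.sin d := Real.sin_pos_of_pos_of_lt_pi hd hd'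
  set J : ℂ → ℂ := fun k => ∫ t : ℝ, Complex.exp (-(Complex.I * k * (t + d * Complex.I))) /
      (2 * (t + d * Complex.I) * Complex.sinh (t + d * Complex.I)) with hJ
  set P : ℂ → ℂ := fun k => Complex.exp (J k) * (1 + Complex.exp (Real.pi * k)) with hP
  have hPd : ∀ z : ℂ, |z.im| < 1 → HasDerivAt P 0 z := by
    intro z hz
    have h1 := (J_deriv z hz d hd hd').cexp
    have h2 : HasDerivAt (fun z : ℂ => 1 + Complex.exp (Real.pi * z))
        (Complex.exp (Real.pi * z) * Real.pi) z := by
      have := (((hasDerivAt_id z).const_mul (Real.pi : ℂ)).cexp).const_add 1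
      simpa using this
    refine (h1.mul h2).congr_deriv ?_
    have := one_add_ne z hz
    generalize Complex.exp (∫ t : ℝ, _) = A
    generalize Complex.exp (Real.pi * z) = B at *
    field_simp
    ring
  have hconv : Convex ℝ {z : ℂ | |z.im| < 1} := by
    have : {z : ℂ | |z.im| < 1} = Complex.imLm ⁻¹' (Set.Ioo (-1) 1) := by
      ext z; simp [abs_lt]
    rw [this]
    exact (convex_Ioo (-1:ℝ) 1).linear_preimage _
  have hconst : ∀ n : ℕ, P k = P (-(n:ℝ) : ℝ) := by
    intro n
    have := hconv.norm_image_sub_le_of_norm_hasDerivWithin_le (𝕜 := ℂ) (f := P) (f' := fun _ => 0)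
      (C := 0) (x := ((-(n:ℝ) : ℝ) : ℂ)) (y := k) (fun z hz => (hPd z hz).hasDerivWithinAt) (by simp)
      (show |((-(n:ℝ) : ℝ) : ℂ).im| < 1 by simp) hk
    rw [zero_mul] at this
    exact sub_eq_zero.1 (norm_le_zero_iff.1 this)
  have hexp : Filter.Tendsto (fun n : ℕ => Real.exp (-(n:ℝ) * d)) Filter.atTop (nhds 0) := by
    refine Real.tendsto_exp_atBot.comp ?_
    have := (tendsto_natCast_atTop_atTop (R := ℝ)).const_mul_atTop_of_neg (r := -d) (by linarith)
    exact this.congr fun n => by ring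
  have hexp2 : Filter.Tendsto (fun n : ℕ => Complex.exp (Real.pi * ((-(n:ℝ) : ℝ) : ℂ)))
      Filter.atTop (nhds 0) := by
    rw [tendsto_zero_iff_norm_tendsto_zero]
    have : ∀ n : ℕ, ‖Complex.exp (Real.pi * ((-(n:ℝ) : ℝ) : ℂ))‖ = Real.exp (-Real.pi * n) := by
      intro n; rw [Complex.norm_exp]; simp
    simp_rw [this]
    exact Real.tendsto_exp_atBot.comp
      ((tendsto_natCast_atTop_atTop (R := ℝ)).const_mul_atTop_of_neg (by linarith [Real.pi_pos]))
  have hJ0 : Filter.Tendsto (fun n : ℕ => J ((-(n:ℝ) : ℝ) : ℂ)) Filter.atTop (nhds 0) := by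
    set M := ∫ t : ℝ, Real.exp (-1 * |t|)
    refine squeeze_zero_norm (a := fun n : ℕ => Real.exp (-(n:ℝ) * d) *
      ((2 / Real.sin d) * M * (1 / (2 * d)))) (fun n => ?_) ?_
    · refine (norm_integral_le_of_norm_le
        ((((int_exp_abs one_pos).const_mul (Real.exp (-(n:ℝ) * d) * (2 / Real.sin d))).mul_const
          (1 / (2*d)))) (Filter.Eventually.of_forall fun t => ?_)).trans_eq ?_
      · have := g_bound ((-(n:ℝ) : ℝ) : ℂ) t d _ 1 hd hs le_rfl (by simp)
        rwa [Complex.ofReal_re] at this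
      · rw [integral_mul_const, integral_const_mul]; ring
    · simpa using hexp.mul_const ((2 / Real.sin d) * M * (1 / (2 * d)))
  have hlim : Filter.Tendsto (fun n : ℕ => P ((-(n:ℝ) : ℝ) : ℂ)) Filter.atTop (nhds 1) := by
    have := ((Complex.continuous_exp.tendsto 0).comp hJ0).mul (hexp2.const_add 1)
    rw [Complex.exp_zero, add_zero, mul_one] at this
    exact this
  have : Filter.Tendsto (fun n : ℕ => P ((-(n:ℝ) : ℝ) : ℂ)) Filter.atTop (nhds (P k)) := by
    simp_rw [← hconst]; exact tendsto_const_nhds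
  exact tendsto_nhds_unique this hlim

lemma wb_int (b ε : ℝ) (hb : 0 < b) (hε0 : 0 < ε) (h1 : 0 < Real.sin (b * ε))
    (h2 : 0 < Real.sin (ε / b)) (z : ℂ) (hz : 2 * |z.im| < b + b⁻¹) :
    Integrable (fun t : ℝ => Complex.exp (-(2 * Complex.I * ((t : ℂ) + Complex.I * (ε : ℂ)) * z)) /
        (4 * ((t : ℂ) + Complex.I * (ε : ℂ)) *
          Complex.sinh ((b : ℂ) * ((t : ℂ) + Complex.I * (ε : ℂ))) *
          Complex.sinh (((t : ℂ) + Complex.I * (ε : ℂ)) / (b : ℂ)))) := by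
  have hbc : (b : ℂ) ≠ 0 := by exact_mod_cast hb.ne'
  have e1 : ∀ t : ℝ, (b : ℂ) * ((t : ℂ) + Complex.I * (ε : ℂ)) =
      ((b * t : ℝ) : ℂ) + ((b * ε : ℝ) : ℂ) * Complex.I := by intro t; push_cast; ring
  have e2 : ∀ t : ℝ, ((t : ℂ) + Complex.I * (ε : ℂ)) / (b : ℂ) =
      ((t / b : ℝ) : ℂ) + ((ε / b : ℝ) : ℂ) * Complex.I := by intro t; push_cast; ring
  have e3 : ∀ t : ℝ, ((t : ℂ) + Complex.I * (ε : ℂ)) = t + ε * Complex.I := by intro t; ring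
  have n1 : ∀ t : ℝ, Complex.sinh ((b : ℂ) * ((t : ℂ) + Complex.I * (ε : ℂ))) ≠ 0 := by
    intro t; rw [e1]; exact sinh_ne h1
  have n2 : ∀ t : ℝ, Complex.sinh (((t : ℂ) + Complex.I * (ε : ℂ)) / (b : ℂ)) ≠ 0 := by
    intro t; rw [e2]; exact sinh_ne h2
  have n3 : ∀ t : ℝ, ((t : ℂ) + Complex.I * (ε : ℂ)) ≠ 0 := by
    intro t; rw [e3]; exact u_ne t ε hε0
  have hcont : Continuous (fun t : ℝ =>
      Complex.exp (-(2 * Complex.I * ((t : ℂ) + Complex.I * (ε : ℂ)) * z)) /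
        (4 * ((t : ℂ) + Complex.I * (ε : ℂ)) *
          Complex.sinh ((b : ℂ) * ((t : ℂ) + Complex.I * (ε : ℂ))) *
          Complex.sinh (((t : ℂ) + Complex.I * (ε : ℂ)) / (b : ℂ)))) := by
    refine Continuous.div (by fun_prop) ?_
      (fun t => mul_ne_zero (mul_ne_zero (mul_ne_zero (by norm_num) (n3 t)) (n1 t)) (n2 t))
    exact Continuous.mul (Continuous.mul (by fun_prop) (Complex.continuous_sinh.comp (by fun_prop)))
      (Complex.continuous_sinh.comp (by fun_prop))
  refine ((int_exp_abs (c := b + b⁻¹ - 2 * |z.im|) (by linarith)).const_mul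
    (Real.exp (2 * z.re * ε) / (ε * Real.sin (b * ε) * Real.sin (ε / b)))).mono'
    hcont.aestronglyMeasurable (Filter.Eventually.of_forall fun t => ?_)
  have b1 : Real.exp (b * |t|) / 2 * Real.sin (b * ε) ≤
      ‖Complex.sinh ((b : ℂ) * ((t : ℂ) + Complex.I * (ε : ℂ)))‖ := by
    rw [e1]
    refine le_trans (mul_le_mul_of_nonneg_right ?_ h1.le) (norm_sinh_ge _ _)
    have := cosh_ge (b * t)
    rwa [abs_mul, abs_of_pos hb] at this
  have b2 : Real.exp (b⁻¹ * |t|) / 2 * Real.sin (ε / b) ≤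
      ‖Complex.sinh (((t : ℂ) + Complex.I * (ε : ℂ)) / (b : ℂ))‖ := by
    rw [e2]
    refine le_trans (mul_le_mul_of_nonneg_right ?_ h2.le) (norm_sinh_ge _ _)
    have := cosh_ge (t / b)
    rwa [abs_div, abs_of_pos hb, div_eq_inv_mul |t|] at this
  have b3 : ε ≤ ‖((t : ℂ) + Complex.I * (ε : ℂ))‖ := by
    have := (le_abs_self _).trans (Complex.abs_im_le_norm ((t : ℂ) + Complex.I * (ε : ℂ)))
    simpa using this
  have b4 : ‖Complex.exp (-(2 * Complex.I * ((t : ℂ) + Complex.I * (ε : ℂ)) * z))‖ ≤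
      Real.exp (2 * z.re * ε + 2 * |z.im| * |t|) := by
    have : -(2 * Complex.I * ((t : ℂ) + Complex.I * (ε : ℂ)) * z) =
      -(Complex.I * (2 * z) * (t + ε * Complex.I)) := by ring
    rw [this, norm_numer]
    have : z.im * t ≤ |z.im| * |t| := by rw [← abs_mul]; exact le_abs_self _
    apply Real.exp_le_exp.2
    simp
    linarith
  rw [norm_div, norm_mul, norm_mul, norm_mul]
  have n4 : ‖(4:ℂ)‖ = 4 := by simp
  rw [n4]
  calc _ ≤ Real.exp (2 * z.re * ε + 2 * |z.im| * |t|) /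
        (4 * ε * (Real.exp (b * |t|) / 2 * Real.sin (b * ε)) *
          (Real.exp (b⁻¹ * |t|) / 2 * Real.sin (ε / b))) := by gcongr
    _ = _ := by
      have : Real.exp (2 * z.re * ε + 2 * |z.im| * |t|) =
        Real.exp (2 * z.re * ε) * Real.exp (-(b + b⁻¹ - 2 * |z.im|) * |t|) *
          (Real.exp (b * |t|) * Real.exp (b⁻¹ * |t|)) := by
        rw [← Real.exp_add, ← Real.exp_add, ← Real.exp_add]
        congr 1; ring
      rw [this]
      field_simp
      norm_num

/-- The functional equation
`w_b(x + ib/2) = 2·cosh(πbx)·w_b(x − ib/2)`. -/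
theorem wb_functional_equation (b ε : ℝ) (hb : 0 < b) (hε0 : 0 < ε)
    (hε : ε < Real.pi * min b b⁻¹) (x : ℂ) (hx : |x.im| < 1 / (2 * b)) :
    wb b ε (x + Complex.I * (b : ℂ) / 2) =
      2 * Complex.cosh (((Real.pi * b : ℝ) : ℂ) * x) *
        wb b ε (x - Complex.I * (b : ℂ) / 2) := by
  have hpi := Real.pi_pos
  have hbc : (b : ℂ) ≠ 0 := by exact_mod_cast hb.ne'
  have hε1 : ε < Real.pi * b := hε.trans_le (mul_le_mul_of_nonneg_left (min_le_left _ _) hpi.le)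
  have hε2 : ε < Real.pi * b⁻¹ := hε.trans_le (mul_le_mul_of_nonneg_left (min_le_right _ _) hpi.le)
  have hd : 0 < ε / b := by positivity
  have hd' : ε / b < Real.pi := by rwa [div_lt_iff₀ hb]
  have hd2 : b * ε < Real.pi := by
    rw [← div_eq_mul_inv, lt_div_iff₀ hb] at hε2; linarith
  have s1 : 0 < Real.sin (b * ε) := Real.sin_pos_of_pos_of_lt_pi (by positivity) hd2
  have s2 : 0 < Real.sin (ε / b) := Real.sin_pos_of_pos_of_lt_pi hd hd'
  have hx2 : 2 * |x.im| < b⁻¹ := by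
    have : 1 / (2 * b) = b⁻¹ / 2 := by field_simp
    rw [this] at hx; linarith
  obtain ⟨hxa, hxb⟩ := abs_lt.1 (show |x.im| < b⁻¹ / 2 by linarith)
  have i1 := wb_int b ε hb hε0 s1 s2 (x + Complex.I * (b : ℂ) / 2) (by
    have : |(x + Complex.I * (b : ℂ) / 2).im| < (b + b⁻¹) / 2 := by
      simp [abs_lt]; constructor <;> linarith
    linarith)
  have i2 := wb_int b ε hb hε0 s1 s2 (x - Complex.I * (b : ℂ) / 2) (by
    have : |(x - Complex.I * (b : ℂ) / 2).im| < (b + b⁻¹) / 2 := by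
      simp [abs_lt]; constructor <;> linarith
    linarith)
  have hk : |(2 * b * x : ℂ).im| < 1 := by
    have : (2 * b * x : ℂ).im = 2 * b * x.im := by simp
    rw [this, abs_mul, abs_of_pos (by positivity)]
    rw [lt_div_iff₀ (by positivity)] at hx
    linarith
  have hJ := J_val (2 * b * x) hk (ε / b) hd hd'
  unfold wb
  set I1 := ∫ t : ℝ, Complex.exp (-(2 * Complex.I * ((t : ℂ) + Complex.I * (ε : ℂ)) *
    (x + Complex.I * (b : ℂ) / 2))) / (4 * ((t : ℂ) + Complex.I * (ε : ℂ)) *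
          Complex.sinh ((b : ℂ) * ((t : ℂ) + Complex.I * (ε : ℂ))) *
          Complex.sinh (((t : ℂ) + Complex.I * (ε : ℂ)) / (b : ℂ))) with hI1
  set I2 := ∫ t : ℝ, Complex.exp (-(2 * Complex.I * ((t : ℂ) + Complex.I * (ε : ℂ)) *
    (x - Complex.I * (b : ℂ) / 2))) / (4 * ((t : ℂ) + Complex.I * (ε : ℂ)) *
          Complex.sinh ((b : ℂ) * ((t : ℂ) + Complex.I * (ε : ℂ))) *
          Complex.sinh (((t : ℂ) + Complex.I * (ε : ℂ)) / (b : ℂ))) with hI2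
  set J := ∫ t : ℝ, Complex.exp (-(Complex.I * (2 * b * x) * (t + (ε / b : ℝ) * Complex.I))) /
      (2 * (t + (ε / b : ℝ) * Complex.I) * Complex.sinh (t + (ε / b : ℝ) * Complex.I)) with hJd
  have hdiff : I1 - I2 = J := by
    rw [hI1, hI2, ← integral_sub i1 i2]
    have e : ∀ t : ℝ, Complex.exp (-(2 * Complex.I * ((t : ℂ) + Complex.I * (ε : ℂ)) *
        (x + Complex.I * (b : ℂ) / 2))) / (4 * ((t : ℂ) + Complex.I * (ε : ℂ)) *
          Complex.sinh ((b : ℂ) * ((t : ℂ) + Complex.I * (ε : ℂ))) *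
          Complex.sinh (((t : ℂ) + Complex.I * (ε : ℂ)) / (b : ℂ))) -
        Complex.exp (-(2 * Complex.I * ((t : ℂ) + Complex.I * (ε : ℂ)) *
        (x - Complex.I * (b : ℂ) / 2))) / (4 * ((t : ℂ) + Complex.I * (ε : ℂ)) *
          Complex.sinh ((b : ℂ) * ((t : ℂ) + Complex.I * (ε : ℂ))) *
          Complex.sinh (((t : ℂ) + Complex.I * (ε : ℂ)) / (b : ℂ))) =
        (b⁻¹ : ℂ) * (fun t : ℝ =>
          Complex.exp (-(Complex.I * (2 * b * x) * (t + (ε / b : ℝ) * Complex.I))) /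
      (2 * (t + (ε / b : ℝ) * Complex.I) * Complex.sinh (t + (ε / b : ℝ) * Complex.I))) (b⁻¹ * t) := by
      intro t
      set s : ℂ := (t : ℂ) + Complex.I * (ε : ℂ) with hs
      have hs0 : s ≠ 0 := by
        rw [hs, mul_comm]; exact u_ne t ε hε0
      have n1 : Complex.sinh (b * s) ≠ 0 := by
        have : (b : ℂ) * s = ((b * t : ℝ) : ℂ) + ((b * ε : ℝ) : ℂ) * Complex.I := by
          rw [hs]; push_cast; ring
        rw [this]; exact sinh_ne s1
      have n2 : Complex.sinh (s / b) ≠ 0 := by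
        have : s / b = ((t / b : ℝ) : ℂ) + ((ε / b : ℝ) : ℂ) * Complex.I := by
          rw [hs]; push_cast; ring
        rw [this]; exact sinh_ne s2
      have e0 : (((b⁻¹ * t : ℝ) : ℂ) + (ε / b : ℝ) * Complex.I) = s / b := by
        rw [hs]; push_cast; ring
      simp only [e0]
      have x1 : Complex.exp (-(2 * Complex.I * s * (x + Complex.I * (b : ℂ) / 2))) =
          Complex.exp (-(2 * Complex.I * s * x)) * Complex.exp (b * s) := by
        rw [← Complex.exp_add]; congr 1
        linear_combination (-(s * b) : ℂ) * Complex.I_sq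
      have x2 : Complex.exp (-(2 * Complex.I * s * (x - Complex.I * (b : ℂ) / 2))) =
          Complex.exp (-(2 * Complex.I * s * x)) * Complex.exp (-(b * s)) := by
        rw [← Complex.exp_add]; congr 1
        linear_combination ((s * b) : ℂ) * Complex.I_sq
      have x3 : -(Complex.I * (2 * b * x) * (s / b)) = -(2 * Complex.I * s * x) := by
        field_simp
      have x4 : Complex.exp (b * s) - Complex.exp (-(b * s)) = 2 * Complex.sinh (b * s) := by
        rw [Complex.two_sinh]
      rw [x1, x2, x3, ← sub_div, ← mul_sub, x4]
      generalize Complex.sinh (s / b) = S at *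
      generalize Complex.sinh (b * s) = S' at *
      field_simp
      norm_num
    simp_rw [e]
    have hcv := Measure.integral_comp_mul_left (fun t : ℝ =>
          Complex.exp (-(Complex.I * (2 * b * x) * (t + (ε / b : ℝ) * Complex.I))) /
      (2 * (t + (ε / b : ℝ) * Complex.I) * Complex.sinh (t + (ε / b : ℝ) * Complex.I))) b⁻¹
    rw [integral_const_mul, hcv, inv_inv, abs_of_pos hb,
      Complex.real_smul, ← mul_assoc, inv_mul_cancel₀ hbc, one_mul]
  have hI : I1 = I2 + J := by rw [← hdiff]; ring
  have hEJ : Complex.exp (-J) = 1 + Complex.exp (Real.pi * (2 * b * x)) := by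
    rw [Complex.exp_neg]
    exact inv_eq_of_mul_eq_one_right hJ
  have hc : 2 * Complex.cosh (((Real.pi * b : ℝ) : ℂ) * x) =
      Complex.exp (-(Real.pi * b * x)) * Complex.exp (-J) := by
    rw [hEJ, Complex.two_cosh, mul_add, ← Complex.exp_add, mul_one, add_comm]
    push_cast
    congr 2; ring
  rw [hc, ← Complex.exp_add, ← Complex.exp_add, hI]
  congr 1
  linear_combination (Real.pi * b * x : ℂ) * Complex.I_sq
end
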